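/- Suppose η > 0, k ≥ 5 and 2 ≤ ℓ < k/2. Then there exists n₀ such that every k-graph H on n ≥ n₀ vertices with (k−ℓ) ∣ n and δ_ℓ(H) ≥ (max{(1/2)^{(k−ℓ)/ℓ}, t(k,ℓ,ℓ)} + η)·C(n, k−ℓ) contains a Hamilton ℓ-cycle; consequently h_ℓ^ℓ(k) ≤ max{(1/2)^{(k−ℓ)/ℓ}, t(k,ℓ,ℓ)}. -/

import Mathlib

/-- `H` is a `k`-uniform hypergraph (a `k`-graph) on the vertex set `Fin n`. -/
def IsKGraph (n k : ℕ) (H : Finset (Finset (Fin n))) : Prop :=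
  ∀ e ∈ H, e.card = k

/-- The degree `deg_H(S)` of a vertex set `S` in the `k`-graph `H`: the number of
`(k - |S|)`-sets `T` disjoint from `S` with `S ∪ T ∈ H`. -/
noncomputable def hDeg (n k : ℕ) (H : Finset (Finset (Fin n))) (S : Finset (Fin n)) : ℕ :=
  Nat.card {T : Finset (Fin n) // T.card = k - S.card ∧ Disjoint S T ∧ S ∪ T ∈ H}

/-- The minimum `d`-degree `δ_d(H)` of a `k`-graph `H` on `Fin n`. -/
noncomputable def minDeg (n k d : ℕ) (H : Finset (Finset (Fin n))) : ℕ :=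
  sInf { m : ℕ | ∃ S : Finset (Fin n), S.card = d ∧ hDeg n k H S = m }

/-- `H` contains a Hamilton `ℓ`-cycle: there is a cyclic ordering of all the vertices such
that the `n / (k - ℓ)` segments of `k` consecutive vertices starting at the positions
divisible by `k - ℓ` are all edges of `H` (hence every two consecutive edges share
exactly `ℓ` vertices). -/
def HasHamiltonCycle (n k l : ℕ) (H : Finset (Finset (Fin n))) : Prop :=
  ∃ f : ZMod n → Fin n, Function.Bijective f ∧
    ∀ j < n / (k - l),
      ((Finset.range k).image (fun i => f ((j * (k - l) + i : ℕ) : ZMod n))) ∈ H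

/-- `f` enumerates (the vertices, in order, of) an `ℓ`-path with `t` edges in `H`:
the `j`-th edge consists of the `k` consecutive vertices starting at position `j * (k - ℓ)`,
so every two consecutive edges share exactly `ℓ` vertices. -/
def IsLPath (n k l t : ℕ) (H : Finset (Finset (Fin n))) (f : ℕ → Fin n) : Prop :=
  Set.InjOn f (Set.Iio (t * (k - l) + l)) ∧
  ∀ j < t, ((Finset.range k).image (fun i => f (j * (k - l) + i))) ∈ H

/-- The vertex set of the `ℓ`-path with `t` edges enumerated by `f`. -/
def pathVerts (n k l t : ℕ) (f : ℕ → Fin n) : Finset (Fin n) :=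
  (Finset.range (t * (k - l) + l)).image f

/-- The first `ℓ` vertices (as an ordered `ℓ`-set) of the path enumerated by `f`. -/
def pathBeg (n l : ℕ) (f : ℕ → Fin n) : Fin l → Fin n := fun i => f (i : ℕ)

/-- The last `ℓ` vertices (as an ordered `ℓ`-set) of an `ℓ`-path with `t` edges
enumerated by `f`. -/
def pathEnd (n k l t : ℕ) (f : ℕ → Fin n) : Fin l → Fin n := fun i => f (t * (k - l) + (i : ℕ))

/-- `T` is a reachable set for the pair `{u, v}` (with parameter `i`): there are
vertex-disjoint `ℓ`-paths `P₁, …, Pᵢ` of length two covering exactly `T ∪ {u}` and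
vertex-disjoint `ℓ`-paths `P₁', …, Pᵢ'` of length two covering exactly `T ∪ {v}`,
where `P_j` and `P_j'` have the same (ordered) ends for all `j`. -/
def ReachSet (n k l i : ℕ) (H : Finset (Finset (Fin n))) (u v : Fin n)
    (T : Finset (Fin n)) : Prop :=
  ∃ P P' : Fin i → ℕ → Fin n,
    (∀ j, IsLPath n k l 2 H (P j)) ∧ (∀ j, IsLPath n k l 2 H (P' j)) ∧
    (∀ j j', j ≠ j' → Disjoint (pathVerts n k l 2 (P j)) (pathVerts n k l 2 (P j'))) ∧
    (∀ j j', j ≠ j' → Disjoint (pathVerts n k l 2 (P' j)) (pathVerts n k l 2 (P' j'))) ∧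
    (Finset.univ.biUnion (fun j => pathVerts n k l 2 (P j)) = insert u T) ∧
    (Finset.univ.biUnion (fun j => pathVerts n k l 2 (P' j)) = insert v T) ∧
    (∀ j, pathBeg n l (P j) = pathBeg n l (P' j) ∧
      pathEnd n k l 2 (P j) = pathEnd n k l 2 (P' j))

/-- `u` and `v` are `(β, i)`-reachable in the `k`-graph `H` on `n` vertices: there are at
least `β * n ^ ((2k - ℓ) i - 1)` sets `T` of size `(2k - ℓ) i - 1` that are reachable sets
for `{u, v}`. -/
def Reachable (n k l : ℕ) (H : Finset (Finset (Fin n))) (β : ℝ) (i : ℕ) (u v : Fin n) : Prop :=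
  β * (n : ℝ) ^ ((2 * k - l) * i - 1) ≤
    (Nat.card {T : Finset (Fin n) // T.card = (2 * k - l) * i - 1 ∧
      ReachSet n k l i H u v T} : ℝ)

/-- `H` contains a `Y_{k,2ℓ}`-tiling (vertex-disjoint copies of the `k`-graph consisting of
two edges intersecting in exactly `2ℓ` vertices) covering all but at most `u` vertices. -/
def HasYTilingCover (n l : ℕ) (H : Finset (Finset (Fin n))) (u : ℝ) : Prop :=
  ∃ (m : ℕ) (e₁ e₂ : Fin m → Finset (Fin n)),
    (∀ j, e₁ j ∈ H ∧ e₂ j ∈ H ∧ ((e₁ j) ∩ (e₂ j)).card = 2 * l) ∧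
    (∀ j j', j ≠ j' → Disjoint ((e₁ j) ∪ (e₂ j)) ((e₁ j') ∪ (e₂ j'))) ∧
    (n : ℝ) - ((Finset.univ.biUnion fun j => (e₁ j) ∪ (e₂ j)).card : ℝ) ≤ u

/-- The tiling threshold `t_d^ℓ(k, n, ε)`: the minimum `t` such that every `k`-graph `H`
on `n` vertices with `δ_d(H) ≥ t` contains a `Y_{k,2ℓ}`-tiling covering all but at most
`ε n` vertices. -/
noncomputable def tThreshold (k d l n : ℕ) (ε : ℝ) : ℕ :=
  sInf { t : ℕ | ∀ H : Finset (Finset (Fin n)), IsKGraph n k H →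
    t ≤ minDeg n k d H → HasYTilingCover n l H (ε * n) }

/-- `t(k,d,ℓ) := limsup_{ε → 0⁺} limsup_{n → ∞} t_d^ℓ(k,n,ε) / C(n, k-d)`. -/
noncomputable def tVal (k d l : ℕ) : ℝ :=
  Filter.limsup
    (fun ε : ℝ => Filter.limsup
      (fun n : ℕ => (tThreshold k d l n ε : ℝ) / (n.choose (k - d) : ℝ)) Filter.atTop)
    (nhdsWithin (0 : ℝ) (Set.Ioi (0 : ℝ)))

/-- The Dirac threshold `h_d^ℓ(k, n)`: the smallest `h` such that every `k`-graph `H` on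
`n` vertices with `δ_d(H) ≥ h` contains a Hamilton `ℓ`-cycle. -/
noncomputable def hThreshold (k d l n : ℕ) : ℕ :=
  sInf { h : ℕ | ∀ H : Finset (Finset (Fin n)), IsKGraph n k H →
    h ≤ minDeg n k d H → HasHamiltonCycle n k l H }

/-- `h_d^ℓ(k) := limsup_{n → ∞, (k-ℓ) ∣ n} h_d^ℓ(k,n) / C(n, k-d)`. -/
noncomputable def hVal (k d l : ℕ) : ℝ :=
  Filter.limsup (fun n : ℕ => (hThreshold k d l n : ℝ) / (n.choose (k - d) : ℝ))
    (Filter.atTop ⊓ Filter.principal { m : ℕ | (k - l) ∣ m })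

/-- The generalized binomial coefficient `C(x, r)` for a real `x`. -/
noncomputable def genChoose (x : ℝ) (r : ℕ) : ℝ :=
  (∏ i ∈ Finset.range r, (x - (i : ℝ))) / (r.factorial : ℝ)

/-- The number of sets in the `ε`-robust `r`-shadow `∂_ε^r(G)` of the `K`-graph `G` on
`Fin n`: the number of `(K - r)`-sets lying in more than `ε * n ^ r` edges of `G`. -/
noncomputable def shadowCard (n K r : ℕ) (G : Finset (Finset (Fin n))) (ε : ℝ) : ℕ :=
  Nat.card {F : Finset (Fin n) // F.card = K - r ∧ ε * (n : ℝ) ^ r < (hDeg n K G F : ℝ)}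

/-- `g` is an `S`-absorber, given as a `b`-tuple of distinct vertices avoiding `S`: the
tuple spans a family of `2k - 2ℓ + 1` vertex-disjoint `ℓ`-paths, and there is another
family of `2k - 2ℓ + 1` vertex-disjoint `ℓ`-paths, with the same ordered ends, spanning
the tuple together with `S`. -/
def IsAbsorberTuple (n k l b : ℕ) (H : Finset (Finset (Fin n))) (S : Finset (Fin n))
    (g : Fin b → Fin n) : Prop :=
  Function.Injective g ∧ (∀ i, g i ∉ S) ∧
  ∃ (t t' : Fin (2 * k - 2 * l + 1) → ℕ) (Q Q' : Fin (2 * k - 2 * l + 1) → ℕ → Fin n),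
    (∀ j, IsLPath n k l (t j) H (Q j)) ∧ (∀ j, IsLPath n k l (t' j) H (Q' j)) ∧
    (∀ j j', j ≠ j' → Disjoint (pathVerts n k l (t j) (Q j)) (pathVerts n k l (t j') (Q j'))) ∧
    (∀ j j', j ≠ j' →
      Disjoint (pathVerts n k l (t' j) (Q' j)) (pathVerts n k l (t' j') (Q' j'))) ∧
    (∀ j, pathBeg n l (Q j) = pathBeg n l (Q' j) ∧
      pathEnd n k l (t j) (Q j) = pathEnd n k l (t' j) (Q' j)) ∧
    Finset.univ.biUnion (fun j => pathVerts n k l (t' j) (Q' j)) = Finset.image g Finset.univ ∧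
    Finset.univ.biUnion (fun j => pathVerts n k l (t j) (Q j)) = Finset.image g Finset.univ ∪ S

section Paths

variable {α β : Type*} [DecidableEq α] [DecidableEq β]

/-- An edge of `H` split into two disjoint `l`-sets `A`, `B` and the remaining vertices `I`. -/
structure LEdge (H : Finset (Finset α)) (k l : ℕ) (A I B : Finset α) : Prop where
  cardA : A.card = l
  cardI : I.card = k - 2 * l
  cardB : B.card = l
  dAI : Disjoint A I
  dAB : Disjoint A B
  dIB : Disjoint I B
  mem : A ∪ I ∪ B ∈ H

/-- `LP H k l A X B`: there is an `l`-path in `H` whose first `l` vertices form `A`, whose last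
`l` vertices form `B` and whose remaining vertices form `X`. -/
inductive LP (H : Finset (Finset α)) (k l : ℕ) : Finset α → Finset α → Finset α → Prop
  | edge {A I B : Finset α} : LEdge H k l A I B → LP H k l A I B
  | cons {A I C Y B : Finset α} : LEdge H k l A I C → LP H k l C Y B →
      Disjoint (A ∪ I) (C ∪ Y ∪ B) → LP H k l A (I ∪ C ∪ Y) B

variable {H : Finset (Finset α)} {k l : ℕ} {A X B C Y I : Finset α}

theorem LEdge.symm (h : LEdge H k l A I B) : LEdge H k l B I A where
  cardA := h.cardB
  cardI := h.cardI
  cardB := h.cardA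
  dAI := h.dIB.symm
  dAB := h.dAB.symm
  dIB := h.dAI.symm
  mem := by
    have : B ∪ I ∪ A = A ∪ I ∪ B := by ext; simp; tauto
    rw [this]; exact h.mem

theorem LP.basic (h : LP H k l A X B) :
    A.card = l ∧ B.card = l ∧ Disjoint A X ∧ Disjoint A B ∧ Disjoint X B := by
  induction h with
  | edge h => exact ⟨h.cardA, h.cardB, h.dAI, h.dAB, h.dIB⟩
  | cons h _ hd ih =>
    obtain ⟨h1, h2, h3, h4, h5⟩ := ih
    have := h.dAI
    have := h.dAB
    have := h.dIB
    refine ⟨h.cardA, h2, ?_, ?_, ?_⟩ <;>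
    · simp only [Finset.disjoint_union_left, Finset.disjoint_union_right] at *
      tauto

theorem LP.cardA (h : LP H k l A X B) : A.card = l := h.basic.1
theorem LP.cardB (h : LP H k l A X B) : B.card = l := h.basic.2.1
theorem LP.dAX (h : LP H k l A X B) : Disjoint A X := h.basic.2.2.1
theorem LP.dAB (h : LP H k l A X B) : Disjoint A B := h.basic.2.2.2.1
theorem LP.dXB (h : LP H k l A X B) : Disjoint X B := h.basic.2.2.2.2

theorem LP.dvd (hlk : 2 * l < k) (h : LP H k l A X B) : (k - l) ∣ X.card + l := by
  induction h with
  | edge h => rw [h.cardI]; exact ⟨1, by omega⟩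
  | @cons A I C Y B h hp hd ih =>
    have h1 : Disjoint I C := h.dIB
    have h2 : Disjoint C Y := hp.dAX
    have h3 : Disjoint (I ∪ C) Y := by
      simp only [Finset.disjoint_union_left, Finset.disjoint_union_right] at *
      tauto
    rw [Finset.card_union_of_disjoint h3, Finset.card_union_of_disjoint h1, h.cardI, h.cardB]
    have : k - 2 * l + l + Y.card + l = (k - l) + (Y.card + l) := by omega
    rw [this]
    exact (Nat.dvd_add_right (dvd_refl _)).2 ih

theorem LP.trans (h : LP H k l A X C) (h' : LP H k l C Y B) (hd : Disjoint (A ∪ X) (C ∪ Y ∪ B)) :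
    LP H k l A (X ∪ C ∪ Y) B := by
  induction h with
  | edge h => exact LP.cons h h' hd
  | @cons A I D X' C h hp hd' ih =>
    have h1 : Disjoint (D ∪ X') (C ∪ Y ∪ B) := by
      simp only [Finset.disjoint_union_left, Finset.disjoint_union_right] at *
      tauto
    have := ih h' h1
    have e : I ∪ D ∪ X' ∪ C ∪ Y = I ∪ D ∪ (X' ∪ C ∪ Y) := by
      simp only [Finset.union_assoc]
    rw [e]
    refine LP.cons h this ?_
    simp only [Finset.disjoint_union_left, Finset.disjoint_union_right] at *
    tauto

theorem LP.symm (h : LP H k l A X B) : LP H k l B X A := by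
  induction h with
  | edge h => exact LP.edge h.symm
  | @cons A I C Y B h hp hd ih =>
    have e : I ∪ C ∪ Y = Y ∪ C ∪ I := by ext; simp; tauto
    rw [e]
    refine ih.trans (LP.edge h.symm) ?_
    have := hp.dAX
    have := hp.dAB
    have := hp.dXB
    simp only [Finset.disjoint_union_right, disjoint_comm] at *
    tauto

theorem LP.map {K : Finset (Finset β)} {f : β → α} (hf : Function.Injective f)
    (hK : ∀ e ∈ K, e.image f ∈ H) {A X B : Finset β} (h : LP K k l A X B) :
    LP H k l (A.image f) (X.image f) (B.image f) := by
  have key : ∀ {A I B : Finset β}, LEdge K k l A I B →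
      LEdge H k l (A.image f) (I.image f) (B.image f) := by
    intro A I B h
    refine ⟨?_, ?_, ?_, ?_, ?_, ?_, ?_⟩
    · rw [Finset.card_image_of_injective _ hf, h.cardA]
    · rw [Finset.card_image_of_injective _ hf, h.cardI]
    · rw [Finset.card_image_of_injective _ hf, h.cardB]
    · exact (Finset.disjoint_image hf).2 h.dAI
    · exact (Finset.disjoint_image hf).2 h.dAB
    · exact (Finset.disjoint_image hf).2 h.dIB
    · rw [← Finset.image_union, ← Finset.image_union]; exact hK _ h.mem
  induction h with
  | edge h => exact LP.edge (key h)
  | cons h _ hd ih =>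
    rw [Finset.image_union, Finset.image_union]
    refine LP.cons (key h) ih ?_
    rw [← Finset.image_union, ← Finset.image_union, ← Finset.image_union]
    exact (Finset.disjoint_image hf).2 hd

/-- Splitting off the first edge of an `l`-path. -/
theorem LP.first (h : LP H k l A X B) :
    LEdge H k l A X B ∨ ∃ I C Y, LEdge H k l A I C ∧ LP H k l C Y B ∧
      Disjoint (A ∪ I) (C ∪ Y ∪ B) ∧ X = I ∪ C ∪ Y := by
  cases h with
  | edge h => exact Or.inl h
  | cons h hp hd => exact Or.inr ⟨_, _, _, h, hp, hd, rfl⟩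

/-- `f` enumerates the set `S` on `{0, …, s - 1}` injectively. -/
def Enum (f : ℕ → α) (s : ℕ) (S : Finset α) : Prop :=
  Set.InjOn f (Set.Iio s) ∧ (Finset.range s).image f = S

theorem Enum.exists [Nonempty α] (S : Finset α) : ∃ f, Enum f S.card S := by
  obtain ⟨d⟩ := ‹Nonempty α›
  let e := S.equivFin
  refine ⟨fun i => if h : i < S.card then (e.symm ⟨i, h⟩ : α) else d, ?_, ?_⟩
  · intro i hi j hj hij
    simp only [Set.mem_Iio] at hi hj
    simp only [hi, hj, dif_pos] at hij
    have := e.symm.injective (Subtype.ext hij)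
    simpa using this
  · ext x
    simp only [Finset.mem_image, Finset.mem_range]
    constructor
    · rintro ⟨i, hi, rfl⟩
      simp only [hi, dif_pos]
      exact (e.symm ⟨i, hi⟩).2
    · intro hx
      refine ⟨e ⟨x, hx⟩, (e ⟨x, hx⟩).2, ?_⟩
      simp

/-- Follow `f` for `s` steps and then `g`. -/
def glue (s : ℕ) (f g : ℕ → α) : ℕ → α := fun i => if i < s then f i else g (i - s)

theorem image_glue_lt {s t : ℕ} {f g : ℕ → α} (h : t ≤ s) :
    (Finset.range t).image (glue s f g) = (Finset.range t).image f := by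
  apply Finset.image_congr
  intro i hi
  have : i < t := by simpa using hi
  have h2 : i < s := by omega
  simp [glue, h2]

theorem image_glue {s t : ℕ} {f g : ℕ → α} :
    (Finset.range (s + t)).image (glue s f g) =
      (Finset.range s).image f ∪ (Finset.range t).image g := by
  ext x
  simp only [Finset.mem_image, Finset.mem_range, Finset.mem_union, glue]
  constructor
  · rintro ⟨i, hi, rfl⟩
    by_cases h : i < s
    · left; exact ⟨i, h, by simp [h]⟩
    · right; exact ⟨i - s, by omega, by simp [h]⟩
  · rintro (⟨i, hi, rfl⟩ | ⟨i, hi, rfl⟩)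
    · exact ⟨i, by omega, by simp [hi]⟩
    · exact ⟨s + i, by omega, by simp⟩

theorem Enum.glue {s t : ℕ} {f g : ℕ → α} {S T : Finset α} (hf : Enum f s S) (hg : Enum g t T)
    (hST : Disjoint S T) : Enum (glue s f g) (s + t) (S ∪ T) := by
  refine ⟨?_, by rw [image_glue, hf.2, hg.2]⟩
  have hfS : ∀ i < s, f i ∈ S := fun i hi => by
    rw [← hf.2]; exact Finset.mem_image_of_mem _ (by simpa using hi)
  have hgT : ∀ i < t, g i ∈ T := fun i hi => by
    rw [← hg.2]; exact Finset.mem_image_of_mem _ (by simpa using hi)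
  intro i hi j hj hij
  simp only [Set.mem_Iio] at hi hj
  simp only [_root_.glue] at hij
  by_cases h1 : i < s <;> by_cases h2 : j < s
  · simp only [h1, h2, if_true] at hij; exact hf.1 h1 h2 hij
  · simp only [h1, h2, if_true, if_false] at hij
    have := hgT (j - s) (by omega)
    rw [← hij] at this
    exact absurd this (Finset.disjoint_left.1 hST (hfS i h1))
  · simp only [h1, h2, if_true, if_false] at hij
    have := hgT (i - s) (by omega)
    rw [hij] at this
    exact absurd this (Finset.disjoint_left.1 hST (hfS j h2))
  · simp only [h1, h2, if_false] at hij
    have := hg.1 (show i - s ∈ Set.Iio t by simp; omega)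
      (show j - s ∈ Set.Iio t by simp; omega) hij
    omega

theorem LP.enum (hl : 0 < l) (hlk : 2 * l < k) (h : LP H k l A X B) :
    ∃ (t : ℕ) (f : ℕ → α), Enum f (t * (k - l) + l) (A ∪ X ∪ B) ∧
      (Finset.range l).image f = A ∧
      (Finset.range l).image (fun i => f (t * (k - l) + i)) = B ∧
      ∀ j < t, (Finset.range k).image (fun i => f (j * (k - l) + i)) ∈ H := by
  have hne : Nonempty α := by
    have : A.Nonempty := Finset.card_pos.1 (by rw [h.cardA]; exact hl)
    exact ⟨this.choose⟩
  have start : ∀ {A I C : Finset α}, LEdge H k l A I C →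
      ∃ g : ℕ → α, Enum g (k - l) (A ∪ I) ∧ (Finset.range l).image g = A := by
    intro A I C h
    obtain ⟨a, ha⟩ := Enum.exists A
    obtain ⟨i, hi⟩ := Enum.exists I
    rw [h.cardA] at ha
    rw [h.cardI] at hi
    refine ⟨_root_.glue l a i, ?_, ?_⟩
    · have := ha.glue hi h.dAI
      have e : l + (k - 2 * l) = k - l := by omega
      rwa [e] at this
    · rw [image_glue_lt le_rfl, ha.2]
  induction h with
  | @edge A I B h =>
    obtain ⟨g, hg, hgA⟩ := start h
    obtain ⟨b, hb⟩ := Enum.exists B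
    rw [h.cardB] at hb
    have hd : Disjoint (A ∪ I) B := Finset.disjoint_union_left.2 ⟨h.dAB, h.dIB⟩
    have hE := hg.glue hb hd
    refine ⟨1, _root_.glue (k - l) g b, by simpa using hE, ?_, ?_, ?_⟩
    · rw [image_glue_lt (by omega), hgA]
    · rw [← hb.2]
      apply Finset.image_congr
      intro i _
      simp [_root_.glue]
    · intro j hj
      have : j = 0 := by omega
      subst this
      have e : k - l + l = k := by omega
      rw [e] at hE
      simp only [zero_mul, zero_add]
      rw [hE.2]; exact h.mem
  | @cons A I C Y B h hp hd ih =>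
    obtain ⟨t, f, hf, hfC, hfB, hfe⟩ := ih
    obtain ⟨g, hg, hgA⟩ := start h
    have hE := hg.glue hf hd
    refine ⟨t + 1, _root_.glue (k - l) g f, ?_, ?_, ?_, ?_⟩
    · have e : (t + 1) * (k - l) + l = k - l + (t * (k - l) + l) := by ring
      have e' : A ∪ (I ∪ C ∪ Y) ∪ B = A ∪ I ∪ (C ∪ Y ∪ B) := by
        simp only [Finset.union_assoc]
      rw [e, e']; exact hE
    · rw [image_glue_lt (by omega), hgA]
    · rw [← hfB]
      apply Finset.image_congr
      intro i _
      have h1 : ¬ (t + 1) * (k - l) + i < k - l := by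
        have : (k - l) ≤ (t + 1) * (k - l) := Nat.le_mul_of_pos_left _ (by omega)
        omega
      have h2 : (t + 1) * (k - l) + i - (k - l) = t * (k - l) + i := by
        rw [Nat.add_mul, one_mul]; omega
      simp [_root_.glue, h1, h2]
    · intro j hj
      rcases Nat.eq_zero_or_pos j with rfl | hj0
      · have e : k = k - l + l := by omega
        simp only [zero_mul, zero_add]
        have e' := image_glue (s := k - l) (t := l) (f := g) (g := f)
        rw [← e, hg.2, hfC] at e'
        rw [e']
        exact h.mem
      · obtain ⟨j, rfl⟩ : ∃ j', j = j' + 1 := ⟨j - 1, by omega⟩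
        have := hfe j (by omega)
        convert this using 1
        apply Finset.image_congr
        intro i _
        have h1 : ¬ (j + 1) * (k - l) + i < k - l := by
          have : (k - l) ≤ (j + 1) * (k - l) := Nat.le_mul_of_pos_left _ (by omega)
          omega
        have h2 : (j + 1) * (k - l) + i - (k - l) = j * (k - l) + i := by
          rw [Nat.add_mul, one_mul]; omega
        simp [_root_.glue, h1, h2]

end Paths

theorem hasHamiltonCycle_of_edge {n k l : ℕ} (hl : 0 < l) (hlk : 2 * l < k)
    {H : Finset (Finset (Fin n))} {A X B J : Finset (Fin n)}
    (h : LP H k l A X B) (he : LEdge H k l B J A) (hXJ : Disjoint X J)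
    (hcov : A ∪ X ∪ B ∪ J = Finset.univ) : HasHamiltonCycle n k l H := by
  obtain ⟨t, f, hf, hfA, hfB, hfe⟩ := h.enum hl hlk
  have hne : Nonempty (Fin n) := by
    have : A.Nonempty := Finset.card_pos.1 (by rw [h.cardA]; exact hl)
    exact ⟨this.choose⟩
  obtain ⟨g, hg⟩ := Enum.exists J
  rw [he.cardI] at hg
  have hd : Disjoint (A ∪ X ∪ B) J := by
    have := he.dAI
    have := he.dIB
    simp only [Finset.disjoint_union_left]
    exact ⟨⟨this.symm, hXJ⟩, he.dAI⟩
  have hE := hf.glue hg hd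
  rw [hcov] at hE
  set F := glue (t * (k - l) + l) f g with hF
  have hn : t * (k - l) + l + (k - 2 * l) = n := by
    have h1 := congrArg Finset.card hE.2
    rw [Finset.card_image_of_injOn (by
      intro i hi j hj; exact hE.1 (by simpa using hi) (by simpa using hj))] at h1
    simpa using h1
  rw [hn] at hE
  have hn' : n = (t + 1) * (k - l) := by rw [← hn, Nat.add_mul]; omega
  have hn0 : 0 < n := by rw [hn']; exact Nat.mul_pos (by omega) (by omega)
  have : NeZero n := ⟨hn0.ne'⟩
  refine ⟨fun z => F z.val, ?_, ?_⟩
  · have hinj : Function.Injective (fun z : ZMod n => F z.val) := by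
      intro a b hab
      have := hE.1 (ZMod.val_lt a) (ZMod.val_lt b) hab
      exact ZMod.val_injective n this
    refine ⟨hinj, ?_⟩
    intro x
    have hx : x ∈ (Finset.range n).image F := by rw [hE.2]; simp
    obtain ⟨i, hi, rfl⟩ := Finset.mem_image.1 hx
    refine ⟨(i : ZMod n), ?_⟩
    simp only
    rw [ZMod.val_cast_of_lt (by simpa using hi)]
  · intro j hj
    rw [hn', Nat.mul_div_cancel _ (by omega)] at hj
    simp only [ZMod.val_natCast]
    rcases Nat.lt_succ_iff_lt_or_eq.1 hj with hj | rfl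
    · have := hfe j hj
      convert this using 1
      apply Finset.image_congr
      intro i hi
      have hi : i < k := by simpa using hi
      have h1 : (j + 1) * (k - l) ≤ t * (k - l) := Nat.mul_le_mul_right _ hj
      rw [Nat.add_mul, one_mul] at h1
      have h2 : j * (k - l) + i < t * (k - l) + l := by omega
      have h3 : j * (k - l) + i < n := by omega
      simp only
      rw [Nat.mod_eq_of_lt h3, hF]
      simp [glue, h2]
    · have e : (Finset.range k).image (fun i => F ((j * (k - l) + i) % n)) = B ∪ J ∪ A := by
        rw [← hfA, ← hfB, ← hg.2]
        ext x
        simp only [Finset.mem_image, Finset.mem_range, Finset.mem_union]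
        constructor
        · rintro ⟨i, hi, rfl⟩
          by_cases h1 : i < l
          · left; left
            refine ⟨i, h1, ?_⟩
            rw [Nat.mod_eq_of_lt (by omega), hF]
            simp [glue, h1]
          · by_cases h2 : i < k - l
            · left; right
              refine ⟨i - l, by omega, ?_⟩
              rw [Nat.mod_eq_of_lt (by omega), hF]
              have h4 : ¬ j * (k - l) + i < j * (k - l) + l := by omega
              have h5 : j * (k - l) + i - (j * (k - l) + l) = i - l := by omega
              simp only [glue, h4, if_false, h5]
            · right
              refine ⟨i - (k - l), by omega, ?_⟩
              have h3 : j * (k - l) + i = (i - (k - l)) + n := by omega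
              rw [h3, Nat.add_mod_right, Nat.mod_eq_of_lt (by omega), hF]
              have h4 : i - (k - l) < j * (k - l) + l := by omega
              simp only [glue, h4, if_true]
        · rintro ((⟨i, hi, rfl⟩ | ⟨i, hi, rfl⟩) | ⟨i, hi, rfl⟩)
          · refine ⟨i, by omega, ?_⟩
            rw [Nat.mod_eq_of_lt (by omega), hF]
            simp [glue, hi]
          · refine ⟨i + l, by omega, ?_⟩
            rw [Nat.mod_eq_of_lt (by omega), hF]
            have h4 : ¬ j * (k - l) + (i + l) < j * (k - l) + l := by omega
            have h5 : j * (k - l) + (i + l) - (j * (k - l) + l) = i := by omega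
            simp only [glue, h4, if_false, h5]
          · refine ⟨i + (k - l), by omega, ?_⟩
            have h3 : j * (k - l) + (i + (k - l)) = i + n := by omega
            rw [h3, Nat.add_mod_right, Nat.mod_eq_of_lt (by omega), hF]
            have h4 : i < j * (k - l) + l := by omega
            simp only [glue, h4, if_true]
      rw [e]
      exact he.mem

theorem hasHamiltonCycle_of_paths {n k l : ℕ} (hl : 0 < l) (hlk : 2 * l < k)
    {H : Finset (Finset (Fin n))} {A X B Y : Finset (Fin n)}
    (h : LP H k l A X B) (h' : LP H k l B Y A) (hXY : Disjoint X Y)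
    (hcov : A ∪ X ∪ B ∪ Y = Finset.univ) : HasHamiltonCycle n k l H := by
  rcases h'.symm.first with he | ⟨J, C, Y', he, hp, hd, rfl⟩
  · exact hasHamiltonCycle_of_edge hl hlk h he.symm hXY hcov
  · have hp' := hp.symm
    have h1 := h.dXB
    have h2 := h.dAB
    have h3 := h.dAX
    have h4 := hp.dAB
    have h5 := hp.dAX
    have h6 := hp.dXB
    have h7 := he.dIB
    have hLP := h.trans hp' (by
      simp only [Finset.disjoint_union_right, disjoint_comm] at *
      tauto)
    refine hasHamiltonCycle_of_edge hl hlk hLP he.symm ?_ ?_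
    · simp only [Finset.disjoint_union_right, disjoint_comm] at *
      tauto
    · rw [← hcov]; ext x; simp only [Finset.mem_union]; tauto

section Concentration

open Finset

variable {V : Type*} [Fintype V]

theorem exp_moment [Nonempty V] {s : ℝ} (hs0 : 0 ≤ s) (hs1 : s ≤ 1) (m : ℕ) :
    ∀ f : (Fin m → V) → ℝ,
      (∀ x y : Fin m → V, ∀ i, (∀ j, j ≠ i → x j = y j) → f x - f y ≤ 1) →
      ∀ μ : ℝ, ∑ x, f x = μ * (Fintype.card V : ℝ) ^ m →
      ∑ x, Real.exp (-s * f x) ≤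
        (Fintype.card V : ℝ) ^ m * Real.exp (-s * μ + m * s ^ 2) := by
  induction m with
  | zero =>
    intro f _ μ hμ
    simp at hμ ⊢
    rw [hμ]
  | succ m ih =>
    intro f hf μ hμ
    have hn : (0 : ℝ) < Fintype.card V := by exact_mod_cast Fintype.card_pos
    set N : ℝ := (Fintype.card V : ℝ) with hN
    have split : ∀ g : (Fin (m + 1) → V) → ℝ,
        ∑ x, g x = ∑ a : V, ∑ y : Fin m → V, g (Fin.cons a y) := by
      intro g
      rw [← Fintype.sum_prod_type', ← (Fin.consEquiv (fun _ : Fin (m + 1) => V)).sum_comp]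
      rfl
    set ν : V → ℝ := fun a => (∑ y : Fin m → V, f (Fin.cons a y)) / N ^ m with hν
    have hνs : ∀ a, ∑ y : Fin m → V, f (Fin.cons a y) = ν a * N ^ m := by
      intro a
      rw [hν]; field_simp
    have h1 : ∀ a, ∑ y : Fin m → V, Real.exp (-s * f (Fin.cons a y)) ≤
        N ^ m * Real.exp (-s * ν a + m * s ^ 2) := by
      intro a
      refine ih (fun y => f (Fin.cons a y)) ?_ (ν a) (hνs a)
      intro x y i hxy
      refine hf _ _ i.succ ?_
      intro j
      refine Fin.cases ?_ ?_ j
      · intro _; simp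
      · intro j hj
        simp only [Fin.cons_succ]
        exact hxy j (fun h => hj (by rw [h]))
    have hνμ : ∑ a, ν a = μ * N := by
      have : (∑ a, ν a) * N ^ m = μ * N * N ^ m := by
        rw [Finset.sum_mul, ← Finset.sum_congr rfl (fun a _ => hνs a), ← split, hμ]
        ring
      exact mul_right_cancel₀ (by positivity) this
    have hνd : ∀ a b, ν a - ν b ≤ 1 := by
      intro a b
      rw [hν]
      simp only
      rw [← sub_div, div_le_one (by positivity), ← Finset.sum_sub_distrib]
      calc _ ≤ ∑ y : Fin m → V, (1 : ℝ) := by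
            refine Finset.sum_le_sum fun y _ => hf _ _ 0 ?_
            intro j
            refine Fin.cases ?_ ?_ j
            · intro h; exact absurd rfl h
            · intro j _; simp
        _ = N ^ m := by simp [hN]
    have hνμ' : ∀ a, |ν a - μ| ≤ 1 := by
      intro a
      have e1 : (ν a - μ) * N = ∑ b : V, (ν a - ν b) := by
        rw [Finset.sum_sub_distrib, hνμ]; simp [hN]; ring
      rw [abs_le]
      constructor
      · have : -1 * N ≤ (ν a - μ) * N := by
          rw [e1]
          calc -1 * N = ∑ b : V, (-1 : ℝ) := by simp [hN]
            _ ≤ _ := Finset.sum_le_sum fun b _ => by linarith [hνd b a]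
        exact le_of_mul_le_mul_right this hn
      · have : (ν a - μ) * N ≤ 1 * N := by
          rw [e1]
          calc _ ≤ ∑ b : V, (1 : ℝ) := Finset.sum_le_sum fun b _ => hνd a b
            _ = 1 * N := by simp [hN]
        exact le_of_mul_le_mul_right this hn
    have h2 : ∀ a, Real.exp (-s * (ν a - μ)) ≤ 1 - s * (ν a - μ) + s ^ 2 := by
      intro a
      have habs : |(-s * (ν a - μ))| ≤ 1 := by
        rw [abs_mul, abs_neg, abs_of_nonneg hs0]
        nlinarith [hνμ' a, abs_nonneg (ν a - μ)]
      have := Real.abs_exp_sub_one_sub_id_le habs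
      have h3 := (abs_le.1 this).2
      have h4 : (ν a - μ) ^ 2 ≤ 1 := by
        rw [← sq_abs]; nlinarith [hνμ' a, abs_nonneg (ν a - μ)]
      have h5 : (-s * (ν a - μ)) ^ 2 ≤ s ^ 2 := by
        rw [mul_pow, neg_sq]; nlinarith [sq_nonneg s]
      linarith
    have h3 : ∑ a, Real.exp (-s * (ν a - μ)) ≤ N * Real.exp (s ^ 2) := by
      calc _ ≤ ∑ a : V, (1 - s * (ν a - μ) + s ^ 2) := Finset.sum_le_sum fun a _ => h2 a
        _ = N * (1 + s ^ 2) := by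
          rw [Finset.sum_add_distrib, Finset.sum_sub_distrib, ← Finset.mul_sum,
            Finset.sum_sub_distrib, hνμ]
          simp [hN]; ring
        _ ≤ _ := by
          have := Real.add_one_le_exp (s ^ 2)
          have : 1 + s ^ 2 ≤ Real.exp (s ^ 2) := by linarith
          exact mul_le_mul_of_nonneg_left this hn.le
    rw [split]
    calc _ ≤ ∑ a, N ^ m * Real.exp (-s * ν a + m * s ^ 2) := Finset.sum_le_sum fun a _ => h1 a
      _ = N ^ m * Real.exp (-s * μ + m * s ^ 2) * ∑ a, Real.exp (-s * (ν a - μ)) := by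
        rw [Finset.mul_sum]
        refine Finset.sum_congr rfl fun a _ => ?_
        rw [mul_assoc, ← Real.exp_add]; congr 2; ring
      _ ≤ N ^ m * Real.exp (-s * μ + m * s ^ 2) * (N * Real.exp (s ^ 2)) := by
        refine mul_le_mul_of_nonneg_left h3 (by positivity)
      _ = _ := by
        rw [show N ^ m * Real.exp (-s * μ + m * s ^ 2) * (N * Real.exp (s ^ 2)) =
          N ^ m * N * (Real.exp (-s * μ + m * s ^ 2) * Real.exp (s ^ 2)) by ring,
          ← Real.exp_add, pow_succ]
        congr 2
        push_cast; ring

/-- McDiarmid's inequality (lower tail) on a finite power. -/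
theorem mcdiarmid [Nonempty V] {m : ℕ} {c a μ : ℝ} (hc : 0 < c) (ha : 0 ≤ a) (ha2 : a ≤ 2)
    (f : (Fin m → V) → ℝ)
    (hf : ∀ x y : Fin m → V, ∀ i, (∀ j, j ≠ i → x j = y j) → f x - f y ≤ c)
    (hμ : μ * (Fintype.card V : ℝ) ^ m ≤ ∑ x, f x) (P : (Fin m → V) → Prop) [DecidablePred P]
    (hP : ∀ x, P x → f x ≤ μ - a * m * c) :
    ((univ.filter P).card : ℝ) ≤
      (Fintype.card V : ℝ) ^ m * Real.exp (-(m * a ^ 2 / 4)) := by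
  have hn : (0 : ℝ) < Fintype.card V := by exact_mod_cast Fintype.card_pos
  set N : ℝ := (Fintype.card V : ℝ) with hN
  set ν : ℝ := (∑ x, f x) / N ^ m with hν
  have hνμ : μ ≤ ν := by rw [hν, le_div_iff₀ (by positivity)]; exact hμ
  have key := exp_moment (V := V) (s := a / 2) (by linarith) (by linarith) m
    (fun x => f x / c)
    (fun x y i h => by rw [← sub_div, div_le_one hc]; exact hf x y i h) (ν / c)
    (by rw [← Finset.sum_div, ← hN, hν]; field_simp)
  have h1 : ((univ.filter P).card : ℝ) * Real.exp (-(a / 2) * (ν / c) + a / 2 * (a * m)) ≤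
      ∑ x, Real.exp (-(a / 2) * (f x / c)) := by
    calc _ = ∑ x ∈ univ.filter P, Real.exp (-(a / 2) * (ν / c) + a / 2 * (a * m)) := by
          simp
      _ ≤ ∑ x ∈ univ.filter P, Real.exp (-(a / 2) * (f x / c)) := by
          refine Finset.sum_le_sum fun x hx => ?_
          rw [Real.exp_le_exp]
          have := hP x (Finset.mem_filter.1 hx).2
          have h2 : f x / c ≤ ν / c - a * m := by
            rw [div_le_iff₀ hc, sub_mul, div_mul_cancel₀ _ hc.ne']; linarith
          nlinarith
      _ ≤ _ := Finset.sum_le_sum_of_subset_of_nonneg (Finset.filter_subset _ _)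
          fun _ _ _ => (Real.exp_pos _).le
  have h2 := h1.trans key
  rw [← le_div_iff₀ (Real.exp_pos _), mul_div_assoc, ← Real.exp_sub] at h2
  refine h2.trans (le_of_eq ?_)
  congr 2
  ring

end Concentration

section Counting

open Finset

/-- `H` is `k`-uniform and every `l`-set lies in at least `d * C(|V|, k - l)` edges. -/
def DegDense {V : Type*} [Fintype V] [DecidableEq V] (k l : ℕ) (d : ℝ)
    (H : Finset (Finset V)) : Prop :=
  (∀ e ∈ H, e.card = k) ∧
    ∀ S : Finset V, S.card = l →
      d * ((Fintype.card V).choose (k - l) : ℝ) ≤ ((H.filter (S ⊆ ·)).card : ℝ)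

variable {V : Type*} [Fintype V] [DecidableEq V] {m k l : ℕ} {d : ℝ} {H : Finset (Finset V)}

theorem DegDense.mono (h : DegDense k l d H) {d' : ℝ} (hd : d' ≤ d) : DegDense k l d' H :=
  ⟨h.1, fun S hS => (mul_le_mul_of_nonneg_right hd (by positivity)).trans (h.2 S hS)⟩

theorem card_image_eq_ge (T : Finset (Fin m)) (T₀ : Finset V) (h : T.card = T₀.card) :
    T.card.factorial * Fintype.card V ^ (m - T.card) ≤
      (univ.filter fun x : Fin m → V => T.image x = T₀).card := by
  classical
  have e : T ≃ T₀ := Finset.equivOfCardEq h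
  let F : (T ≃ T₀) × ({i // i ∉ T} → V) → (Fin m → V) := fun p i =>
    if hi : i ∈ T then (p.1 ⟨i, hi⟩ : V) else p.2 ⟨i, hi⟩
  have hF : Function.Injective F := by
    rintro ⟨σ, y⟩ ⟨σ', y'⟩ hxy
    have h1 : σ = σ' := by
      ext ⟨i, hi⟩
      have := congrFun hxy i
      simpa [F, hi] using this
    have h2 : y = y' := by
      ext ⟨i, hi⟩
      have := congrFun hxy i
      simpa [F, hi] using this
    rw [h1, h2]
  have hcard : Fintype.card ((T ≃ T₀) × ({i // i ∉ T} → V)) =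
      T.card.factorial * Fintype.card V ^ (m - T.card) := by
    rw [Fintype.card_prod, Fintype.card_equiv e, Fintype.card_fun]
    congr 2
    · simp
    · rw [Fintype.card_subtype_compl]; simp
  rw [← hcard, ← Finset.card_univ]
  refine Finset.card_le_card_of_injOn F ?_ hF.injOn
  rintro ⟨σ, y⟩ _
  simp only [coe_filter, mem_univ, true_and, Set.mem_ofPred_eq]
  ext v
  simp only [mem_image]
  constructor
  · rintro ⟨i, hi, rfl⟩
    simp [F, hi]
  · intro hv
    refine ⟨σ.symm ⟨v, hv⟩, (σ.symm ⟨v, hv⟩).2, ?_⟩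
    simp [F]

theorem core_count_nat (hH : ∀ e ∈ H, e.card = k) {S : Finset V} (hS : S.card = l)
    {T : Finset (Fin m)} (hT : T.card = k - l) :
    (H.filter (S ⊆ ·)).card * ((k - l).factorial * Fintype.card V ^ (m - (k - l))) ≤
      (univ.filter fun x : Fin m → V => S ∪ T.image x ∈ H).card := by
  classical
  set E := H.filter (S ⊆ ·) with hE
  have hEc : ∀ e ∈ E, (e \ S).card = k - l := by
    intro e he
    rw [hE, mem_filter] at he
    rw [card_sdiff_of_subset he.2, hH e he.1, hS]
  have hsub : E.biUnion (fun e => univ.filter fun x : Fin m → V => T.image x = e \ S) ⊆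
      univ.filter fun x : Fin m → V => S ∪ T.image x ∈ H := by
    intro x hx
    simp only [mem_biUnion, mem_filter, mem_univ, true_and] at hx ⊢
    obtain ⟨e, he, hx⟩ := hx
    rw [hE, mem_filter] at he
    rw [hx, Finset.union_sdiff_of_subset he.2]
    exact he.1
  refine le_trans ?_ (card_le_card hsub)
  rw [card_biUnion]
  · rw [← smul_eq_mul, ← Finset.sum_const]
    refine Finset.sum_le_sum fun e he => ?_
    have := card_image_eq_ge T (e \ S) (by rw [hT, hEc e he])
    rwa [hT] at this
  · intro e he e' he' hne
    rw [Function.onFun, Finset.disjoint_left]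
    intro x hx hx'
    simp only [mem_filter, mem_univ, true_and] at hx hx'
    apply hne
    rw [hE, mem_coe, mem_filter] at he he'
    rw [← Finset.union_sdiff_of_subset he.2, ← Finset.union_sdiff_of_subset he'.2, ← hx, hx']

theorem descFactorial_ge (r : ℕ) {δ : ℝ} (hδ : 0 < δ) :
    ∃ n₀ : ℕ, ∀ n ≥ n₀, (1 - δ) * (n : ℝ) ^ r ≤ (n.descFactorial r : ℝ) := by
  obtain ⟨N, hN⟩ := exists_nat_gt ((r : ℝ) ^ 2 / δ)
  refine ⟨N + r + 1, fun n hn => ?_⟩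
  have hn0 : (0 : ℝ) < n := by exact_mod_cast (by omega : 0 < n)
  have h1 : (n + 1 - r) ^ r ≤ n.descFactorial r := Nat.pow_sub_le_descFactorial n r
  have h2 : ((n : ℝ) - r) ^ r ≤ (n.descFactorial r : ℝ) := by
    calc ((n : ℝ) - r) ^ r ≤ (((n + 1 - r : ℕ) : ℝ)) ^ r := by
          have h4 : (r : ℝ) ≤ n := by exact_mod_cast (by omega : r ≤ n)
          refine pow_le_pow_left₀ (by linarith) ?_ r
          rw [Nat.cast_sub (by omega)]; push_cast; linarith
      _ ≤ _ := by exact_mod_cast h1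
  refine le_trans ?_ h2
  have h3 : (n : ℝ) - r = n * (1 + -(r / n)) := by field_simp; ring
  have hrn : (r : ℝ) / n ≤ 1 := by
    rw [div_le_one hn0]; exact_mod_cast (by omega : r ≤ n)
  have h5 := one_add_mul_le_pow (show (-2 : ℝ) ≤ -(r / n) by linarith) r
  rw [h3, mul_pow, mul_comm]
  refine mul_le_mul_of_nonneg_left (le_trans ?_ h5) (by positivity)
  have h6 : (r : ℝ) * (r / n) ≤ δ := by
    rw [← mul_div_assoc, div_le_iff₀ hn0, ← sq]
    rw [div_lt_iff₀ hδ] at hN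
    have : (N : ℝ) ≤ n := by exact_mod_cast (by omega : N ≤ n)
    nlinarith
  linarith

theorem core_count (k l : ℕ) {δ : ℝ} (hδ : 0 < δ) :
    ∃ n₀ : ℕ, ∀ (V : Type) [Fintype V] [DecidableEq V], n₀ ≤ Fintype.card V →
      ∀ (d : ℝ) (H : Finset (Finset V)), 0 ≤ d → d ≤ 1 → DegDense k l d H →
      ∀ (m : ℕ) (S : Finset V), S.card = l → ∀ T : Finset (Fin m), T.card = k - l →
      (d - δ) * (Fintype.card V : ℝ) ^ m ≤
        ((univ.filter fun x : Fin m → V => S ∪ T.image x ∈ H).card : ℝ) := by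
  obtain ⟨n₀, hn₀⟩ := descFactorial_ge (k - l) hδ
  refine ⟨n₀, fun V _ _ hV d H hd0 hd1 hH m S hS T hT => ?_⟩
  set n := Fintype.card V with hn
  have hr : k - l ≤ m := by rw [← hT]; simpa using card_le_univ T
  have h1 : (((H.filter (S ⊆ ·)).card * ((k - l).factorial * n ^ (m - (k - l))) : ℕ) : ℝ) ≤
      ((univ.filter fun x : Fin m → V => S ∪ T.image x ∈ H).card : ℝ) := by
    exact_mod_cast core_count_nat hH.1 hS hT
  refine le_trans ?_ h1
  push_cast
  have h2 := hH.2 S hS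
  rw [← hn] at h2
  have h3 := hn₀ n hV
  rw [Nat.descFactorial_eq_factorial_mul_choose] at h3
  push_cast at h3
  have e : (n : ℝ) ^ m = (n : ℝ) ^ (k - l) * (n : ℝ) ^ (m - (k - l)) := by
    rw [← pow_add]; congr 1; omega
  have hnr : (0 : ℝ) ≤ (n : ℝ) ^ (k - l) := by positivity
  rw [e, ← mul_assoc, ← mul_assoc]
  refine mul_le_mul_of_nonneg_right ?_ (by positivity)
  calc (d - δ) * (n : ℝ) ^ (k - l) ≤ d * ((1 - δ) * (n : ℝ) ^ (k - l)) := by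
        nlinarith [mul_nonneg (mul_nonneg (sub_nonneg.2 hd1) hδ.le) hnr]
    _ ≤ d * ((k - l).factorial * n.choose (k - l)) := mul_le_mul_of_nonneg_left h3 hd0
    _ = d * n.choose (k - l) * (k - l).factorial := by ring
    _ ≤ _ := mul_le_mul_of_nonneg_right h2 (by positivity)

/-- Combine independent choices inside and outside `F`. -/
theorem card_filter_le_of_piecewise {W : Type*} [Fintype W] (F : Finset (Fin m))
    (P : (Fin m → W) → Prop) [DecidablePred P] {c : ℝ} [Nonempty W]
    (h : ∀ z : Fin m → W,
      ((univ.filter fun x : Fin m → W => P (F.piecewise z x)).card : ℝ) ≤ c) :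
    ((univ.filter P).card : ℝ) ≤ c := by
  classical
  let e : (Fin m → W) × (Fin m → W) ≃ (Fin m → W) × (Fin m → W) :=
    { toFun := fun p => (F.piecewise p.1 p.2, F.piecewise p.2 p.1)
      invFun := fun p => (F.piecewise p.1 p.2, F.piecewise p.2 p.1)
      left_inv := by
        rintro ⟨z, x⟩
        ext i <;> by_cases hi : i ∈ F <;> simp [hi]
      right_inv := by
        rintro ⟨z, x⟩
        ext i <;> by_cases hi : i ∈ F <;> simp [hi] }
  have hn : (0 : ℝ) < (Fintype.card W : ℝ) ^ m := by
    have : 0 < Fintype.card W := Fintype.card_pos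
    positivity
  have h1 : (univ.filter fun p : (Fin m → W) × (Fin m → W) =>
      P (F.piecewise p.1 p.2)).card = (univ.filter P).card * Fintype.card W ^ m := by
    have e1 : (univ.filter fun p : (Fin m → W) × (Fin m → W) => P (F.piecewise p.1 p.2)).card =
        (univ.filter fun p : (Fin m → W) × (Fin m → W) => P p.1).card := by
      refine Finset.card_bij (fun p _ => e p) ?_ ?_ ?_
      · intro p hp
        simpa [e] using hp
      · intro p _ q _ hpq
        exact e.injective hpq
      · intro q hq
        refine ⟨e.symm q, ?_, by simp⟩
        have : (F.piecewise (e.symm q).1 (e.symm q).2) = q.1 := by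
          have := congrArg Prod.fst (e.apply_symm_apply q)
          simpa [e] using this
        simp only [mem_filter, mem_univ, true_and] at hq ⊢
        rwa [this]
    rw [e1]
    have : (univ.filter fun p : (Fin m → W) × (Fin m → W) => P p.1) =
        (univ.filter P) ×ˢ univ := by
      ext p; simp
    rw [this, card_product]
    simp
  have h2 : (univ.filter fun p : (Fin m → W) × (Fin m → W) =>
      P (F.piecewise p.1 p.2)).card =
      ∑ z : Fin m → W, (univ.filter fun x : Fin m → W => P (F.piecewise z x)).card := by
    simp only [Finset.card_filter]
    rw [Fintype.sum_prod_type]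
  have h3 : ((univ.filter P).card : ℝ) * (Fintype.card W : ℝ) ^ m ≤
      c * (Fintype.card W : ℝ) ^ m := by
    have : (((univ.filter P).card * Fintype.card W ^ m : ℕ) : ℝ) ≤
        c * (Fintype.card W : ℝ) ^ m := by
      rw [← h1, h2]
      push_cast
      calc _ ≤ ∑ z : Fin m → W, c := Finset.sum_le_sum fun z _ => h z
        _ = _ := by simp; ring
    exact_mod_cast this
  exact le_of_mul_le_mul_right h3 hn

theorem card_coord_eq_le (i : Fin m) (φ : (Fin m → V) → V)
    (hφ : ∀ x y : Fin m → V, (∀ j, j ≠ i → x j = y j) → φ x = φ y) :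
    Fintype.card V * (univ.filter fun x : Fin m → V => x i = φ x).card ≤
      Fintype.card V ^ m := by
  have h : Fintype.card V ^ m = (univ : Finset (Fin m → V)).card := by simp
  rw [h, ← Finset.card_univ, ← Finset.card_product]
  refine Finset.card_le_card_of_injOn (fun p => Function.update p.2 i p.1) (by simp) ?_
  rintro ⟨v, x⟩ hx ⟨w, y⟩ hy hxy
  simp only [coe_product, coe_filter, Set.mem_prod, mem_coe, mem_univ, true_and,
    Set.mem_ofPred_eq] at hx hy hxy
  have h1 : v = w := by simpa using congrFun hxy i
  have h2 : ∀ j, j ≠ i → x j = y j := fun j hj => by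
    simpa [hj] using congrFun hxy j
  have h3 : x = y := by
    ext j
    by_cases hj : j = i
    · subst hj; rw [hx, hy, hφ x y h2]
    · exact h2 j hj
  rw [h1, h3]

end Counting

section Sampling

open Finset

/-- The `k`-graph on the coordinates of `y` whose edges are mapped by `y` to edges of `H`. -/
def pullback {V : Type*} [DecidableEq V] {m : ℕ} (k : ℕ) (H : Finset (Finset V))
    (y : Fin m → V) : Finset (Finset (Fin m)) :=
  (univ.powersetCard k).filter fun e => e.image y ∈ H

theorem mem_pullback {V : Type*} [DecidableEq V] {m k : ℕ} {H : Finset (Finset V)}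
    {y : Fin m → V} {e : Finset (Fin m)} : e ∈ pullback k H y ↔ e.card = k ∧ e.image y ∈ H := by
  simp [pullback, mem_powersetCard]

theorem choose_pred_mul {m r : ℕ} (hr : 1 ≤ r) (hm : 2 * r ≤ m) :
    (m : ℝ) * (m.choose (r - 1) : ℝ) ≤ 2 * r * (m.choose r : ℝ) := by
  obtain ⟨r, rfl⟩ : ∃ r', r = r' + 1 := ⟨r - 1, by omega⟩
  have h := Nat.choose_succ_right_eq m r
  have h' : (m.choose (r + 1) : ℝ) * (r + 1) = m.choose r * ((m - r : ℕ) : ℝ) := by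
    exact_mod_cast h
  rw [Nat.cast_sub (by omega)] at h'
  have h2 : (2 : ℝ) * (r + 1) ≤ m := by exact_mod_cast hm
  simp only [Nat.add_sub_cancel]
  push_cast
  have hc : (0 : ℝ) ≤ m.choose r := by positivity
  nlinarith

theorem choose_sub_ge (s r : ℕ) {δ : ℝ} (hδ : 0 < δ) :
    ∃ m₀ : ℕ, ∀ m ≥ m₀, (1 - δ) * (m.choose r : ℝ) ≤ ((m - s).choose r : ℝ) := by
  obtain ⟨n₀, hn₀⟩ := descFactorial_ge r (δ := δ / 2) (by linarith)
  obtain ⟨N, hN⟩ := exists_nat_gt ((r : ℝ) * s / (δ / 2))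
  refine ⟨n₀ + N + s + 1, fun m hm => ?_⟩
  have hm0 : (0 : ℝ) < m := by exact_mod_cast (by omega : 0 < m)
  have h1 := hn₀ (m - s) (by omega)
  have h2 : (m.descFactorial r : ℝ) ≤ (m : ℝ) ^ r := by
    exact_mod_cast Nat.descFactorial_le_pow m r
  rw [Nat.descFactorial_eq_factorial_mul_choose] at h1 h2
  push_cast at h1 h2
  have hf : (0 : ℝ) < r.factorial := by exact_mod_cast Nat.factorial_pos r
  rw [Nat.cast_sub (by omega)] at h1
  have h3 : (m : ℝ) - s = m * (1 + -(s / m)) := by field_simp; ring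
  have hsm : (s : ℝ) / m ≤ 1 := by
    rw [div_le_one hm0]; exact_mod_cast (by omega : s ≤ m)
  have h5 := one_add_mul_le_pow (show (-2 : ℝ) ≤ -(s / m) by linarith) r
  have h6 : (r : ℝ) * (s / m) ≤ δ / 2 := by
    rw [← mul_div_assoc, div_le_iff₀ hm0]
    rw [div_lt_iff₀ (by linarith)] at hN
    have : (N : ℝ) ≤ m := by exact_mod_cast (by omega : N ≤ m)
    nlinarith
  by_cases hd1 : 1 - δ ≤ 0
  · have : (0 : ℝ) ≤ (m - s).choose r := by positivity
    have : (0 : ℝ) ≤ m.choose r := by positivity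
    nlinarith
  push Not at hd1
  have h7 : (1 - δ / 2) * (m : ℝ) ^ r ≤ ((m : ℝ) - s) ^ r := by
    rw [h3, mul_pow, mul_comm]
    exact mul_le_mul_of_nonneg_left (by linarith) (by positivity)
  have h8 : (r.factorial : ℝ) * ((1 - δ) * m.choose r) ≤
      r.factorial * ((m - s).choose r : ℝ) := by
    calc (r.factorial : ℝ) * ((1 - δ) * m.choose r) = (1 - δ) * (r.factorial * m.choose r) := by
          ring
      _ ≤ (1 - δ) * (m : ℝ) ^ r := mul_le_mul_of_nonneg_left h2 hd1.le
      _ ≤ (1 - δ / 2) * ((1 - δ / 2) * (m : ℝ) ^ r) := by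
          nlinarith [sq_nonneg δ, (by positivity : (0 : ℝ) ≤ (m : ℝ) ^ r),
            mul_nonneg (sq_nonneg δ) (by positivity : (0 : ℝ) ≤ (m : ℝ) ^ r)]
      _ ≤ (1 - δ / 2) * ((m : ℝ) - s) ^ r :=
          mul_le_mul_of_nonneg_left h7 (by linarith)
      _ ≤ _ := h1
  exact le_of_mul_le_mul_left h8 hf

theorem exists_pow_mul_exp_le (q : ℕ) {c δ : ℝ} (hc : 0 < c) (hδ : 0 < δ) :
    ∃ m₀ : ℕ, ∀ m : ℕ, m₀ ≤ m → (m : ℝ) ^ q * Real.exp (-(c * m)) ≤ δ := by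
  have h := Real.tendsto_pow_mul_exp_neg_atTop_nhds_zero q
  have h2 : Filter.Tendsto (fun m : ℕ => c * (m : ℝ)) Filter.atTop Filter.atTop :=
    (tendsto_natCast_atTop_atTop).const_mul_atTop hc
  have h3 := (h.comp h2).eventually (gt_mem_nhds (show (0 : ℝ) < c ^ q * δ by positivity))
  obtain ⟨m₀, hm₀⟩ := Filter.eventually_atTop.1 h3
  refine ⟨m₀, fun m hm => ?_⟩
  have := hm₀ m hm
  simp only [Function.comp, mul_pow] at this
  rw [mul_assoc] at this
  exact (lt_of_mul_lt_mul_left this (by positivity)).le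

theorem card_not_injective_le {V : Type*} [Fintype V] [DecidableEq V] [Nonempty V] {m : ℕ}
    (F : Finset (Fin m)) (s : Fin m → V) (hs : Set.InjOn s F) :
    Fintype.card V * (univ.filter fun x : Fin m → V =>
      ¬ Function.Injective (F.piecewise s x)).card ≤ m ^ 2 * Fintype.card V ^ m := by
  have hsub : (univ.filter fun x : Fin m → V => ¬ Function.Injective (F.piecewise s x)) ⊆
      ((univ : Finset (Fin m × Fin m)).filter fun p => p.1 ≠ p.2 ∧ p.1 ∉ F).biUnion fun p =>
        univ.filter fun x : Fin m → V => x p.1 = F.piecewise s x p.2 := by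
    intro x hx
    have hx' := (mem_filter.1 hx).2
    rw [Function.Injective] at hx'
    push Not at hx'
    obtain ⟨i, j, hij, hne⟩ := hx'
    simp only [mem_filter, mem_univ, true_and, mem_biUnion, Prod.exists]
    by_cases hi : i ∈ F
    · by_cases hj : j ∈ F
      · simp only [hi, hj, piecewise_eq_of_mem] at hij
        exact absurd (hs hi hj hij) hne
      · exact ⟨j, i, ⟨hne.symm, hj⟩, by rw [hij]; simp [hj]⟩
    · exact ⟨i, j, ⟨hne, hi⟩, by rw [← hij]; simp [hi]⟩
  calc _ ≤ Fintype.card V * ∑ p ∈ (univ : Finset (Fin m × Fin m)).filter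
          (fun p => p.1 ≠ p.2 ∧ p.1 ∉ F),
          (univ.filter fun x : Fin m → V => x p.1 = F.piecewise s x p.2).card :=
        Nat.mul_le_mul_left _ ((card_le_card hsub).trans card_biUnion_le)
    _ = ∑ p ∈ (univ : Finset (Fin m × Fin m)).filter (fun p => p.1 ≠ p.2 ∧ p.1 ∉ F),
          Fintype.card V *
          (univ.filter fun x : Fin m → V => x p.1 = F.piecewise s x p.2).card := by
        rw [Finset.mul_sum]
    _ ≤ ∑ p ∈ (univ : Finset (Fin m × Fin m)).filter (fun p => p.1 ≠ p.2 ∧ p.1 ∉ F),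
          Fintype.card V ^ m := by
        refine Finset.sum_le_sum fun p hp => ?_
        simp only [mem_filter, mem_univ, true_and] at hp
        refine card_coord_eq_le p.1 (fun x => F.piecewise s x p.2) ?_
        intro x y hxy
        by_cases h : p.2 ∈ F
        · simp [h]
        · simp [h, hxy p.2 (Ne.symm hp.1)]
    _ ≤ ∑ p : Fin m × Fin m, Fintype.card V ^ m :=
        Finset.sum_le_sum_of_subset (filter_subset _ _)
    _ = _ := by simp; ring

/-- For a fixed injective choice of the coordinates in `F₀`, almost every choice of the other
coordinates is injective and spans a `k`-graph inheriting the minimum degree of `H`. -/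
theorem sampling_mul (k l : ℕ) (hlk : l < k) (s₀ : ℕ) {η δ : ℝ} (hη : 0 < η) (hδ : 0 < δ) :
    ∃ m₀ : ℕ, ∀ m, m₀ ≤ m → ∃ n₀ : ℕ, ∀ (V : Type) [Fintype V] [DecidableEq V],
      n₀ ≤ Fintype.card V → ∀ (p : ℝ) (H : Finset (Finset V)), 0 ≤ p → p ≤ 1 →
      DegDense k l p H → ∀ (F₀ : Finset (Fin m)) (s : Fin m → V), F₀.card ≤ s₀ →
      Set.InjOn s F₀ →
      ∃ B : Finset (Fin m → V), (m : ℝ) * B.card ≤ δ * (Fintype.card V : ℝ) ^ m ∧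
        ∀ x ∉ B, Function.Injective (F₀.piecewise s x) ∧
          DegDense k l (p - η) (pullback k H (F₀.piecewise s x)) := by
  classical
  set r := k - l with hr
  have hr1 : 1 ≤ r := by omega
  have hr0 : (0 : ℝ) < r := by exact_mod_cast hr1
  set η' := min η 1 with hη'
  have hη'0 : 0 < η' := lt_min hη one_pos
  have hη'1 : η' ≤ 1 := min_le_right _ _
  set a := η' / (4 * r) with ha
  have ha0 : 0 < a := by positivity
  have ha2 : a ≤ 2 := by
    rw [ha, div_le_iff₀ (by positivity)]
    have : (1 : ℝ) ≤ r := by exact_mod_cast hr1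
    nlinarith
  obtain ⟨m₁, hm₁⟩ := choose_sub_ge (s₀ + l) r (δ := η' / 4) (by positivity)
  obtain ⟨m₂, hm₂⟩ := exists_pow_mul_exp_le (l + 1) (c := a ^ 2 / 4) (δ := δ / 2)
    (by positivity) (by positivity)
  refine ⟨m₁ + m₂ + 2 * r + s₀ + l, fun m hm => ?_⟩
  obtain ⟨n₁, hn₁⟩ := core_count k l (δ := η' / 4) (by positivity)
  obtain ⟨n₂, hn₂⟩ := exists_nat_gt ((m : ℝ) ^ 3 / (δ / 2))
  refine ⟨n₁ + n₂ + 1, fun V _ _ hV p H hp0 hp1 hH F₀ s hF₀ hs => ?_⟩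
  have hne : Nonempty V := Fintype.card_pos_iff.1 (by omega)
  set n := Fintype.card V with hn
  have hn0 : (0 : ℝ) < n := by exact_mod_cast (by omega : 0 < n)
  have hm0 : (0 : ℝ) < m := by exact_mod_cast (by omega : 0 < m)
  -- the bad event for a single `l`-set
  set bad : Finset (Fin m) → (Fin m → V) → Prop := fun L x =>
    Function.Injective (F₀.piecewise s x) ∧
      (((pullback k H (F₀.piecewise s x)).filter (L ⊆ ·)).card : ℝ) <
        (p - η) * (m.choose r : ℝ) with hbad
  have hbadle : ∀ L : Finset (Fin m), L.card = l →
      ((univ.filter (bad L)).card : ℝ) ≤ (n : ℝ) ^ m * Real.exp (-(m * a ^ 2 / 4)) := by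
    intro L hL
    set F := F₀ ∪ L with hF
    refine card_filter_le_of_piecewise F (bad L) fun z => ?_
    set w := F₀.piecewise s z with hw
    by_cases hwinj : Set.InjOn w L
    swap
    · have : (univ.filter fun x : Fin m → V => bad L (F.piecewise z x)) = ∅ := by
        rw [filter_eq_empty_iff]
        intro x _ hx
        apply hwinj
        have hx1 := hx.1
        intro i hi j hj hij
        apply hx1
        have e : ∀ i ∈ L, F₀.piecewise s (F.piecewise z x) i = w i := by
          intro i hi
          by_cases h0 : i ∈ F₀
          · simp [hw, h0]
          · have : i ∈ F := mem_union_right _ hi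
            simp [hw, h0, this]
        rw [e i hi, e j hj, hij]
      rw [this]
      simp only [card_empty, Nat.cast_zero]
      positivity
    have hwL : (L.image w).card = l := by rw [card_image_of_injOn hwinj, hL]
    have hFc : F.card ≤ s₀ + l := (card_union_le _ _).trans (by omega)
    have hFcard : m - (s₀ + l) ≤ Fᶜ.card := by
      rw [card_compl]; simp; omega
    set f : (Fin m → V) → ℝ := fun x =>
      (((Fᶜ.powersetCard r).filter fun T => L.image w ∪ T.image x ∈ H).card : ℝ) with hf
    have hfle : ∀ x, f x ≤
        (((pullback k H (F₀.piecewise s (F.piecewise z x))).filter (L ⊆ ·)).card : ℝ) := by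
      intro x
      rw [hf]
      simp only [Nat.cast_le]
      refine card_le_card_of_injOn (fun T => L ∪ T) ?_ ?_
      · intro T hT
        simp only [coe_filter, mem_powersetCard, Set.mem_ofPred_eq] at hT ⊢
        obtain ⟨⟨hT1, hT2⟩, hT3⟩ := hT
        have hd : Disjoint L T := by
          rw [disjoint_left]
          intro i hi hiT
          have := hT1 hiT
          rw [mem_compl] at this
          exact this (mem_union_right _ hi)
        refine ⟨mem_pullback.2 ⟨?_, ?_⟩, subset_union_left⟩
        · rw [card_union_of_disjoint hd, hL, hT2]; omega
        · rw [image_union]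
          have e1 : L.image (F₀.piecewise s (F.piecewise z x)) = L.image w := by
            refine image_congr fun i hi => ?_
            by_cases h0 : i ∈ F₀
            · simp [hw, h0]
            · have : i ∈ F := mem_union_right _ hi
              simp [hw, h0, this]
          have e2 : T.image (F₀.piecewise s (F.piecewise z x)) = T.image x := by
            refine image_congr fun i hi => ?_
            have h1 : i ∉ F := by simpa using hT1 hi
            have h0 : i ∉ F₀ := fun h => h1 (mem_union_left _ h)
            simp [h0, h1]
          rw [e1, e2]; exact hT3
      · intro T hT T' hT' hTT
        have hd : ∀ T ∈ (Fᶜ.powersetCard r).filter fun T => L.image w ∪ T.image x ∈ H,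
            Disjoint L T := by
          intro T hT
          rw [mem_filter, mem_powersetCard] at hT
          rw [disjoint_left]
          intro i hi hiT
          have := hT.1.1 hiT
          rw [mem_compl] at this
          exact this (mem_union_right _ hi)
        have h1 := (hd T hT)
        have h2 := (hd T' hT')
        have h3 : (L ∪ T) \ L = (L ∪ T') \ L := congrArg (· \ L) hTT
        rwa [union_sdiff_cancel_left h1, union_sdiff_cancel_left h2] at h3
    have hc0 : (0 : ℝ) < m.choose (r - 1) := by
      exact_mod_cast Nat.choose_pos (by omega)
    have hdiff : ∀ x y : Fin m → V, ∀ i, (∀ j, j ≠ i → x j = y j) →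
        f x - f y ≤ m.choose (r - 1) := by
      intro x y i hxy
      have h1 : ((Fᶜ.powersetCard r).filter fun T => L.image w ∪ T.image x ∈ H).card ≤
          ((Fᶜ.powersetCard r).filter fun T => L.image w ∪ T.image y ∈ H).card +
          m.choose (r - 1) := by
        have hsub : ((Fᶜ.powersetCard r).filter fun T => L.image w ∪ T.image x ∈ H) ⊆
            ((Fᶜ.powersetCard r).filter fun T => L.image w ∪ T.image y ∈ H) ∪
            ((univ.powersetCard (r - 1)).image fun T => insert i T) := by
          intro T hT
          rw [mem_filter] at hT
          rw [mem_union]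
          by_cases hi : i ∈ T
          · right
            rw [mem_image]
            refine ⟨T.erase i, ?_, insert_erase hi⟩
            rw [mem_powersetCard, card_erase_of_mem hi, (mem_powersetCard.1 hT.1).2]
            exact ⟨subset_univ _, rfl⟩
          · left
            rw [mem_filter]
            refine ⟨hT.1, ?_⟩
            have : T.image y = T.image x := image_congr fun j hj =>
              (hxy j (fun h => hi (h ▸ hj))).symm
            rw [this]; exact hT.2
        refine (card_le_card hsub).trans ((card_union_le _ _).trans ?_)
        refine Nat.add_le_add_left (card_image_le.trans ?_) _
        simp
      have h2 : f x ≤ f y + m.choose (r - 1) := by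
        simp only [hf]; exact_mod_cast h1
      linarith
    have hmean : ((p - η' / 4) * (Fᶜ.card.choose r : ℝ)) * (Fintype.card V : ℝ) ^ m ≤
        ∑ x, f x := by
      have e : ∑ x, f x = ∑ T ∈ Fᶜ.powersetCard r,
          ((univ.filter fun x : Fin m → V => L.image w ∪ T.image x ∈ H).card : ℝ) := by
        rw [hf]
        simp only [card_filter]
        push_cast
        rw [sum_comm]
      rw [e]
      calc _ = ∑ T ∈ Fᶜ.powersetCard r, (p - η' / 4) * (n : ℝ) ^ m := by
            rw [sum_const, card_powersetCard]; simp; ring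
        _ ≤ _ := by
            refine sum_le_sum fun T hT => ?_
            exact hn₁ V (by omega) p H hp0 hp1 hH m _ hwL T (mem_powersetCard.1 hT).2
    refine mcdiarmid hc0 ha0.le ha2 f hdiff hmean _ ?_
    intro x hx
    have h1 := (hfle x).trans hx.2.le
    have hch : (1 - η' / 4) * (m.choose r : ℝ) ≤ (Fᶜ.card.choose r : ℝ) := by
      refine (hm₁ m (by omega)).trans ?_
      exact_mod_cast Nat.choose_le_choose r hFcard
    have hch2 : (Fᶜ.card.choose r : ℝ) ≤ m.choose r := by
      exact_mod_cast Nat.choose_le_choose r (by simpa using card_le_univ Fᶜ)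
    have hC : (0 : ℝ) ≤ m.choose r := by positivity
    have h4 := choose_pred_mul hr1 (show 2 * r ≤ m by omega)
    have h5 : a * m * (m.choose (r - 1) : ℝ) ≤ η' / 2 * m.choose r := by
      calc a * m * (m.choose (r - 1) : ℝ) = a * (m * (m.choose (r - 1) : ℝ)) := by ring
        _ ≤ a * (2 * r * m.choose r) := mul_le_mul_of_nonneg_left h4 ha0.le
        _ = η' / 2 * m.choose r := by rw [ha]; field_simp; ring
    have h6 : (p - η' / 2) * (m.choose r : ℝ) ≤ (p - η' / 4) * (Fᶜ.card.choose r : ℝ) := by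
      have : p * ((1 - η' / 4) * (m.choose r : ℝ)) ≤ p * (Fᶜ.card.choose r : ℝ) :=
        mul_le_mul_of_nonneg_left hch hp0
      nlinarith [mul_nonneg (mul_nonneg hη'0.le (sub_nonneg.2 hp1)) hC]
    have h7 : (p - η) * (m.choose r : ℝ) ≤ (p - η') * (m.choose r : ℝ) :=
      mul_le_mul_of_nonneg_right (by linarith [min_le_left η 1]) hC
    linarith
  refine ⟨(univ.filter fun x : Fin m → V => ¬ Function.Injective (F₀.piecewise s x)) ∪
      ((univ : Finset (Fin m)).powersetCard l).biUnion fun L => univ.filter (bad L), ?_, ?_⟩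
  swap
  · intro x hx
    simp only [mem_filter, mem_univ, true_and, mem_union, mem_biUnion, mem_powersetCard] at hx
    push Not at hx
    refine ⟨hx.1, fun e he => (mem_pullback.1 he).1, fun L hL => ?_⟩
    have := hx.2 L ⟨subset_univ _, hL⟩
    by_contra hlt
    push Not at hlt
    apply this
    refine ⟨hx.1, ?_⟩
    simpa using hlt
  have hcard : ((((univ.filter fun x : Fin m → V => ¬ Function.Injective (F₀.piecewise s x)) ∪
      ((univ : Finset (Fin m)).powersetCard l).biUnion fun L =>
        univ.filter (bad L)).card : ℕ) : ℝ) ≤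
      ((univ.filter fun x : Fin m → V => ¬ Function.Injective (F₀.piecewise s x)).card : ℝ) +
      ∑ L ∈ (univ : Finset (Fin m)).powersetCard l, ((univ.filter (bad L)).card : ℝ) := by
    exact_mod_cast (card_union_le _ _).trans (Nat.add_le_add_left card_biUnion_le _)
  refine (mul_le_mul_of_nonneg_left hcard hm0.le).trans ?_
  rw [mul_add]
  have hA : (m : ℝ) * ((univ.filter fun x : Fin m → V => ¬ Function.Injective
      (F₀.piecewise s x)).card : ℝ) ≤ δ / 2 * (n : ℝ) ^ m := by
    have h1 := card_not_injective_le F₀ s hs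
    have h2 : (n : ℝ) * ((univ.filter fun x : Fin m → V => ¬ Function.Injective
        (F₀.piecewise s x)).card : ℝ) ≤ (m : ℝ) ^ 2 * (n : ℝ) ^ m := by exact_mod_cast h1
    have h5 := mul_le_mul_of_nonneg_left h2 hm0.le
    rw [mul_left_comm, ← mul_assoc (m : ℝ), ← pow_succ'] at h5
    rw [div_lt_iff₀ (by positivity)] at hn₂
    have h3 : (n₂ : ℝ) ≤ n := by exact_mod_cast (by omega : n₂ ≤ n)
    have h4 : (m : ℝ) ^ (2 + 1) * (n : ℝ) ^ m ≤ n * (δ / 2 * (n : ℝ) ^ m) := by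
      have : (m : ℝ) ^ (2 + 1) ≤ n * (δ / 2) := by nlinarith
      calc _ ≤ n * (δ / 2) * (n : ℝ) ^ m := mul_le_mul_of_nonneg_right this (by positivity)
        _ = _ := by ring
    exact le_of_mul_le_mul_left (h5.trans h4) hn0
  have hB : (m : ℝ) * ∑ L ∈ (univ : Finset (Fin m)).powersetCard l,
      ((univ.filter (bad L)).card : ℝ) ≤
      δ / 2 * (n : ℝ) ^ m := by
    calc _ ≤ m * ∑ L ∈ (univ : Finset (Fin m)).powersetCard l,
          (n : ℝ) ^ m * Real.exp (-(m * a ^ 2 / 4)) :=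
          mul_le_mul_of_nonneg_left
            (sum_le_sum fun L hL => hbadle L (mem_powersetCard.1 hL).2) hm0.le
      _ = m * (m.choose l : ℝ) * ((n : ℝ) ^ m * Real.exp (-(m * a ^ 2 / 4))) := by
          rw [sum_const, card_powersetCard]; simp; ring
      _ ≤ (m : ℝ) ^ (l + 1) * ((n : ℝ) ^ m * Real.exp (-(m * a ^ 2 / 4))) := by
          refine mul_le_mul_of_nonneg_right ?_ (by positivity)
          rw [pow_succ']
          exact mul_le_mul_of_nonneg_left (by exact_mod_cast Nat.choose_le_pow m l) hm0.le
      _ = ((m : ℝ) ^ (l + 1) * Real.exp (-(a ^ 2 / 4 * m))) * (n : ℝ) ^ m := by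
          rw [show m * a ^ 2 / 4 = a ^ 2 / 4 * m by ring]; ring
      _ ≤ _ := mul_le_mul_of_nonneg_right (hm₂ m (by omega)) (by positivity)
  calc _ ≤ δ / 2 * (n : ℝ) ^ m + δ / 2 * (n : ℝ) ^ m := add_le_add hA hB
    _ = _ := by ring

theorem sampling (k l : ℕ) (hlk : l < k) (s₀ : ℕ) {η δ : ℝ} (hη : 0 < η) (hδ : 0 < δ) :
    ∃ m₀ : ℕ, ∀ m, m₀ ≤ m → ∃ n₀ : ℕ, ∀ (V : Type) [Fintype V] [DecidableEq V],
      n₀ ≤ Fintype.card V → ∀ (p : ℝ) (H : Finset (Finset V)), 0 ≤ p → p ≤ 1 →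
      DegDense k l p H → ∀ (F₀ : Finset (Fin m)) (s : Fin m → V), F₀.card ≤ s₀ →
      Set.InjOn s F₀ →
      ∃ B : Finset (Fin m → V), (B.card : ℝ) ≤ δ * (Fintype.card V : ℝ) ^ m ∧
        ∀ x ∉ B, Function.Injective (F₀.piecewise s x) ∧
          DegDense k l (p - η) (pullback k H (F₀.piecewise s x)) := by
  obtain ⟨m₀, hm₀⟩ := sampling_mul k l hlk s₀ hη hδ
  refine ⟨m₀ + 1, fun m hm => ?_⟩
  obtain ⟨n₀, hn₀⟩ := hm₀ m (by omega)
  refine ⟨n₀, fun V _ _ hV p H hp0 hp1 hH F₀ s hF₀ hs => ?_⟩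
  obtain ⟨B, hB, hx⟩ := hn₀ V hV p H hp0 hp1 hH F₀ s hF₀ hs
  refine ⟨B, le_trans ?_ hB, hx⟩
  have : (1 : ℝ) ≤ m := by exact_mod_cast (by omega : 1 ≤ m)
  exact le_mul_of_one_le_left (by positivity) this

end Sampling

section Box

open Finset

/-- Erdős: a positive proportion of all `m`-tuples contains a complete `m`-partite box. -/
theorem exists_box (s m : ℕ) : ∀ δ : ℝ, 0 < δ → ∃ n₀ : ℕ, ∀ (V : Type) [Fintype V]
    [DecidableEq V], n₀ ≤ Fintype.card V → ∀ Q : Finset (Fin m → V),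
      δ * (Fintype.card V : ℝ) ^ m ≤ (Q.card : ℝ) →
      ∃ X : Fin m → Finset V, (∀ j, (X j).card = s) ∧ ∀ x, (∀ j, x j ∈ X j) → x ∈ Q := by
  induction m with
  | zero =>
    intro δ hδ
    refine ⟨0, fun V _ _ _ Q hQ => ?_⟩
    have hQ0 : (0 : ℝ) < Q.card := by
      have : δ * (Fintype.card V : ℝ) ^ 0 = δ := by simp
      linarith
    obtain ⟨x, hx⟩ := card_pos.1 (by exact_mod_cast hQ0 : 0 < Q.card)
    exact ⟨fun j => j.elim0, fun j => j.elim0, fun y _ => by rwa [Subsingleton.elim y x]⟩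
  | succ m ih =>
    intro δ hδ
    obtain ⟨t, ht⟩ := exists_nat_gt (4 * s / δ)
    have hst : (s : ℝ) ≤ t * (δ / 4) := by
      rw [div_lt_iff₀ hδ] at ht; linarith
    have ht0 : (0 : ℝ) < t := lt_of_le_of_lt (by positivity) ht
    obtain ⟨n₁, hn₁⟩ := ih (δ / 4 / 2 ^ t) (by positivity)
    obtain ⟨n₂, hn₂⟩ := exists_nat_gt (t / (δ / 2))
    refine ⟨n₁ + n₂ + 1, fun V _ _ hV Q hQ => ?_⟩
    set n := Fintype.card V with hn
    have hn0 : (0 : ℝ) < n := by exact_mod_cast (by omega : 0 < n)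
    set d : V → ℕ := fun v => (univ.filter fun x : Fin m → V => Fin.cons v x ∈ Q).card with hd
    have hdn : ∀ v, (d v : ℝ) ≤ (n : ℝ) ^ m := by
      intro v
      have : d v ≤ n ^ m := (card_le_univ _).trans (by simp [hn])
      exact_mod_cast this
    have hsum : ∑ v, (d v : ℝ) = Q.card := by
      have h1 : Q.card = ∑ x : Fin (m + 1) → V, if x ∈ Q then 1 else 0 := by simp
      rw [h1, ← (Fin.consEquiv (fun _ : Fin (m + 1) => V)).sum_comp, Fintype.sum_prod_type]
      push_cast
      refine sum_congr rfl fun v _ => ?_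
      rw [hd]
      simp only [card_filter]
      push_cast
      rfl
    set P := univ.filter fun v => δ / 2 * (n : ℝ) ^ m ≤ d v with hP
    have hPc : δ / 2 * n ≤ (P.card : ℝ) := by
      have h1 : ∑ v, (d v : ℝ) ≤ P.card * (n : ℝ) ^ m + n * (δ / 2 * (n : ℝ) ^ m) := by
        rw [← sum_filter_add_sum_filter_not univ (fun v => δ / 2 * (n : ℝ) ^ m ≤ d v)]
        refine add_le_add ?_ ?_
        · rw [← nsmul_eq_mul]
          exact sum_le_card_nsmul _ _ _ fun v _ => hdn v
        · calc _ ≤ ∑ v ∈ univ.filter (fun v => ¬ δ / 2 * (n : ℝ) ^ m ≤ d v),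
                  δ / 2 * (n : ℝ) ^ m :=
                sum_le_sum fun v hv => (not_le.1 (mem_filter.1 hv).2).le
            _ ≤ ∑ v : V, δ / 2 * (n : ℝ) ^ m :=
                sum_le_sum_of_subset_of_nonneg (filter_subset _ _) fun _ _ _ => by positivity
            _ = _ := by simp [hn]
      rw [hsum] at h1
      have h2 : δ / 2 * n * (n : ℝ) ^ m ≤ P.card * (n : ℝ) ^ m := by
        rw [pow_succ] at hQ
        nlinarith
      exact le_of_mul_le_mul_right h2 (by positivity)
    have htP : t ≤ P.card := by
      rw [div_lt_iff₀ (by positivity)] at hn₂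
      have h3 : (n₂ : ℝ) ≤ n := by exact_mod_cast (by omega : n₂ ≤ n)
      have : (t : ℝ) ≤ P.card := by nlinarith
      exact_mod_cast this
    obtain ⟨D, hDP, hDt⟩ := exists_subset_card_eq htP
    set w : (Fin m → V) → Finset V := fun x => D.filter fun v => Fin.cons v x ∈ Q with hw
    have hwsum : (t : ℝ) * (δ / 2 * (n : ℝ) ^ m) ≤ ∑ x, ((w x).card : ℝ) := by
      have : ∑ x, ((w x).card : ℝ) = ∑ v ∈ D, (d v : ℝ) := by
        rw [hw, hd]
        simp only [card_filter]
        push_cast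
        rw [sum_comm]
      rw [this, ← hDt, ← nsmul_eq_mul]
      exact card_nsmul_le_sum _ _ _ fun v hv => (mem_filter.1 (hDP hv)).2
    set G := univ.filter fun x : Fin m → V => s ≤ (w x).card with hG
    have hGc : δ / 4 * (n : ℝ) ^ m ≤ G.card := by
      have h1 : ∑ x, ((w x).card : ℝ) ≤ G.card * t + (n : ℝ) ^ m * s := by
        rw [← sum_filter_add_sum_filter_not univ (fun x : Fin m → V => s ≤ (w x).card)]
        refine add_le_add ?_ ?_
        · rw [← nsmul_eq_mul]
          refine sum_le_card_nsmul _ _ _ fun v _ => ?_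
          rw [← hDt]; exact_mod_cast card_le_card (filter_subset _ _)
        · calc _ ≤ ∑ x ∈ univ.filter (fun x : Fin m → V => ¬ s ≤ (w x).card), (s : ℝ) :=
                sum_le_sum fun v hv => by exact_mod_cast (not_le.1 (mem_filter.1 hv).2).le
            _ ≤ ∑ x : Fin m → V, (s : ℝ) :=
                sum_le_sum_of_subset_of_nonneg (filter_subset _ _) fun _ _ _ => by positivity
            _ = _ := by simp [hn]
      have h2 : (n : ℝ) ^ m * s ≤ t * (δ / 4 * (n : ℝ) ^ m) := by
        have : (0 : ℝ) ≤ (n : ℝ) ^ m := by positivity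
        nlinarith
      have h3 : δ / 4 * (n : ℝ) ^ m * t ≤ G.card * t := by nlinarith
      exact le_of_mul_le_mul_right h3 ht0
    have hpig : ∃ D₀ ∈ D.powersetCard s, δ / 4 / 2 ^ t * (n : ℝ) ^ m ≤
        ((univ.filter fun x : Fin m → V => D₀ ⊆ w x).card : ℝ) := by
      by_contra hcon
      push Not at hcon
      have hsub : G ⊆ (D.powersetCard s).biUnion fun D₀ =>
          univ.filter fun x : Fin m → V => D₀ ⊆ w x := by
        intro x hx
        obtain ⟨D₀, h1, h2⟩ := exists_subset_card_eq (mem_filter.1 hx).2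
        simp only [mem_biUnion, mem_powersetCard, mem_filter, mem_univ, true_and]
        exact ⟨D₀, ⟨h1.trans (filter_subset _ _), h2⟩, h1⟩
      have hne : (D.powersetCard s).Nonempty := by
        have : 0 < G.card := by
          have : (0 : ℝ) < G.card := lt_of_lt_of_le (by positivity) hGc
          exact_mod_cast this
        obtain ⟨x, hx⟩ := card_pos.1 this
        obtain ⟨D₀, h1, h2⟩ := exists_subset_card_eq (mem_filter.1 hx).2
        exact ⟨D₀, mem_powersetCard.2 ⟨h1.trans (filter_subset _ _), h2⟩⟩
      have h1 : (G.card : ℝ) ≤ ∑ D₀ ∈ D.powersetCard s,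
          ((univ.filter fun x : Fin m → V => D₀ ⊆ w x).card : ℝ) := by
        exact_mod_cast (card_le_card hsub).trans card_biUnion_le
      have h2 := sum_lt_sum_of_nonempty hne hcon
      have h3 : ∑ D₀ ∈ D.powersetCard s, δ / 4 / 2 ^ t * (n : ℝ) ^ m ≤ δ / 4 * (n : ℝ) ^ m := by
        rw [sum_const, nsmul_eq_mul, card_powersetCard, hDt]
        have h4 : (t.choose s : ℝ) ≤ 2 ^ t := by exact_mod_cast Nat.choose_le_two_pow t s
        calc _ ≤ 2 ^ t * (δ / 4 / 2 ^ t * (n : ℝ) ^ m) :=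
              mul_le_mul_of_nonneg_right h4 (by positivity)
          _ = _ := by field_simp
      linarith
    obtain ⟨D₀, hD₀, hbig⟩ := hpig
    obtain ⟨X, hXc, hX⟩ := hn₁ V (by omega) _ hbig
    refine ⟨Fin.cons D₀ X, ?_, ?_⟩
    · intro j
      refine Fin.cases ?_ ?_ j
      · simpa using (mem_powersetCard.1 hD₀).2
      · intro j; simpa using hXc j
    · intro x hx
      have h1 := hX (Fin.tail x) fun j => by simpa [Fin.tail] using hx j.succ
      have h2 : x 0 ∈ D₀ := by simpa using hx 0
      have h3 := (mem_filter.1 ((mem_filter.1 h1).2 h2)).2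
      rwa [Fin.cons_self_tail] at h3

end Box

section Connector

open Finset

theorem card_superset_le {V : Type*} [Fintype V] [DecidableEq V] {r : ℕ}
    {𝒜 : Finset (Finset V)} (h𝒜 : ∀ e ∈ 𝒜, e.card = r) (D : Finset V) :
    (𝒜.filter (D ⊆ ·)).card ≤ Fintype.card V ^ (r - D.card) := by
  calc _ ≤ ((univ : Finset V).powersetCard (r - D.card)).card := by
        refine card_le_card_of_injOn (fun e => e \ D) ?_ ?_
        · intro e he
          simp only [coe_filter, Set.mem_ofPred_eq, mem_coe, mem_powersetCard, subset_univ,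
            true_and] at he ⊢
          rw [card_sdiff_of_subset he.2, h𝒜 e he.1]
        · intro e he e' he' hee
          simp only [coe_filter, Set.mem_ofPred_eq] at he he'
          simp only at hee
          rw [← union_sdiff_of_subset he.2, ← union_sdiff_of_subset he'.2, hee]
    _ ≤ _ := by
        rw [card_powersetCard, card_univ]
        exact Nat.choose_le_pow _ _

theorem pow_le_choose (r : ℕ) : ∃ n₀ : ℕ, ∀ n ≥ n₀,
    (n : ℝ) ^ r ≤ 2 * r.factorial * (n.choose r : ℝ) := by
  obtain ⟨n₀, hn₀⟩ := descFactorial_ge r (δ := 1 / 2) (by norm_num)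
  refine ⟨n₀, fun n hn => ?_⟩
  have := hn₀ n hn
  rw [Nat.descFactorial_eq_factorial_mul_choose] at this
  push_cast at this
  linarith

/-- A set of more than `q ^ r` of the `r`-sets, `q ^ l = 1 / 2`, covers more than half of the
`l`-sets. -/
theorem half_lt_shadow {r l : ℕ} (hl : 1 ≤ l) (hlr : l ≤ r) {η : ℝ} (hη : 0 < η) :
    ∃ n₀ : ℕ, ∀ n ≥ n₀, ∀ 𝒜 : Finset (Finset (Fin n)), (𝒜 : Set (Finset (Fin n))).Sized r →
      (((1 : ℝ) / 2) ^ ((r : ℝ) / l) + η) * (n.choose r : ℝ) ≤ (𝒜.card : ℝ) →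
      n.choose l < 2 * (shadow^[r - l] 𝒜).card := by
  have hl0 : (0 : ℝ) < l := by exact_mod_cast hl
  set q : ℝ := ((1 : ℝ) / 2) ^ ((1 : ℝ) / l) with hq
  have hq0 : 0 < q := Real.rpow_pos_of_pos (by norm_num) _
  have hq1 : q < 1 := Real.rpow_lt_one (by norm_num) (by norm_num) (by positivity)
  have hql : q ^ l = 1 / 2 := by
    rw [hq, ← Real.rpow_natCast, ← Real.rpow_mul (by norm_num)]
    rw [one_div_mul_cancel hl0.ne', Real.rpow_one]
  have hqr : ((1 : ℝ) / 2) ^ ((r : ℝ) / l) = q ^ r := by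
    rw [hq, ← Real.rpow_natCast, ← Real.rpow_mul (by norm_num)]
    congr 1; ring
  rw [hqr]
  obtain ⟨δ, hδ0, hδ1, hδ2⟩ : ∃ δ : ℝ, 0 < δ ∧ q + δ ≤ 1 ∧
      (q + δ) ^ r ≤ (q ^ r + η) * (1 - δ) := by
    have hc : Filter.Tendsto (fun δ : ℝ => (q ^ r + η) * (1 - δ) - (q + δ) ^ r)
        (nhdsWithin 0 (Set.Ioi 0)) (nhds ((q ^ r + η) * (1 - 0) - (q + 0) ^ r)) := by
      refine Filter.Tendsto.mono_left (Continuous.tendsto ?_ 0) nhdsWithin_le_nhds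
      fun_prop
    have h1 := hc.eventually (lt_mem_nhds (show (0 : ℝ) < (q ^ r + η) * (1 - 0) - (q + 0) ^ r by
      simp; linarith))
    have h2 : ∀ᶠ δ : ℝ in nhdsWithin 0 (Set.Ioi 0), δ < 1 - q :=
      Filter.Eventually.filter_mono nhdsWithin_le_nhds (gt_mem_nhds (by linarith))
    have h3 : ∀ᶠ δ : ℝ in nhdsWithin 0 (Set.Ioi 0), 0 < δ := self_mem_nhdsWithin
    obtain ⟨δ, h1, h2, h3⟩ := (h1.and (h2.and h3)).exists
    exact ⟨δ, h3, by linarith, by linarith⟩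
  obtain ⟨n₁, hn₁⟩ := descFactorial_ge r hδ0
  obtain ⟨n₂, hn₂⟩ := exists_nat_gt (((l : ℝ) + 1) / δ)
  refine ⟨n₁ + n₂ + r + 1 + ⌈(r : ℝ) / q⌉₊, fun n hn 𝒜 hs h𝒜 => ?_⟩
  have hn0 : (0 : ℝ) < n := by exact_mod_cast (by omega : 0 < n)
  set x : ℕ := ⌈q * n⌉₊ + l with hx
  have hceil : q * n ≤ (⌈q * n⌉₊ : ℝ) := Nat.le_ceil _
  have hceil' : (⌈q * n⌉₊ : ℝ) < q * n + 1 := Nat.ceil_lt_add_one (by positivity)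
  have hxn : (x : ℝ) ≤ (q + δ) * n := by
    rw [div_lt_iff₀ hδ0] at hn₂
    have h3 : (n₂ : ℝ) ≤ n := by exact_mod_cast (by omega : n₂ ≤ n)
    rw [hx]; push_cast; nlinarith
  have hxn' : x ≤ n := by
    have : (x : ℝ) ≤ n := by nlinarith
    exact_mod_cast this
  have hrx : r ≤ x := by
    have h1 : (r : ℝ) / q ≤ n := (Nat.le_ceil _).trans (by exact_mod_cast (by omega))
    rw [div_le_iff₀ hq0] at h1
    have : (r : ℝ) ≤ x := by rw [hx]; push_cast; nlinarith
    exact_mod_cast this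
  have hcx : x.choose r ≤ 𝒜.card := by
    have h1 : (x.descFactorial r : ℝ) ≤ (x : ℝ) ^ r := by
      exact_mod_cast Nat.descFactorial_le_pow x r
    have h2 : (x : ℝ) ^ r ≤ ((q + δ) * n) ^ r := pow_le_pow_left₀ (by positivity) hxn r
    have h3 := hn₁ n (by omega)
    rw [Nat.descFactorial_eq_factorial_mul_choose] at h1 h3
    push_cast at h1 h3
    have hf : (0 : ℝ) < r.factorial := by exact_mod_cast Nat.factorial_pos r
    have h4 : (r.factorial : ℝ) * x.choose r ≤ r.factorial * 𝒜.card := by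
      calc _ ≤ ((q + δ) * n) ^ r := h1.trans h2
        _ = (q + δ) ^ r * (n : ℝ) ^ r := mul_pow _ _ _
        _ ≤ (q ^ r + η) * (1 - δ) * (n : ℝ) ^ r :=
            mul_le_mul_of_nonneg_right hδ2 (by positivity)
        _ = (q ^ r + η) * ((1 - δ) * (n : ℝ) ^ r) := by ring
        _ ≤ (q ^ r + η) * (r.factorial * n.choose r) :=
            mul_le_mul_of_nonneg_left h3 (by positivity)
        _ = r.factorial * ((q ^ r + η) * n.choose r) := by ring
        _ ≤ _ := mul_le_mul_of_nonneg_left h𝒜 hf.le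
    exact_mod_cast le_of_mul_le_mul_left h4 hf
  have hKK := kruskal_katona_lovasz_form (i := r - l) (by omega) hrx hxn' hs hcx
  rw [show r - (r - l) = l by omega] at hKK
  have h5 : n.choose l < 2 * x.choose l := by
    have h1 : ((x + 1 - l) ^ l : ℕ) ≤ x.descFactorial l := Nat.pow_sub_le_descFactorial x l
    have h2 : (n.descFactorial l : ℝ) ≤ (n : ℝ) ^ l := by
      exact_mod_cast Nat.descFactorial_le_pow n l
    have h3 : (q * n) ^ l < (((x + 1 - l) ^ l : ℕ) : ℝ) := by
      push_cast
      refine pow_lt_pow_left₀ ?_ (by positivity) (by omega)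
      rw [Nat.cast_sub (by omega), hx]; push_cast; linarith
    have h4 : (((x + 1 - l) ^ l : ℕ) : ℝ) ≤ x.descFactorial l := by exact_mod_cast h1
    rw [mul_pow, hql] at h3
    rw [Nat.descFactorial_eq_factorial_mul_choose] at h2 h4
    push_cast at h2 h4 h3
    have hf : (0 : ℝ) < l.factorial := by exact_mod_cast Nat.factorial_pos l
    have : (l.factorial : ℝ) * n.choose l < l.factorial * (2 * x.choose l) := by linarith
    have := lt_of_mul_lt_mul_left this hf.le
    exact_mod_cast this
  omega

/-- The link of `A` restricted to the complement of `W`. -/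
def linkAvoid {V : Type*} [Fintype V] [DecidableEq V] (H : Finset (Finset V)) (r : ℕ)
    (A W : Finset V) : Finset (Finset V) :=
  (Wᶜ.powersetCard r).filter fun T => A ∪ T ∈ H

theorem card_link_le {V : Type*} [Fintype V] [DecidableEq V] {H : Finset (Finset V)} {k l : ℕ}
    (hH : ∀ e ∈ H, e.card = k) {A W : Finset V} (hA : A.card = l) :
    (H.filter (A ⊆ ·)).card ≤
      (linkAvoid H (k - l) A W).card + W.card * Fintype.card V ^ (k - l - 1) := by
  have hsub : H.filter (A ⊆ ·) ⊆ (linkAvoid H (k - l) A W).image (A ∪ ·) ∪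
      (W \ A).biUnion fun v => H.filter (insert v A ⊆ ·) := by
    intro e he
    rw [mem_filter] at he
    rw [mem_union]
    by_cases h : ∃ v ∈ W \ A, v ∈ e
    · obtain ⟨v, hv, hve⟩ := h
      right
      rw [mem_biUnion]
      exact ⟨v, hv, mem_filter.2 ⟨he.1, insert_subset hve he.2⟩⟩
    · left
      push Not at h
      rw [mem_image]
      refine ⟨e \ A, ?_, union_sdiff_of_subset he.2⟩
      rw [linkAvoid, mem_filter, mem_powersetCard, union_sdiff_of_subset he.2]
      refine ⟨⟨?_, ?_⟩, he.1⟩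
      · intro v hv
        rw [mem_compl]
        intro hvW
        rw [mem_sdiff] at hv
        exact h v (mem_sdiff.2 ⟨hvW, hv.2⟩) hv.1
      · rw [card_sdiff_of_subset he.2, hH e he.1, hA]
  refine (card_le_card hsub).trans ((card_union_le _ _).trans (add_le_add card_image_le ?_))
  refine card_biUnion_le.trans ?_
  calc _ ≤ ∑ v ∈ W \ A, Fintype.card V ^ (k - l - 1) := by
        refine sum_le_sum fun v hv => ?_
        have := card_superset_le hH (insert v A)
        rw [card_insert_of_notMem (mem_sdiff.1 hv).2, hA] at this
        rwa [Nat.sub_sub]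
    _ = (W \ A).card * Fintype.card V ^ (k - l - 1) := by simp
    _ ≤ _ := Nat.mul_le_mul_right _ (card_le_card sdiff_subset)

/-- Any two disjoint `l`-sets are joined by an `l`-path with two edges avoiding a given small
set. -/
theorem exists_connector {k l : ℕ} (hl : 1 ≤ l) (hlk : 2 * l < k) {η : ℝ} (hη : 0 < η) :
    ∃ c : ℝ, 0 < c ∧ ∃ n₀ : ℕ, ∀ n ≥ n₀, ∀ H : Finset (Finset (Fin n)),
      DegDense k l (((1 : ℝ) / 2) ^ (((k - l : ℕ) : ℝ) / l) + η) H →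
      ∀ A B Z : Finset (Fin n), A.card = l → B.card = l → Disjoint A B →
      (Z.card : ℝ) ≤ c * n →
      ∃ X, X.card = 2 * k - 3 * l ∧ Disjoint X Z ∧ LP H k l A X B := by
  obtain ⟨r, hr⟩ : ∃ r, r = k - l := ⟨_, rfl⟩
  obtain ⟨n₁, hn₁⟩ := half_lt_shadow (r := r) hl (by omega) (η := η / 2) (by linarith)
  obtain ⟨n₂, hn₂⟩ := pow_le_choose r
  have hf : (0 : ℝ) < r.factorial := by exact_mod_cast Nat.factorial_pos r
  set c : ℝ := η / (16 * r.factorial) with hc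
  have hc0 : 0 < c := by positivity
  obtain ⟨n₃, hn₃⟩ := exists_nat_gt ((2 * l + k : ℝ) / c)
  refine ⟨c, hc0, n₁ + n₂ + n₃ + 1, fun n hn H hH A B Z hA hB hAB hZ => ?_⟩
  rw [← hr] at hH
  have hn0 : (0 : ℝ) < n := by exact_mod_cast (by omega : 0 < n)
  set W := Z ∪ A ∪ B with hW
  have hWc : W.card ≤ Z.card + 2 * l := by
    have h1 := card_union_le (Z ∪ A) B
    have h2 := card_union_le Z A
    rw [← hW] at h1
    omega
  have h1 : (2 * l + k : ℝ) ≤ c * n := by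
    rw [div_lt_iff₀ hc0] at hn₃
    have h3 : (n₃ : ℝ) ≤ n := by exact_mod_cast (by omega : n₃ ≤ n)
    nlinarith
  have hpow : (n : ℝ) * (n : ℝ) ^ (r - 1) = (n : ℝ) ^ r := by
    rw [← pow_succ']; congr 1; omega
  have h2 : ((W.card + k : ℕ) : ℝ) * (n : ℝ) ^ (r - 1) ≤ η / 4 * n.choose r := by
    have h3 : ((W.card + k : ℕ) : ℝ) ≤ 2 * c * n := by
      have : ((W.card + k : ℕ) : ℝ) ≤ Z.card + 2 * l + k := by
        exact_mod_cast (by omega : W.card + k ≤ Z.card + 2 * l + k)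
      linarith
    calc _ ≤ 2 * c * n * (n : ℝ) ^ (r - 1) := mul_le_mul_of_nonneg_right h3 (by positivity)
      _ = 2 * c * (n : ℝ) ^ r := by rw [← hpow]; ring
      _ ≤ 2 * c * (2 * r.factorial * n.choose r) :=
          mul_le_mul_of_nonneg_left (hn₂ n (by omega)) (by positivity)
      _ = η / 4 * n.choose r := by rw [hc]; field_simp; ring
  set q0 := ((1 : ℝ) / 2) ^ ((r : ℝ) / l) with hq0
  -- links
  have hlink : ∀ A : Finset (Fin n), A.card = l →
      (q0 + 3 * η / 4) * n.choose r + k * (n : ℝ) ^ (r - 1) ≤ (linkAvoid H r A W).card := by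
    intro A hA
    have h3 := card_link_le hH.1 hA (W := W)
    rw [← hr, Fintype.card_fin] at h3
    have h4 : ((H.filter (A ⊆ ·)).card : ℝ) ≤
      (linkAvoid H r A W).card + W.card * (n : ℝ) ^ (r - 1) := by exact_mod_cast h3
    have h5 := hH.2 A hA
    rw [← hr, Fintype.card_fin] at h5
    push_cast at h2
    linarith
  have hmem : ∀ {A T : Finset (Fin n)}, T ∈ linkAvoid H r A W →
      T.card = r ∧ Disjoint T W ∧ A ∪ T ∈ H := by
    intro A T hT
    rw [linkAvoid, mem_filter, mem_powersetCard] at hT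
    exact ⟨hT.1.2, disjoint_left.2 fun v hv => mem_compl.1 (hT.1.1 hv), hT.2⟩
  set LA := linkAvoid H r A W with hLA
  set LB := linkAvoid H r B W with hLB
  set few : Finset (Finset (Fin n)) := ((univ : Finset (Fin n)).powersetCard l).filter
    fun C => (LB.filter (C ⊆ ·)).card ≤ k * n ^ (r - l - 1) with hfew
  set LB' := LB.filter fun T => ∀ C ∈ few, ¬ C ⊆ T with hLB'
  have hAc := hlink A hA
  have hBc := hlink B hB
  have hB'c : LB.card ≤ LB'.card + k * n ^ (r - 1) := by
    have hsub : LB ⊆ LB' ∪ few.biUnion fun C => LB.filter (C ⊆ ·) := by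
      intro T hT
      rw [mem_union, hLB', mem_filter, mem_biUnion]
      by_cases h : ∀ C ∈ few, ¬ C ⊆ T
      · exact Or.inl ⟨hT, h⟩
      · push Not at h
        obtain ⟨C, hC, hCT⟩ := h
        exact Or.inr ⟨C, hC, mem_filter.2 ⟨hT, hCT⟩⟩
    refine (card_le_card hsub).trans ((card_union_le _ _).trans (Nat.add_le_add_left ?_ _))
    refine card_biUnion_le.trans ?_
    calc _ ≤ few.card * (k * n ^ (r - l - 1)) := by
          rw [← smul_eq_mul]
          exact sum_le_card_nsmul _ _ _ fun C hC => (mem_filter.1 hC).2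
      _ ≤ n ^ l * (k * n ^ (r - l - 1)) := by
          refine Nat.mul_le_mul_right _ ((card_filter_le _ _).trans ?_)
          rw [card_powersetCard, card_univ, Fintype.card_fin]
          exact Nat.choose_le_pow _ _
      _ = k * (n ^ l * n ^ (r - l - 1)) := by ring
      _ = k * n ^ (r - 1) := by rw [← pow_add]; congr 2; omega
  have hB'c' : (LB.card : ℝ) ≤ LB'.card + k * (n : ℝ) ^ (r - 1) := by exact_mod_cast hB'c
  have hC0 : (0 : ℝ) ≤ n.choose r := by positivity
  have hsA : n.choose l < 2 * (shadow^[r - l] LA).card := by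
    refine hn₁ n (by omega) LA (fun T hT => (hmem hT).1) ?_
    have : (0 : ℝ) ≤ k * (n : ℝ) ^ (r - 1) := by positivity
    nlinarith
  have hsB : n.choose l < 2 * (shadow^[r - l] LB').card := by
    refine hn₁ n (by omega) LB' (fun T hT => (hmem (mem_filter.1 hT).1).1) ?_
    nlinarith
  have hmemS : ∀ {𝒜 : Finset (Finset (Fin n))}, (∀ T ∈ 𝒜, T.card = r) →
      ∀ C ∈ shadow^[r - l] 𝒜, C.card = l ∧ ∃ T ∈ 𝒜, C ⊆ T := by
    intro 𝒜 h𝒜 C hC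
    obtain ⟨T, hT, hCT, hc⟩ := mem_shadow_iterate_iff_exists_mem_card_add.1 hC
    rw [h𝒜 T hT] at hc
    exact ⟨by omega, T, hT, hCT⟩
  obtain ⟨C, hCA, hCB⟩ : ∃ C, C ∈ shadow^[r - l] LA ∧ C ∈ shadow^[r - l] LB' := by
    by_contra hcon
    push Not at hcon
    have hd : Disjoint (shadow^[r - l] LA) (shadow^[r - l] LB') := disjoint_left.2 hcon
    have hsub : shadow^[r - l] LA ∪ shadow^[r - l] LB' ⊆ (univ : Finset (Fin n)).powersetCard l := by
      intro C hC
      rw [mem_powersetCard]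
      refine ⟨subset_univ _, ?_⟩
      rcases mem_union.1 hC with h | h
      · exact (hmemS (fun T hT => (hmem hT).1) C h).1
      · exact (hmemS (fun T hT => (hmem (mem_filter.1 hT).1).1) C h).1
    have := card_le_card hsub
    rw [card_union_of_disjoint hd, card_powersetCard, card_univ, Fintype.card_fin] at this
    omega
  obtain ⟨hCl, TA, hTA, hCTA⟩ := hmemS (fun T hT => (hmem hT).1) C hCA
  obtain ⟨-, TB, hTB, hCTB⟩ := hmemS (fun T hT => (hmem (mem_filter.1 hT).1).1) C hCB
  obtain ⟨hTAc, hTAW, hTAH⟩ := hmem hTA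
  have hCmany : k * n ^ (r - l - 1) < (LB.filter (C ⊆ ·)).card := by
    by_contra hcon
    push Not at hcon
    refine (mem_filter.1 hTB).2 C ?_ hCTB
    rw [hfew, mem_filter, mem_powersetCard]
    exact ⟨⟨subset_univ _, hCl⟩, hcon⟩
  set I := TA \ C with hI
  have hIc : I.card = k - 2 * l := by
    rw [hI, card_sdiff_of_subset hCTA, hTAc, hCl]; omega
  obtain ⟨T, hT, hCT, hTI⟩ : ∃ T ∈ LB, C ⊆ T ∧ Disjoint T I := by
    by_contra hcon
    push Not at hcon
    have hsub : LB.filter (C ⊆ ·) ⊆ I.biUnion fun v => LB.filter (insert v C ⊆ ·) := by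
      intro T hT
      rw [mem_filter] at hT
      have := hcon T hT.1 hT.2
      rw [not_disjoint_iff] at this
      obtain ⟨v, hvT, hvI⟩ := this
      rw [mem_biUnion]
      exact ⟨v, hvI, mem_filter.2 ⟨hT.1, insert_subset hvT hT.2⟩⟩
    have h3 := (card_le_card hsub).trans card_biUnion_le
    have h4 : ∑ v ∈ I, (LB.filter (insert v C ⊆ ·)).card ≤ I.card * n ^ (r - l - 1) := by
      rw [← smul_eq_mul]
      refine sum_le_card_nsmul _ _ _ fun v hv => ?_
      have := card_superset_le (fun T hT => (hmem hT).1 : ∀ T ∈ LB, T.card = r) (insert v C)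
      rw [card_insert_of_notMem (mem_sdiff.1 hv).2, hCl, Fintype.card_fin] at this
      rwa [Nat.sub_sub]
    have h5 : I.card * n ^ (r - l - 1) ≤ k * n ^ (r - l - 1) := Nat.mul_le_mul_right _ (by omega)
    omega
  obtain ⟨hTc, hTW, hTH⟩ := hmem hT
  set J := T \ C with hJ
  have hJc : J.card = k - 2 * l := by
    rw [hJ, card_sdiff_of_subset hCT, hTc, hCl]; omega
  have eA : I ∪ C = TA := by rw [hI]; exact sdiff_union_of_subset hCTA
  have eB : C ∪ J = T := by rw [hJ]; exact union_sdiff_of_subset hCT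
  have dIC : Disjoint I C := sdiff_disjoint
  have dCJ : Disjoint C J := disjoint_sdiff
  have hIT : I ⊆ TA := sdiff_subset
  have hJT : J ⊆ T := sdiff_subset
  have e1 : LEdge H k l A I C := by
    refine ⟨hA, hIc, hCl, ?_, ?_, dIC, ?_⟩
    · simp only [hW, disjoint_left, mem_union, subset_iff] at *; grind
    · simp only [hW, disjoint_left, mem_union, subset_iff] at *; grind
    · rw [union_assoc, eA]; exact hTAH
  have e2 : LEdge H k l C J B := by
    refine ⟨hCl, hJc, hB, dCJ, ?_, ?_, ?_⟩
    · simp only [hW, disjoint_left, mem_union, subset_iff] at *; grind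
    · simp only [hW, disjoint_left, mem_union, subset_iff] at *; grind
    · rw [eB, union_comm]; exact hTH
  have hd : Disjoint (A ∪ I) (C ∪ J ∪ B) := by
    rw [eB]
    simp only [hW, disjoint_left, mem_union, subset_iff] at *; grind
  refine ⟨I ∪ C ∪ J, ?_, ?_, LP.cons e1 (LP.edge e2) hd⟩
  · have d2 : Disjoint (I ∪ C) J := by
      simp only [disjoint_left, mem_union, subset_iff] at *; grind
    rw [card_union_of_disjoint d2, card_union_of_disjoint dIC, hIc, hCl, hJc]; omega
  · simp only [hW, disjoint_left, mem_union, subset_iff] at *; grind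

end Connector

section Swaps

open Finset

variable {α : Type*} [DecidableEq α] {H : Finset (Finset α)} {k l : ℕ}

/-- Any two disjoint `l`-sets can be joined by a two-edge path avoiding any `q` vertices. -/
def Conn (H : Finset (Finset α)) (k l q : ℕ) : Prop :=
  ∀ A B Z : Finset α, A.card = l → B.card = l → Disjoint A B → Z.card ≤ q →
    ∃ X, X.card = 2 * k - 3 * l ∧ Disjoint X Z ∧ LP H k l A X B

theorem Conn.mono {q q' : ℕ} (h : Conn H k l q) (hq : q' ≤ q) : Conn H k l q' :=
  fun A B Z hA hB hAB hZ => h A B Z hA hB hAB (hZ.trans hq)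

/-- The vertices `T` together with either `U` or `W` form the interior of a path from `A`
to `B`. -/
structure SetSwap (H : Finset (Finset α)) (k l : ℕ) (A T B U W : Finset α) : Prop where
  left : LP H k l A (T ∪ U) B
  right : LP H k l A (T ∪ W) B
  dTU : Disjoint T U
  dTW : Disjoint T W

theorem SetSwap.symm {A T B U W : Finset α} (h : SetSwap H k l A T B U W) :
    SetSwap H k l A T B W U := ⟨h.right, h.left, h.dTW, h.dTU⟩

theorem SetSwap.join {A₁ T₁ B₁ U₁ W₁ A₂ T₂ B₂ U₂ W₂ Z : Finset α}
    (h₁ : SetSwap H k l A₁ T₁ B₁ U₁ W₁) (h₂ : SetSwap H k l A₂ T₂ B₂ U₂ W₂)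
    (hZ : LP H k l B₁ Z A₂)
    (hZd : Disjoint Z (A₁ ∪ T₁ ∪ U₁ ∪ W₁ ∪ T₂ ∪ B₂ ∪ U₂ ∪ W₂))
    (h12 : Disjoint (A₁ ∪ T₁ ∪ B₁) (A₂ ∪ T₂ ∪ B₂)) (h12' : Disjoint (A₁ ∪ T₁ ∪ B₁) (U₂ ∪ W₂))
    (h21 : Disjoint (A₂ ∪ T₂ ∪ B₂) (U₁ ∪ W₁)) (hU : Disjoint U₁ U₂) (hW : Disjoint W₁ W₂) :
    SetSwap H k l A₁ (T₁ ∪ B₁ ∪ Z ∪ A₂ ∪ T₂) B₂ (U₁ ∪ U₂) (W₁ ∪ W₂) := by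
  have key : ∀ {U₁ U₂ : Finset α}, LP H k l A₁ (T₁ ∪ U₁) B₁ → LP H k l A₂ (T₂ ∪ U₂) B₂ →
      Disjoint T₁ U₁ → Disjoint T₂ U₂ →
      Disjoint Z (A₁ ∪ T₁ ∪ U₁ ∪ T₂ ∪ B₂ ∪ U₂) → Disjoint (A₁ ∪ T₁ ∪ B₁) U₂ →
      Disjoint (A₂ ∪ T₂ ∪ B₂) U₁ → Disjoint U₁ U₂ →
      LP H k l A₁ (T₁ ∪ B₁ ∪ Z ∪ A₂ ∪ T₂ ∪ (U₁ ∪ U₂)) B₂ ∧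
        Disjoint (T₁ ∪ B₁ ∪ Z ∪ A₂ ∪ T₂) (U₁ ∪ U₂) := by
    intro U₁ U₂ h₁ h₂ d₁ d₂ hZd e₁ e₂ e₃
    have a1 := h₁.dAX
    have a2 := h₁.dAB
    have a3 := h₁.dXB
    have b1 := h₂.dAX
    have b2 := h₂.dAB
    have b3 := h₂.dXB
    have c1 := hZ.dAX
    have c2 := hZ.dAB
    have c3 := hZ.dXB
    have f1 : Disjoint (A₁ ∪ (T₁ ∪ U₁)) (B₁ ∪ Z ∪ A₂) := by
      simp only [disjoint_union_right, disjoint_comm] at *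
      tauto
    have f2 : Disjoint (A₁ ∪ (T₁ ∪ U₁ ∪ B₁ ∪ Z)) (A₂ ∪ (T₂ ∪ U₂) ∪ B₂) := by
      simp only [disjoint_union_right, disjoint_comm] at *
      tauto
    refine ⟨?_, ?_⟩
    · have := (h₁.trans hZ f1).trans h₂ f2
      convert this using 1
      ext v
      simp only [mem_union]
      tauto
    · simp only [disjoint_union_right, disjoint_comm] at *
      tauto
  simp only [disjoint_union_right] at hZd h12' h21
  obtain ⟨p1, p2⟩ := key h₁.left h₂.left h₁.dTU h₂.dTU
    (by simp only [disjoint_union_right]; tauto) h12'.1 h21.1 hU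
  obtain ⟨p3, p4⟩ := key h₁.right h₂.right h₁.dTW h₂.dTW
    (by simp only [disjoint_union_right]; tauto) h12'.2 h21.2 hW
  exact ⟨p1, p3, p2, p4⟩

/-- A common part of the two exchanged sets may be moved to the fixed part. -/
theorem SetSwap.of_common {A T B U W X U' W' : Finset α} (h : SetSwap H k l A T B U' W')
    (hU : U' = X ∪ U) (hW : W' = X ∪ W) (hXU : Disjoint X U) (hXW : Disjoint X W) :
    SetSwap H k l A (T ∪ X) B U W := by
  subst hU hW
  obtain ⟨h1, h2, h3, h4⟩ := h
  simp only [disjoint_union_right] at h3 h4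
  refine ⟨?_, ?_, disjoint_union_left.2 ⟨h3.2, hXU⟩, disjoint_union_left.2 ⟨h4.2, hXW⟩⟩
  · rwa [union_assoc]
  · rwa [union_assoc]

/-- There are swaps of `U` and `W` of size at most `b` avoiding any given `q` vertices. -/
def RobSwap (H : Finset (Finset α)) (k l b q : ℕ) (U W : Finset α) : Prop :=
  ∀ Z : Finset α, Z.card ≤ q → ∃ A T B, SetSwap H k l A T B U W ∧
    Disjoint (A ∪ T ∪ B) Z ∧ (A ∪ T ∪ B).card ≤ b

theorem RobSwap.mono {b b' q q' : ℕ} {U W : Finset α} (h : RobSwap H k l b q U W) (hb : b ≤ b')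
    (hq : q' ≤ q) : RobSwap H k l b' q' U W := by
  intro Z hZ
  obtain ⟨A, T, B, h1, h2, h3⟩ := h Z (hZ.trans hq)
  exact ⟨A, T, B, h1, h2, h3.trans hb⟩

theorem RobSwap.symm {b q : ℕ} {U W : Finset α} (h : RobSwap H k l b q U W) :
    RobSwap H k l b q W U := by
  intro Z hZ
  obtain ⟨A, T, B, h1, h2, h3⟩ := h Z hZ
  exact ⟨A, T, B, h1.symm, h2, h3⟩

theorem card_union_le_of_le {s t : Finset α} {a b : ℕ} (hs : s.card ≤ a) (ht : t.card ≤ b) :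
    (s ∪ t).card ≤ a + b :=
  (card_union_le _ _).trans (add_le_add hs ht)

theorem RobSwap.join {b q q' : ℕ} {U₁ W₁ U₂ W₂ : Finset α} (h₁ : RobSwap H k l b q U₁ W₁)
    (h₂ : RobSwap H k l b q U₂ W₂) (hC : Conn H k l q) (hkb : 2 * k ≤ b)
    (hq : q' + 6 * b ≤ q) (hU₁ : U₁.card ≤ b) (hU₂ : U₂.card ≤ b) (hW₁ : W₁.card ≤ b)
    (hW₂ : W₂.card ≤ b) (hU : Disjoint U₁ U₂) (hW : Disjoint W₁ W₂) :
    RobSwap H k l (3 * b) q' (U₁ ∪ U₂) (W₁ ∪ W₂) := by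
  intro Z hZ
  set D := Z ∪ U₁ ∪ U₂ ∪ W₁ ∪ W₂ with hD
  have hDc : D.card ≤ q' + b + b + b + b :=
    card_union_le_of_le (card_union_le_of_le (card_union_le_of_le (card_union_le_of_le hZ hU₁)
      hU₂) hW₁) hW₂
  obtain ⟨A₁, T₁, B₁, s₁, d₁, c₁⟩ := h₁ (Z ∪ U₂ ∪ W₂)
    ((card_union_le_of_le (card_union_le_of_le hZ hU₂) hW₂).trans (by omega))
  obtain ⟨A₂, T₂, B₂, s₂, d₂, c₂⟩ := h₂ (Z ∪ U₁ ∪ W₁ ∪ (A₁ ∪ T₁ ∪ B₁))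
    ((card_union_le_of_le (card_union_le_of_le (card_union_le_of_le hZ hU₁) hW₁) c₁).trans
      (by omega))
  have e : Disjoint B₁ A₂ := by
    simp only [disjoint_union_right, disjoint_comm] at *
    tauto
  obtain ⟨X, hXc, hX, hp⟩ := hC B₁ A₂ (D ∪ (A₁ ∪ T₁ ∪ B₁) ∪ (A₂ ∪ T₂ ∪ B₂)) s₁.left.cardB
    s₂.left.cardA e ((card_union_le_of_le (card_union_le_of_le hDc c₁) c₂).trans (by omega))
  refine ⟨A₁, T₁ ∪ B₁ ∪ X ∪ A₂ ∪ T₂, B₂, s₁.join s₂ hp ?_ ?_ ?_ ?_ hU hW, ?_, ?_⟩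
  · simp only [hD, disjoint_union_right, disjoint_comm] at *
    tauto
  · simp only [disjoint_union_right, disjoint_comm] at *
    tauto
  · simp only [disjoint_union_right, disjoint_comm] at *
    tauto
  · simp only [disjoint_union_right, disjoint_comm] at *
    tauto
  · simp only [hD, disjoint_union_right, disjoint_comm] at *
    tauto
  · have h : A₁ ∪ (T₁ ∪ B₁ ∪ X ∪ A₂ ∪ T₂) ∪ B₂ = A₁ ∪ T₁ ∪ B₁ ∪ X ∪ (A₂ ∪ T₂ ∪ B₂) := by
      ext v
      simp only [mem_union]
      tauto
    rw [h]
    exact (card_union_le_of_le (card_union_le_of_le c₁ (le_of_eq hXc)) c₂).trans (by omega)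

/-- Swaps may be composed through intermediate sets. -/
theorem RobSwap.chain {b q q' : ℕ} {U W : Finset α} (hC : Conn H k l q) (hkb : 2 * k ≤ b)
    (hq : q' + 26 * b ≤ q) (hU : U.card ≤ b) (hW : W.card ≤ b)
    (h : ∀ Z : Finset α, Z.card ≤ q' → ∃ X Y : Finset α, Disjoint X (Z ∪ U ∪ W) ∧
      Disjoint Y (Z ∪ U ∪ W) ∧ Disjoint X Y ∧ X.card ≤ b ∧ Y.card ≤ b ∧
      RobSwap H k l b q U X ∧ RobSwap H k l b q X Y ∧ RobSwap H k l b q Y W) :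
    RobSwap H k l (11 * b) q' U W := by
  intro Z hZ
  obtain ⟨X, Y, hX, hY, hXY, hXc, hYc, h1, h2, h3⟩ := h Z hZ
  simp only [disjoint_union_right] at hX hY
  have h12 := RobSwap.join (q' := q' + 20 * b) h1 h2 hC hkb (by omega) hU hXc hXc hYc
    hX.1.2.symm hXY
  obtain ⟨A, T, B, s, d, c⟩ := RobSwap.join (q' := q' + 2 * b) h12
    (h3.mono (show b ≤ 3 * b by omega) (show q' + 20 * b ≤ q by omega)) (hC.mono (by omega))
    (by omega) (by omega)
    ((card_union_le_of_le hU hXc).trans (by omega)) (by omega)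
    ((card_union_le_of_le hXc hYc).trans (by omega)) (by omega)
    (disjoint_union_left.2 ⟨hY.1.2.symm, hXY⟩) (disjoint_union_left.2 ⟨hX.2, hY.2⟩)
    (Z ∪ X ∪ Y) ((card_union_le_of_le (card_union_le_of_le hZ hXc) hYc).trans (by omega))
  simp only [disjoint_union_right] at d
  refine ⟨A, T ∪ (X ∪ Y), B, s.of_common (X := X ∪ Y) ?_ rfl ?_ ?_, ?_, ?_⟩
  · ext v
    simp only [mem_union]
    tauto
  · exact disjoint_union_left.2 ⟨hX.1.2, hY.1.2⟩
  · exact disjoint_union_left.2 ⟨hX.2, hY.2⟩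
  · simp only [disjoint_union_right, disjoint_union_left] at *
    tauto
  · have h : A ∪ (T ∪ (X ∪ Y)) ∪ B = A ∪ T ∪ B ∪ X ∪ Y := by
      ext v
      simp only [mem_union]
      tauto
    rw [h]
    exact (card_union_le_of_le (card_union_le_of_le c hXc) hYc).trans (by omega)

/-- Swaps of single vertices combine to swaps of sets. -/
theorem RobSwap.of_singletons {b q : ℕ} (hC : Conn H k l q) (hkb : 2 * k ≤ b) (hb : 1 ≤ b)
    (s : ℕ) (hs : 1 ≤ s) : ∀ q' : ℕ, q' + 6 * s * 3 ^ s * b ≤ q → ∀ U W : Finset α,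
      U.card = s → W.card = s → (∀ u ∈ U, ∀ w ∈ W, RobSwap H k l b q {u} {w}) →
      RobSwap H k l (3 ^ s * b) q' U W := by
  induction s, hs using Nat.le_induction with
  | base =>
    intro q' hq U W hU hW h
    obtain ⟨u, rfl⟩ := card_eq_one.1 hU
    obtain ⟨w, rfl⟩ := card_eq_one.1 hW
    exact (h u (mem_singleton_self u) w (mem_singleton_self w)).mono (by omega) (by omega)
  | succ s hs ih =>
    intro q' hq U W hU hW h
    have hpow : (3 : ℕ) ^ (s + 1) = 3 * 3 ^ s := by ring
    have hp1 : 1 ≤ 3 ^ s := Nat.one_le_pow _ _ (by norm_num)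
    have hps : s + 1 ≤ 3 ^ s := by
      have := (Nat.lt_pow_self (by norm_num : 1 < 3) : s < 3 ^ s)
      omega
    have hbb : b ≤ 3 ^ s * b := Nat.le_mul_of_pos_left _ hp1
    have hsb : s + 1 ≤ 3 ^ s * b := hps.trans (Nat.le_mul_of_pos_right _ hb)
    obtain ⟨P, hP⟩ : ∃ P, P = 3 ^ s * b := ⟨_, rfl⟩
    have hsP : 6 * (s + 1) * 3 ^ (s + 1) * b = 18 * (s * P) + 18 * P := by
      rw [hP, hpow]; ring
    have hsP' : 6 * s * 3 ^ s * b = 6 * (s * P) := by rw [hP]; ring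
    have hbq : q' + 6 * P + 6 * (s * P) ≤ q := by omega
    obtain ⟨u, U', hu, rfl, hU'⟩ := card_eq_succ.1 hU
    obtain ⟨w, W', hw, rfl, hW'⟩ := card_eq_succ.1 hW
    have h1 := ih (q' + 6 * P) (by omega) U' W' hU' hW'
      fun u hu w hw => h u (mem_insert_of_mem hu) w (mem_insert_of_mem hw)
    have h2 := (h u (mem_insert_self _ _) w (mem_insert_self _ _)).mono hbb
      (show q' + 6 * P ≤ q by omega)
    rw [hpow, mul_assoc, insert_eq, insert_eq]
    refine h2.join h1 (hC.mono (by omega)) (by omega) (by omega) ?_ ?_ ?_ ?_ ?_ ?_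
    · rw [card_singleton]; omega
    · omega
    · rw [card_singleton]; omega
    · omega
    · exact disjoint_singleton_left.2 hu
    · exact disjoint_singleton_left.2 hw

end Swaps

section Lookalikes

open Finset

variable {V : Type*} [Fintype V] [DecidableEq V] {k l m : ℕ} {H : Finset (Finset V)}

theorem card_hit_le (Z : Finset V) :
    Fintype.card V * (univ.filter fun x : Fin m → V => ∃ i, x i ∈ Z).card ≤
      m * Z.card * Fintype.card V ^ m := by
  have hsub : (univ.filter fun x : Fin m → V => ∃ i, x i ∈ Z) ⊆
      ((univ : Finset (Fin m)) ×ˢ Z).biUnion fun p => univ.filter fun x => x p.1 = p.2 := by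
    intro x hx
    obtain ⟨i, hi⟩ := (mem_filter.1 hx).2
    exact mem_biUnion.2 ⟨(i, x i), mem_product.2 ⟨mem_univ _, hi⟩, by simp⟩
  calc _ ≤ Fintype.card V * ∑ p ∈ (univ : Finset (Fin m)) ×ˢ Z,
        (univ.filter fun x : Fin m → V => x p.1 = p.2).card :=
        Nat.mul_le_mul_left _ ((card_le_card hsub).trans card_biUnion_le)
    _ = ∑ p ∈ (univ : Finset (Fin m)) ×ˢ Z,
        Fintype.card V * (univ.filter fun x : Fin m → V => x p.1 = p.2).card := by
        rw [mul_sum]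
    _ ≤ ∑ p ∈ (univ : Finset (Fin m)) ×ˢ Z, Fintype.card V ^ m :=
        sum_le_sum fun p _ => card_coord_eq_le p.1 (fun _ => p.2) fun _ _ _ => rfl
    _ = _ := by simp

/-- A positive proportion of tuples contains an injective one avoiding a bounded set; more
precisely few tuples are not of this kind. -/
theorem card_bad_tuple_le [Nonempty V] (Z : Finset V) (m : ℕ) :
    Fintype.card V *
      (univ.filter fun x : Fin m → V => ¬ (Function.Injective x ∧ ∀ i, x i ∉ Z)).card ≤
      (m ^ 2 + m * Z.card) * Fintype.card V ^ m := by
  have h1 := card_not_injective_le (V := V) (m := m) ∅ (fun _ => Classical.arbitrary V)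
    (by simp)
  simp only [piecewise_empty] at h1
  have h2 := card_hit_le (m := m) Z
  have hsub : (univ.filter fun x : Fin m → V => ¬ (Function.Injective x ∧ ∀ i, x i ∉ Z)) ⊆
      (univ.filter fun x : Fin m → V => ¬ Function.Injective x) ∪
        univ.filter fun x : Fin m → V => ∃ i, x i ∈ Z := by
    intro x hx
    simp only [mem_filter, mem_univ, true_and, mem_union] at hx ⊢
    by_cases h : Function.Injective x
    · right
      by_contra h'
      exact hx ⟨h, fun i hi => h' ⟨i, hi⟩⟩
    · exact Or.inl h
  calc _ ≤ Fintype.card V * _ :=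
        Nat.mul_le_mul_left _ ((card_le_card hsub).trans (card_union_le _ _))
    _ ≤ _ := by rw [mul_add, add_mul]; exact add_le_add h1 h2

end Lookalikes

section Lookalikes

open Finset

theorem DegDense.le_one {V : Type*} [Fintype V] [DecidableEq V] {k l : ℕ} {d : ℝ}
    {H : Finset (Finset V)} (hlk : l ≤ k) (hV : k ≤ Fintype.card V) (h : DegDense k l d H) :
    d ≤ 1 := by
  obtain ⟨S, -, hS⟩ := exists_subset_card_eq (s := (univ : Finset V)) (n := l)
    (by rw [card_univ]; omega)
  have h1 := h.2 S hS
  have h2 : (H.filter (S ⊆ ·)).card ≤ (Fintype.card V).choose (k - l) := by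
    rw [← card_univ, ← card_powersetCard]
    refine card_le_card_of_injOn (fun e => e \ S) ?_ ?_
    · intro e he
      simp only [coe_filter, Set.mem_ofPred_eq, mem_coe, mem_powersetCard, subset_univ,
        true_and] at he ⊢
      rw [card_sdiff_of_subset he.2, h.1 e he.1, hS]
    · intro e he e' he' hee
      simp only [coe_filter, Set.mem_ofPred_eq] at he he'
      simp only at hee
      rw [← union_sdiff_of_subset he.2, ← union_sdiff_of_subset he'.2, hee]
  have h3 : (0 : ℝ) < (Fintype.card V).choose (k - l) := by
    exact_mod_cast Nat.choose_pos (by omega)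
  have h4 : ((H.filter (S ⊆ ·)).card : ℝ) ≤ (Fintype.card V).choose (k - l) := by
    exact_mod_cast h2
  nlinarith

/-- Averaging the count of edges extending an `l`-set over the choice of the `l`-set. -/
theorem extension_count (k l : ℕ) (hlk : l ≤ k) {δ : ℝ} (hδ : 0 < δ) :
    ∃ n₀ : ℕ, ∀ (V : Type) [Fintype V] [DecidableEq V], n₀ ≤ Fintype.card V →
      ∀ (d : ℝ) (H : Finset (Finset V)), 0 ≤ d → DegDense k l d H →
      ∀ (m : ℕ) (T : Finset (Fin m)), T.card = k - l →
      ∀ (P : (Fin m → V) → Prop) [DecidablePred P] (S : (Fin m → V) → Finset V),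
        (∀ x z, P (T.piecewise x z) ↔ P z) → (∀ x z, S (T.piecewise x z) = S z) →
        (∀ z, P z → (S z).card = l) →
        (d - δ) * ((univ.filter P).card : ℝ) ≤
          ((univ.filter fun z => P z ∧ S z ∪ T.image z ∈ H).card : ℝ) := by
  obtain ⟨n₀, hn₀⟩ := core_count k l hδ
  refine ⟨n₀ + k + 1, fun V _ _ hV d H hd0 hH m T hT P _ S hP hS hPS => ?_⟩
  have : Nonempty V := Fintype.card_pos_iff.1 (by omega)
  set Q : (Fin m → V) → Prop := fun z => P z ∧ S z ∪ T.image z ∈ H with hQ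
  have hN : (0 : ℝ) < (Fintype.card V : ℝ) ^ m := by
    have : 0 < Fintype.card V := Fintype.card_pos
    positivity
  let e : (Fin m → V) × (Fin m → V) ≃ (Fin m → V) × (Fin m → V) :=
    { toFun := fun p => (T.piecewise p.1 p.2, T.piecewise p.2 p.1)
      invFun := fun p => (T.piecewise p.1 p.2, T.piecewise p.2 p.1)
      left_inv := by
        rintro ⟨z, x⟩
        ext i <;> by_cases hi : i ∈ T <;> simp [hi]
      right_inv := by
        rintro ⟨z, x⟩
        ext i <;> by_cases hi : i ∈ T <;> simp [hi] }
  have h1 : (univ.filter fun p : (Fin m → V) × (Fin m → V) => Q (e p).1).card =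
      (univ.filter Q).card * Fintype.card V ^ m := by
    have : (univ.filter fun p : (Fin m → V) × (Fin m → V) => Q (e p).1).card =
        (univ.filter fun p : (Fin m → V) × (Fin m → V) => Q p.1).card := by
      refine card_bij (fun p _ => e p) (by simp) (fun _ _ _ _ h => e.injective h) ?_
      intro p hp
      exact ⟨e.symm p, by simpa using hp, by simp⟩
    rw [this, show (univ.filter fun p : (Fin m → V) × (Fin m → V) => Q p.1) =
      (univ.filter Q) ×ˢ (univ : Finset (Fin m → V)) by ext; simp, card_product]
    simp
  have h2 : (univ.filter fun p : (Fin m → V) × (Fin m → V) => Q (e p).1).card =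
      ∑ z ∈ univ.filter P, (univ.filter fun x : Fin m → V => S z ∪ T.image x ∈ H).card := by
    rw [card_eq_sum_card_fiberwise (f := Prod.snd) (t := univ.filter P)]
    · refine sum_congr rfl fun z hz => ?_
      refine card_bij (fun p _ => p.1) ?_ ?_ ?_
      · rintro ⟨x, y⟩ h
        simp only [mem_filter, mem_univ, true_and, hQ, e, Equiv.coe_fn_mk, hS] at h ⊢
        obtain ⟨⟨-, h⟩, rfl⟩ := h
        convert h using 2
        exact image_congr fun i hi => by simp [mem_coe.1 hi]
      · rintro ⟨x, y⟩ h ⟨x', y'⟩ h' hxx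
        simp only [mem_filter] at h h'
        exact Prod.ext hxx (h.2.trans h'.2.symm)
      · intro x hx
        refine ⟨(x, z), ?_, rfl⟩
        simp only [mem_filter, mem_univ, true_and, hQ, e, Equiv.coe_fn_mk, hS, hP,
          and_true] at hx hz ⊢
        refine ⟨hz, ?_⟩
        convert hx using 2
        exact image_congr fun i hi => by simp [mem_coe.1 hi]
    · intro p hp
      simp only [coe_filter, mem_univ, true_and, Set.mem_ofPred_eq, hQ, e, Equiv.coe_fn_mk,
        hP] at hp ⊢
      exact hp.1
  have h3 : (d - δ) * ((univ.filter P).card : ℝ) * (Fintype.card V : ℝ) ^ m ≤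
      ((univ.filter Q).card : ℝ) * (Fintype.card V : ℝ) ^ m := by
    have h4 : ((univ.filter Q).card : ℝ) * (Fintype.card V : ℝ) ^ m =
        ∑ z ∈ univ.filter P,
          ((univ.filter fun x : Fin m → V => S z ∪ T.image x ∈ H).card : ℝ) := by
      exact_mod_cast h1.symm.trans h2
    rw [h4]
    calc _ = ∑ z ∈ univ.filter P, (d - δ) * (Fintype.card V : ℝ) ^ m := by
          rw [sum_const, nsmul_eq_mul]; ring
      _ ≤ _ := sum_le_sum fun z hz => hn₀ V (by omega) d H hd0
          (hH.le_one hlk (by omega)) hH m (S z) (hPS z (mem_filter.1 hz).2) T hT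
  exact le_of_mul_le_mul_right h3 hN

end Lookalikes

section Lookalikes

open Finset

theorem bad_tuple_small (m q : ℕ) {ε : ℝ} (hε : 0 < ε) :
    ∃ n₀ : ℕ, ∀ (V : Type) [Fintype V] [DecidableEq V], n₀ ≤ Fintype.card V →
      ∀ Z : Finset V, Z.card ≤ q →
        ((univ.filter fun x : Fin m → V => ¬ (Function.Injective x ∧ ∀ i, x i ∉ Z)).card : ℝ) ≤
          ε * (Fintype.card V : ℝ) ^ m := by
  obtain ⟨n₀, hn₀⟩ := exists_nat_gt (((m ^ 2 + m * q : ℕ) : ℝ) / ε)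
  refine ⟨n₀ + 1, fun V _ _ hV Z hZ => ?_⟩
  have hV0 : 0 < Fintype.card V := by omega
  have : Nonempty V := Fintype.card_pos_iff.1 hV0
  have h1 := card_bad_tuple_le Z m
  have h2 : ((Fintype.card V : ℕ) : ℝ) *
      (univ.filter fun x : Fin m → V => ¬ (Function.Injective x ∧ ∀ i, x i ∉ Z)).card ≤
      ((m ^ 2 + m * q : ℕ) : ℝ) * (Fintype.card V : ℝ) ^ m := by
    have h3 := h1.trans (Nat.mul_le_mul_right (Fintype.card V ^ m)
      (Nat.add_le_add_left (Nat.mul_le_mul_left m hZ) (m ^ 2)))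
    exact_mod_cast h3
  rw [div_lt_iff₀ hε] at hn₀
  have h4 : (n₀ : ℝ) ≤ Fintype.card V := by exact_mod_cast (by omega : n₀ ≤ Fintype.card V)
  have h5 : (0 : ℝ) < Fintype.card V := by exact_mod_cast hV0
  have h6 : (0 : ℝ) < (Fintype.card V : ℝ) ^ m := by positivity
  refine le_of_mul_le_mul_left (h2.trans ?_) h5
  have h7 : ((m ^ 2 + m * q : ℕ) : ℝ) ≤ ε * Fintype.card V := by nlinarith
  calc _ ≤ ε * Fintype.card V * (Fintype.card V : ℝ) ^ m :=
        mul_le_mul_of_nonneg_right h7 h6.le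
    _ = _ := by ring

/-- Every vertex lies in a positive proportion of the edges. -/
theorem vertex_count (k l : ℕ) (hl : 1 ≤ l) (hlk : l < k) {d : ℝ} (hd : 0 < d) :
    ∃ n₀ : ℕ, ∀ (V : Type) [Fintype V] [DecidableEq V], n₀ ≤ Fintype.card V →
      ∀ H : Finset (Finset V), DegDense k l d H → ∀ i₀ : Fin k, i₀.1 = 0 → ∀ u : V,
        d / 4 * (Fintype.card V : ℝ) ^ k ≤
          ((univ.filter fun g : Fin k → V =>
            univ.image (Function.update g i₀ u) ∈ H).card : ℝ) := by
  obtain ⟨n₁, hn₁⟩ := extension_count k l hlk.le (δ := d / 2) (by linarith)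
  obtain ⟨n₂, hn₂⟩ := bad_tuple_small k 1 (ε := 1 / 2) (by norm_num)
  refine ⟨n₁ + n₂ + 1, fun V _ _ hV H hH i₀ hi₀ u => ?_⟩
  set T : Finset (Fin k) := univ.filter fun i => l ≤ i.1 with hT
  set L : Finset (Fin k) := univ.filter fun i => i.1 < l with hL
  have hLc : L.card = l := by
    rw [hL, Fin.card_filter_val_lt]
    omega
  have hTL : L = Tᶜ := by ext; simp [hT, hL]
  have hTc : T.card = k - l := by
    have h1 : T.card + L.card = k := by
      rw [hTL, card_add_card_compl]; simp
    omega
  have hi₀T : i₀ ∉ T := by simp [hT]; omega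
  set S : (Fin k → V) → Finset V := fun z => L.image (Function.update z i₀ u) with hS
  have hSpw : ∀ x z, S (T.piecewise x z) = S z := by
    intro x z
    refine image_congr fun i hi => ?_
    have hi' : i ∉ T := by
      have := mem_coe.1 hi
      rw [hTL] at this
      exact mem_compl.1 this
    by_cases h : i = i₀
    · subst h; simp
    · simp [h, hi']
  have h1 := hn₁ V (by omega) d H hd.le hH k T hTc (fun z => (S z).card = l) S
    (fun x z => by rw [hSpw]) hSpw (fun z h => h)
  have h2 := hn₂ V (by omega) {u} (by simp)
  have h3 : ((univ.filter fun x : Fin k → V =>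
      ¬ (Function.Injective x ∧ ∀ i, x i ∉ ({u} : Finset V))).card : ℝ) +
      ((univ.filter fun z => (S z).card = l).card : ℝ) ≥ (Fintype.card V : ℝ) ^ k := by
    have h4 : (univ : Finset (Fin k → V)) ⊆ (univ.filter fun x : Fin k → V =>
      ¬ (Function.Injective x ∧ ∀ i, x i ∉ ({u} : Finset V))) ∪
        univ.filter fun z => (S z).card = l := by
      intro z _
      rw [mem_union, mem_filter, mem_filter]
      by_cases h : Function.Injective z ∧ ∀ i, z i ∉ ({u} : Finset V)
      · refine Or.inr ⟨mem_univ _, ?_⟩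
        rw [← hLc]
        refine card_image_of_injective _ ?_
        intro i j hij
        have hu : ∀ i, z i ≠ u := fun i => by simpa using h.2 i
        by_cases hi : i = i₀ <;> by_cases hj : j = i₀
        · rw [hi, hj]
        · subst hi
          simp only [Function.update_self, Function.update_of_ne hj] at hij
          exact absurd hij.symm (hu j)
        · subst hj
          simp only [Function.update_self, Function.update_of_ne hi] at hij
          exact absurd hij (hu i)
        · simp only [Function.update_of_ne hj, Function.update_of_ne hi] at hij
          exact h.1 hij
      · exact Or.inl ⟨mem_univ _, h⟩
    have h5 := (card_le_card h4).trans (card_union_le _ _)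
    rw [card_univ, Fintype.card_fun, Fintype.card_fin] at h5
    exact_mod_cast h5
  have h4 : ((univ.filter fun z => (S z).card = l ∧ S z ∪ T.image z ∈ H).card : ℝ) ≤
      ((univ.filter fun g : Fin k → V =>
            univ.image (Function.update g i₀ u) ∈ H).card : ℝ) := by
    refine Nat.cast_le.2 (card_le_card fun z hz => ?_)
    simp only [mem_filter, mem_univ, true_and] at hz ⊢
    convert hz.2 using 1
    have h6 : T.image z = T.image (Function.update z i₀ u) := by
      refine image_congr fun i hi => ?_
      have : i ≠ i₀ := fun h => hi₀T (h ▸ hi)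
      simp [this]
    rw [h6, hS, ← image_union, hTL]
    congr 1
    ext i
    by_cases hi : i ∈ T <;> simp [hi]
  nlinarith

/-- Tuples that extend both `u` and `w` to an edge. -/
def commonTuples {V : Type*} [Fintype V] [DecidableEq V] {k : ℕ} (H : Finset (Finset V))
    (i₀ : Fin k) (u w : V) : Finset (Fin k → V) :=
  univ.filter fun g => univ.image (Function.update g i₀ u) ∈ H ∧
    univ.image (Function.update g i₀ w) ∈ H

/-- Vertices `w` such that `u` and `w` have a `κ`-proportion of common extending tuples. -/
noncomputable def lookalikes {V : Type*} [Fintype V] [DecidableEq V] {k : ℕ}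
    (H : Finset (Finset V)) (i₀ : Fin k) (κ : ℝ) (u : V) : Finset V :=
  open Classical in
  univ.filter fun w => κ * (Fintype.card V : ℝ) ^ k ≤ ((commonTuples H i₀ u w).card : ℝ)

theorem mem_lookalikes {V : Type*} [Fintype V] [DecidableEq V] {k : ℕ}
    {H : Finset (Finset V)} {i₀ : Fin k} {κ : ℝ} {u w : V} : w ∈ lookalikes H i₀ κ u ↔
      κ * (Fintype.card V : ℝ) ^ k ≤ ((commonTuples H i₀ u w).card : ℝ) := by
  simp [lookalikes]

/-- Few vertices have few lookalikes. -/
theorem card_few_lookalikes {V : Type*} [Fintype V] [DecidableEq V] [Nonempty V] {k : ℕ}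
    {H : Finset (Finset V)} {i₀ : Fin k} {κ c : ℝ} (hκ : 0 < κ) (hc : 0 ≤ c)
    (hH : ∀ u : V, κ * (Fintype.card V : ℝ) ^ k ≤ ((univ.filter fun g : Fin k → V =>
            univ.image (Function.update g i₀ u) ∈ H).card : ℝ)) (U : Finset V)
    (hU : ∀ u ∈ U, ((lookalikes H i₀ (κ ^ 2 / 2) u).card : ℝ) ≤ c * Fintype.card V) :
    κ ^ 2 / 2 * U.card ≤ c * Fintype.card V := by
  set N : ℝ := (Fintype.card V : ℝ) ^ k with hN
  have hN0 : 0 < N := by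
    have : 0 < Fintype.card V := Fintype.card_pos
    positivity
  set D : V → Finset (Fin k → V) := fun u => univ.filter fun g : Fin k → V =>
            univ.image (Function.update g i₀ u) ∈ H with hD
  have hcom : ∀ u w, commonTuples H i₀ u w = D u ∩ D w := by
    intro u w; ext g; simp [commonTuples, hD]
  set f : (Fin k → V) → ℝ := fun g => ((U.filter fun u => g ∈ D u).card : ℝ) with hf
  have h1 : ∑ g, f g = ∑ u ∈ U, ((D u).card : ℝ) := by
    simp only [hf]
    have := sum_card_bipartiteAbove_eq_sum_card_bipartiteBelow (s := U)
      (t := (univ : Finset (Fin k → V))) (fun u g => g ∈ D u)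
    simp only [bipartiteAbove, bipartiteBelow, filter_mem_eq_inter, univ_inter] at this
    exact_mod_cast this.symm
  have h2 : ∑ g, f g ^ 2 = ∑ u ∈ U, ∑ w ∈ U, ((commonTuples H i₀ u w).card : ℝ) := by
    have h3 : ∀ g, f g ^ 2 = ∑ u ∈ U, ∑ w ∈ U, if g ∈ D u ∩ D w then (1 : ℝ) else 0 := by
      intro g
      simp only [hf, card_filter, Nat.cast_sum, sq, sum_mul_sum]
      refine sum_congr rfl fun u _ => sum_congr rfl fun w _ => ?_
      by_cases h1 : g ∈ D u <;> by_cases h2 : g ∈ D w <;> simp [h1, h2]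
    simp only [h3, hcom]
    rw [sum_comm]
    refine sum_congr rfl fun u _ => ?_
    rw [sum_comm]
    refine sum_congr rfl fun w _ => ?_
    rw [sum_boole, filter_mem_eq_inter, univ_inter]
  have h3 : (∑ g, f g) ^ 2 ≤ N * ∑ g, f g ^ 2 := by
    have := sq_sum_le_card_mul_sum_sq (s := (univ : Finset (Fin k → V))) (f := f)
    simpa [hN] using this
  have h4 : (U.card : ℝ) * (κ * N) ≤ ∑ g, f g := by
    rw [h1, ← nsmul_eq_mul]
    exact card_nsmul_le_sum _ _ _ fun u _ => hH u
  have h5 : ∑ g, f g ^ 2 ≤ U.card * (c * Fintype.card V * N + U.card * (κ ^ 2 / 2 * N)) := by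
    rw [h2, ← nsmul_eq_mul]
    refine sum_le_card_nsmul _ _ _ fun u hu => ?_
    calc ∑ w ∈ U, ((commonTuples H i₀ u w).card : ℝ) ≤
          ∑ w ∈ U, ((if w ∈ lookalikes H i₀ (κ ^ 2 / 2) u then N else 0) + κ ^ 2 / 2 * N) := by
          refine sum_le_sum fun w _ => ?_
          split_ifs with h
          · have : ((commonTuples H i₀ u w).card : ℝ) ≤ N := by
              rw [hN]
              have := card_le_univ (commonTuples H i₀ u w)
              rw [Fintype.card_fun, Fintype.card_fin] at this
              exact_mod_cast this
            have : 0 ≤ κ ^ 2 / 2 * N := by positivity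
            linarith
          · rw [mem_lookalikes] at h
            linarith
      _ ≤ _ := by
          rw [sum_add_distrib, sum_const, nsmul_eq_mul, ← sum_filter, sum_const, nsmul_eq_mul]
          refine add_le_add_left (mul_le_mul_of_nonneg_right ?_ hN0.le) _
          refine le_trans (Nat.cast_le.2 (card_le_card ?_)) (hU u hu)
          intro w hw
          exact (mem_filter.1 hw).2
  rcases Nat.eq_zero_or_pos U.card with h0 | h0
  · rw [h0]; simp; positivity
  · have hU0 : (0 : ℝ) < U.card := by exact_mod_cast h0
    have h6 : ((U.card : ℝ) * (κ * N)) ^ 2 ≤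
        N * (U.card * (c * Fintype.card V * N + U.card * (κ ^ 2 / 2 * N))) :=
      (pow_le_pow_left₀ (by positivity) h4 2).trans
        (h3.trans (mul_le_mul_of_nonneg_left h5 hN0.le))
    have h7 : (U.card * N ^ 2) * (κ ^ 2 / 2 * U.card) ≤
      (U.card * N ^ 2) * (c * Fintype.card V) := by nlinarith
    exact le_of_mul_le_mul_left h7 (by positivity)

end Lookalikes

section LookalikeSwaps

open Finset

theorem SetSwap.map {α β : Type*} [DecidableEq α] [DecidableEq β] {k l : ℕ}
    {K : Finset (Finset β)} {H : Finset (Finset α)} {f : β → α} (hf : Function.Injective f)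
    (hK : ∀ e ∈ K, e.image f ∈ H) {A T B U W : Finset β} (h : SetSwap K k l A T B U W) :
    SetSwap H k l (A.image f) (T.image f) (B.image f) (U.image f) (W.image f) where
  left := by rw [← image_union]; exact h.left.map hf hK
  right := by rw [← image_union]; exact h.right.map hf hK
  dTU := (disjoint_image hf).2 h.dTU
  dTW := (disjoint_image hf).2 h.dTW

/-- Lookalikes can be swapped inside a single edge. -/
theorem lookalike_swap (k l q : ℕ) (hlk : 2 * l < k) {κ : ℝ} (hκ : 0 < κ) :
    ∃ n₀ : ℕ, ∀ (V : Type) [Fintype V] [DecidableEq V], n₀ ≤ Fintype.card V →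
      ∀ (H : Finset (Finset V)) (i₀ : Fin k) (u w : V), w ∈ lookalikes H i₀ κ u →
        RobSwap H k l (2 * k) q {u} {w} := by
  obtain ⟨n₀, hn₀⟩ := bad_tuple_small k (q + 2) (ε := κ / 2) (by linarith)
  refine ⟨n₀ + 1, fun V _ _ hV H i₀ u w hw Z hZ => ?_⟩
  rw [mem_lookalikes] at hw
  have hV0 : (0 : ℝ) < (Fintype.card V : ℝ) ^ k := by
    have : 0 < Fintype.card V := by omega
    positivity
  have h1 := hn₀ V (by omega) (Z ∪ {u, w}) (card_union_le_of_le hZ card_le_two)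
  obtain ⟨g, hg, hg'⟩ : ∃ g ∈ commonTuples H i₀ u w,
      Function.Injective g ∧ ∀ i, g i ∉ Z ∪ {u, w} := by
    by_contra! hcon
    have h2 : commonTuples H i₀ u w ⊆ univ.filter fun x : Fin k → V =>
        ¬ (Function.Injective x ∧ ∀ i, x i ∉ Z ∪ {u, w}) := by
      intro g hg
      rw [mem_filter]
      refine ⟨mem_univ _, fun h => ?_⟩
      obtain ⟨i, hi⟩ := hcon g hg h.1
      exact h.2 i hi
    have h3 : ((commonTuples H i₀ u w).card : ℝ) ≤ _ := Nat.cast_le.2 (card_le_card h2)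
    nlinarith
  obtain ⟨hinj, hav⟩ := hg'
  set F := (univ.erase i₀).image g with hF
  have hFc : F.card = k - 1 := by
    rw [hF, card_image_of_injective _ hinj, card_erase_of_mem (mem_univ _)]
    simp
  have hFZ : ∀ v ∈ F, v ∉ Z ∪ {u, w} := by
    intro v hv
    obtain ⟨i, -, rfl⟩ := mem_image.1 hv
    exact hav i
  have himg : ∀ v, univ.image (Function.update g i₀ v) = F ∪ {v} := by
    intro v
    rw [← insert_erase (mem_univ i₀), image_insert, Function.update_self, union_comm,
      ← insert_eq, hF]
    congr 1
    exact image_congr fun i hi => Function.update_of_ne (ne_of_mem_erase (mem_coe.1 hi)) _ _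
  simp only [commonTuples, mem_filter, mem_univ, true_and, himg] at hg
  obtain ⟨A, hAF, hA⟩ := exists_subset_card_eq (s := F) (n := l) (by omega)
  obtain ⟨B, hBF, hB⟩ := exists_subset_card_eq (s := F \ A) (n := l)
    (by rw [card_sdiff_of_subset hAF]; omega)
  set T := (F \ A) \ B with hT
  have hTc : T.card = k - 2 * l - 1 := by
    rw [hT, card_sdiff_of_subset hBF, card_sdiff_of_subset hAF]
    omega
  have hBd : Disjoint A B := disjoint_sdiff.mono_right hBF
  have hTA : Disjoint A T := disjoint_sdiff.mono_right sdiff_subset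
  have hTB : Disjoint T B := sdiff_disjoint
  have hATB : A ∪ T ∪ B = F := by
    rw [hT]
    ext v
    simp only [mem_union, mem_sdiff]
    have := @hAF v
    have := @hBF v
    simp only [mem_sdiff] at this
    tauto
  have hedge : ∀ v, v ∉ F → F ∪ {v} ∈ H → LP H k l A (T ∪ {v}) B ∧ Disjoint T {v} := by
    intro v hv hvH
    have hv' := hv
    rw [← hATB] at hv'
    simp only [mem_union, not_or] at hv'
    refine ⟨LP.edge ⟨hA, ?_, hB, ?_, hBd, ?_, ?_⟩, disjoint_singleton_right.2 hv'.1.2⟩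
    · rw [card_union_of_disjoint (disjoint_singleton_right.2 hv'.1.2), hTc, card_singleton]
      omega
    · exact disjoint_union_right.2 ⟨hTA, disjoint_singleton_right.2 hv'.1.1⟩
    · exact disjoint_union_left.2 ⟨hTB, disjoint_singleton_left.2 hv'.2⟩
    · convert hvH using 1
      rw [← hATB]
      ext x
      simp only [mem_union]
      tauto
  have hu := hedge u (fun h => hFZ u h (by simp)) hg.1
  have hw' := hedge w (fun h => hFZ w h (by simp)) hg.2
  refine ⟨A, T, B, ⟨hu.1, hw'.1, hu.2, hw'.2⟩, ?_, ?_⟩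
  · rw [hATB, disjoint_left]
    intro v hv hvZ
    exact hFZ v hv (mem_union_left _ hvZ)
  · rw [hATB, hFc]
    omega

theorem partite_path {k l : ℕ} (hl : 1 ≤ l) (hlk : 2 * l < k)
    {K : Finset (Finset (Fin k × Fin 3))}
    (hK : ∀ σ : Fin k → Fin 3, univ.image (fun j => (j, σ j)) ∈ K) {JA JC JI : Finset (Fin k)}
    (hJAc : JA.card = l) (hJCc : JC.card = l - 1) (hJIc : JI.card = k - 2 * l - 1)
    {i₀ i₁ : Fin k} (hi : i₀ ≠ i₁)
    (m1 : ∀ j, j ∈ JA → j ∉ JC ∧ j ∉ JI ∧ j ≠ i₀ ∧ j ≠ i₁)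
    (m2 : ∀ j, j ∈ JC → j ∉ JA ∧ j ∉ JI ∧ j ≠ i₀ ∧ j ≠ i₁)
    (m3 : ∀ j, j ∈ JI → j ∉ JA ∧ j ∉ JC ∧ j ≠ i₀ ∧ j ≠ i₁)
    (m4 : ∀ j, j ∈ JA ∨ j ∈ JC ∨ j ∈ JI ∨ j = i₀ ∨ j = i₁) :
    LP K k l (JA ×ˢ {1}) ((JI ×ˢ {1} ∪ {(i₁, 1)}) ∪ (JC ×ˢ {1} ∪ {(i₀, 1)}) ∪
      (JI ×ˢ {2} ∪ {(i₁, 0)})) (JA ×ˢ {2}) := by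
  have hsing : ∀ (S : Finset (Fin k)) (t : Fin 3) (v : Fin k × Fin 3),
      v ∈ S ×ˢ ({t} : Finset (Fin 3)) ↔ v.1 ∈ S ∧ v.2 = t := by
    intro S t v
    rw [mem_product, mem_singleton]
  have hcard : ∀ (S : Finset (Fin k)) (t : Fin 3), (S ×ˢ ({t} : Finset (Fin 3))).card = S.card := by
    intro S t
    rw [card_product, card_singleton, mul_one]
  have e1 : LEdge K k l (JA ×ˢ {1}) (JI ×ˢ {1} ∪ {(i₁, 1)}) (JC ×ˢ {1} ∪ {(i₀, 1)}) := by
    refine ⟨by rw [hcard, hJAc], ?_, ?_, ?_, ?_, ?_, ?_⟩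
    · rw [card_union_of_disjoint, hcard, hJIc, card_singleton]
      · omega
      · rw [disjoint_singleton_right, hsing]
        exact fun h => (m3 _ h.1).2.2.2 rfl
    · rw [card_union_of_disjoint, hcard, hJCc, card_singleton]
      · omega
      · rw [disjoint_singleton_right, hsing]
        exact fun h => (m2 _ h.1).2.2.1 rfl
    · rw [disjoint_left]
      intro v h1 h2
      simp only [mem_union, hsing, mem_singleton, Prod.ext_iff] at h1 h2
      have := m1 _ h1.1
      tauto
    · rw [disjoint_left]
      intro v h1 h2
      simp only [mem_union, hsing, mem_singleton, Prod.ext_iff] at h1 h2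
      have := m1 _ h1.1
      tauto
    · rw [disjoint_left]
      rintro ⟨a, b⟩ h1 h2
      simp only [mem_union, hsing, mem_singleton, Prod.ext_iff] at h1 h2
      have := m3 a
      have := m2 a
      grind
    · convert hK (fun _ => 1) using 1
      ext ⟨a, b⟩
      simp only [mem_union, hsing, mem_singleton, Prod.ext_iff, mem_image, mem_univ, true_and]
      have := m4 a
      grind
  have e2 : LEdge K k l (JC ×ˢ {1} ∪ {(i₀, 1)}) (JI ×ˢ {2} ∪ {(i₁, 0)}) (JA ×ˢ {2}) := by
    refine ⟨e1.cardB, ?_, by rw [hcard, hJAc], ?_, ?_, ?_, ?_⟩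
    · rw [card_union_of_disjoint, hcard, hJIc, card_singleton]
      · omega
      · rw [disjoint_singleton_right, hsing]
        exact fun h => (m3 _ h.1).2.2.2 rfl
    · rw [disjoint_left]
      rintro ⟨a, b⟩ h1 h2
      simp only [mem_union, hsing, mem_singleton, Prod.ext_iff] at h1 h2
      grind
    · rw [disjoint_left]
      rintro ⟨a, b⟩ h1 h2
      simp only [mem_union, hsing, mem_singleton, Prod.ext_iff] at h1 h2
      grind
    · rw [disjoint_left]
      rintro ⟨a, b⟩ h1 h2
      simp only [mem_union, hsing, mem_singleton, Prod.ext_iff] at h1 h2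
      grind
    · convert hK (fun j => if j ∈ JA ∨ j ∈ JI then 2 else if j = i₁ then 0 else 1) using 1
      ext ⟨a, b⟩
      simp only [mem_union, hsing, mem_singleton, Prod.ext_iff, mem_image, mem_univ, true_and]
      have := m4 a
      have := m1 a
      have := m2 a
      have := m3 a
      constructor
      · intro h
        exact ⟨a, rfl, by grind⟩
      · rintro ⟨a', rfl, rfl⟩
        grind
  refine LP.cons e1 (LP.edge e2) ?_
  rw [disjoint_left]
  rintro ⟨a, b⟩ h1 h2
  simp only [mem_union, hsing, mem_singleton, Prod.ext_iff] at h1 h2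
  have := m1 a
  have := m2 a
  have := m3 a
  grind

/-- In the complete `k`-partite `k`-graph with parts of size three one vertex of a part may be
exchanged for a vertex of another part. -/
theorem partite_swap {k l : ℕ} (hl : 1 ≤ l) (hlk : 2 * l < k) {i₀ i₁ : Fin k} (hi : i₀ ≠ i₁)
    {K : Finset (Finset (Fin k × Fin 3))}
    (hK : ∀ σ : Fin k → Fin 3, univ.image (fun j => (j, σ j)) ∈ K) :
    ∃ A T B, SetSwap K k l A T B {(i₀, 0)} {(i₁, 0)} ∧ A ∪ T ∪ B ⊆ univ ×ˢ {1, 2} := by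
  set J : Finset (Fin k) := univ \ {i₀, i₁} with hJ
  have hJc : J.card = k - 2 := by
    rw [hJ, card_sdiff_of_subset (subset_univ _), card_pair hi]; simp
  obtain ⟨JA, hJA, hJAc⟩ := exists_subset_card_eq (s := J) (n := l) (by omega)
  obtain ⟨JC, hJC, hJCc⟩ := exists_subset_card_eq (s := J \ JA) (n := l - 1)
    (by rw [card_sdiff_of_subset hJA]; omega)
  set JI := (J \ JA) \ JC with hJI
  have hJIc : JI.card = k - 2 * l - 1 := by
    rw [hJI, card_sdiff_of_subset hJC, card_sdiff_of_subset hJA]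
    omega
  have m1 : ∀ j, j ∈ JA → j ∉ JC ∧ j ∉ JI ∧ j ≠ i₀ ∧ j ≠ i₁ := by
    intro j hj
    have h1 := hJA hj
    have h2 := @hJC j
    simp only [hJ, hJI, mem_sdiff, mem_insert, mem_singleton] at *
    tauto
  have m2 : ∀ j, j ∈ JC → j ∉ JA ∧ j ∉ JI ∧ j ≠ i₀ ∧ j ≠ i₁ := by
    intro j hj
    have h2 := hJC hj
    simp only [hJ, hJI, mem_sdiff, mem_insert, mem_singleton] at *
    tauto
  have m3 : ∀ j, j ∈ JI → j ∉ JA ∧ j ∉ JC ∧ j ≠ i₀ ∧ j ≠ i₁ := by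
    intro j hj
    simp only [hJ, hJI, mem_sdiff, mem_insert, mem_singleton] at *
    tauto
  have m4 : ∀ j, j ∈ JA ∨ j ∈ JC ∨ j ∈ JI ∨ j = i₀ ∨ j = i₁ := by
    intro j
    simp only [hJ, hJI, mem_sdiff, mem_insert, mem_singleton, mem_univ, true_and]
    tauto
  have hsing : ∀ (S : Finset (Fin k)) (t : Fin 3) (v : Fin k × Fin 3),
      v ∈ S ×ˢ ({t} : Finset (Fin 3)) ↔ v.1 ∈ S ∧ v.2 = t := by
    intro S t v
    rw [mem_product, mem_singleton]
  have p1 := partite_path hl hlk hK hJAc hJCc hJIc hi m1 m2 m3 m4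
  have p2 := partite_path hl hlk hK hJAc hJCc hJIc hi.symm
    (fun j h => by have := m1 j h; tauto)
    (fun j h => by have := m2 j h; tauto)
    (fun j h => by have := m3 j h; tauto)
    (fun j => by have := m4 j; tauto)
  refine ⟨JA ×ˢ {1}, JI ×ˢ {1} ∪ JC ×ˢ {1} ∪ {(i₀, 1)} ∪ {(i₁, 1)} ∪ JI ×ˢ {2}, JA ×ˢ {2},
    ⟨?_, ?_, ?_, ?_⟩, ?_⟩
  · convert p2 using 1
    ac_rfl
  · convert p1 using 1
    ac_rfl
  · rw [disjoint_singleton_right]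
    simp
  · rw [disjoint_singleton_right]
    simp
  · rintro ⟨a, b⟩ h
    simp only [mem_union, hsing, mem_singleton, Prod.ext_iff] at h
    simp only [mem_product, mem_univ, mem_insert, mem_singleton, true_and]
    grind

end LookalikeSwaps

section BoxSwaps

open Finset

theorem le_card_filter_two {V : Type*} [Fintype V] [DecidableEq V] {k : ℕ} {i₀ i₁ : Fin k}
    (hi : i₀ ≠ i₁) {c : ℝ} (hc : 0 ≤ c) {R R' : Finset V} (hR : c * Fintype.card V ≤ R.card)
    (hR' : c * Fintype.card V ≤ R'.card) :
    c ^ 2 * (Fintype.card V : ℝ) ^ k ≤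
      ((univ.filter fun g : Fin k → V => g i₀ ∈ R ∧ g i₁ ∈ R').card : ℝ) := by
  have h1 : (univ.filter fun g : Fin k → V => g i₀ ∈ R ∧ g i₁ ∈ R') =
      Fintype.piFinset fun i => if i = i₀ then R else if i = i₁ then R' else univ := by
    ext g
    simp only [mem_filter, mem_univ, true_and, Fintype.mem_piFinset]
    constructor
    · intro h i
      split_ifs with h2 h3
      · rw [h2]; exact h.1
      · rw [h3]; exact h.2
      · exact mem_univ _
    · intro h
      have h2 := h i₀
      have h3 := h i₁
      rw [if_pos rfl] at h2
      rw [if_neg hi.symm, if_pos rfl] at h3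
      exact ⟨h2, h3⟩
  have hi' : i₁ ∈ univ.erase i₀ := mem_erase.2 ⟨hi.symm, mem_univ _⟩
  have h2 : ∀ i ∈ (univ.erase i₀).erase i₁,
      (if i = i₀ then R else if i = i₁ then R' else univ).card = Fintype.card V := by
    intro i h
    rw [mem_erase, mem_erase] at h
    rw [if_neg h.2.1, if_neg h.1, card_univ]
  have h3 : ((univ.erase i₀).erase i₁).card = k - 2 := by
    rw [card_erase_of_mem hi', card_erase_of_mem (mem_univ _)]
    simp
    omega
  have hk : 2 ≤ k := by
    have := i₀.2
    have := i₁.2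
    have : i₀.1 ≠ i₁.1 := fun h => hi (Fin.ext h)
    omega
  rw [h1, Fintype.card_piFinset, ← mul_prod_erase _ _ (mem_univ i₀), ← mul_prod_erase _ _ hi',
    prod_congr rfl h2, prod_const, h3, if_pos rfl, if_neg hi.symm, if_pos rfl]
  push_cast
  have h4 : (Fintype.card V : ℝ) ^ k = Fintype.card V * (Fintype.card V *
      (Fintype.card V : ℝ) ^ (k - 2)) := by
    rw [← pow_succ', ← pow_succ']
    congr 1
    omega
  calc c ^ 2 * (Fintype.card V : ℝ) ^ k = (c * Fintype.card V) * ((c * Fintype.card V) *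
        (Fintype.card V : ℝ) ^ (k - 2)) := by rw [h4]; ring
    _ ≤ _ := by gcongr

/-- Two linear sized sets contain a robustly swappable pair of vertices. -/
theorem box_swap (k l q : ℕ) (hl : 2 ≤ l) (hlk : 2 * l < k) {d c : ℝ} (hd : 0 < d)
    (hc : 0 < c) :
    ∃ n₀ : ℕ, ∀ (V : Type) [Fintype V] [DecidableEq V], n₀ ≤ Fintype.card V →
      ∀ H : Finset (Finset V), DegDense k l d H → ∀ R R' : Finset V,
        c * Fintype.card V ≤ R.card → c * Fintype.card V ≤ R'.card →
        ∀ Z₀ : Finset V, Z₀.card ≤ q → ∃ x ∈ R \ Z₀, ∃ y ∈ R' \ Z₀, x ≠ y ∧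
          RobSwap H k l (2 * k) q {x} {y} := by
  obtain ⟨n₁, hn₁⟩ := extension_count k l (by omega) (δ := d / 2) (by linarith)
  obtain ⟨n₂, hn₂⟩ := bad_tuple_small k q (ε := d * c ^ 2 / 8) (by positivity)
  obtain ⟨n₃, hn₃⟩ := exists_box (q + 3) k (d * c ^ 2 / 4) (by positivity)
  refine ⟨n₁ + n₂ + n₃ + k + 1, fun V _ _ hV H hH R R' hR hR' Z₀ hZ₀ => ?_⟩
  have hd1 : d ≤ 1 := hH.le_one (by omega) (by omega)
  set i₀ : Fin k := ⟨0, by omega⟩ with hi₀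
  set i₁ : Fin k := ⟨1, by omega⟩ with hi₁
  have hi : i₀ ≠ i₁ := by simp [hi₀, hi₁]
  set T : Finset (Fin k) := univ.filter fun i => l ≤ i.1 with hT
  set L : Finset (Fin k) := univ.filter fun i => i.1 < l with hL
  have hLc : L.card = l := by
    rw [hL, Fin.card_filter_val_lt]
    omega
  have hTL : T = Lᶜ := by ext; simp [hT, hL]
  have hTc : T.card = k - l := by
    rw [hTL, card_compl, hLc, Fintype.card_fin]
  have hLT : ∀ i ∈ L, i ∉ T := by intro i hi; simp only [hL, hT, mem_filter, mem_univ, true_and] at *; omega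
  have hi₀T : i₀ ∉ T := hLT _ (by simp [hL, hi₀]; omega)
  have hi₁T : i₁ ∉ T := hLT _ (by simp [hL, hi₁]; omega)
  set P : (Fin k → V) → Prop := fun g => (g i₀ ∈ R ∧ g i₁ ∈ R') ∧ (L.image g).card = l with hP
  have hS : ∀ x z : Fin k → V, L.image (T.piecewise x z) = L.image z := by
    intro x z
    exact image_congr fun i hi => piecewise_eq_of_notMem _ _ _ (hLT i (mem_coe.1 hi))
  set N : ℝ := (Fintype.card V : ℝ) ^ k with hN
  have h1 := hn₁ V (by omega) d H hd.le hH k T hTc P (fun g => L.image g)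
    (by
      intro x z
      simp only [hP, hS, piecewise_eq_of_notMem _ _ _ hi₀T, piecewise_eq_of_notMem _ _ _ hi₁T])
    hS (fun z hz => hz.2)
  have h2 := hn₂ V (by omega) Z₀ hZ₀
  have h3 := le_card_filter_two hi hc.le hR hR'
  set Bad := univ.filter fun x : Fin k → V => ¬ (Function.Injective x ∧ ∀ i, x i ∉ Z₀) with hBad
  have h4 : ((univ.filter fun g : Fin k → V => g i₀ ∈ R ∧ g i₁ ∈ R').card : ℝ) ≤
      (univ.filter P).card + Bad.card := by
    rw [← Nat.cast_add, Nat.cast_le]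
    refine le_trans (card_le_card ?_) (card_union_le _ _)
    intro g hg
    simp only [hBad, mem_union, mem_filter, mem_univ, true_and, hP] at hg ⊢
    by_cases hinj : Function.Injective g
    · left; exact ⟨hg, by rw [card_image_of_injective _ hinj, hLc]⟩
    · right; exact fun h => hinj h.1
  set Q := (univ.filter fun z : Fin k → V => P z ∧ L.image z ∪ T.image z ∈ H) \ Bad with hQ
  have h5 : ((univ.filter fun z : Fin k → V => P z ∧ L.image z ∪ T.image z ∈ H).card : ℝ) ≤
      Q.card + Bad.card := by
    rw [← Nat.cast_add, Nat.cast_le]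
    have := card_le_card_sdiff_add_card (t := Bad) (s := (univ.filter fun z : Fin k → V => P z ∧ L.image z ∪ T.image z ∈ H))
    exact this
  have hN0 : 0 ≤ N := by positivity
  have h6 : d * c ^ 2 / 4 * N ≤ Q.card := by
    have h7 : d / 2 * (c ^ 2 * N - d * c ^ 2 / 8 * N) ≤ (d - d / 2) * ((univ.filter P).card : ℝ) := by
      have : c ^ 2 * N - d * c ^ 2 / 8 * N ≤ (univ.filter P).card := by linarith
      nlinarith
    have h8 : d * (d * c ^ 2 * N) ≤ 1 * (d * c ^ 2 * N) := by gcongr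
    nlinarith
  obtain ⟨X, hXc, hX⟩ := hn₃ V (by omega) Q h6
  have hgood : ∀ x : Fin k → V, (∀ j, x j ∈ X j) → Function.Injective x ∧ (∀ i, x i ∉ Z₀) ∧
      x i₀ ∈ R ∧ x i₁ ∈ R' ∧ univ.image x ∈ H := by
    intro x hx
    have := hX x hx
    simp only [hQ, hBad, mem_sdiff, mem_filter, mem_univ, true_and, not_not, hP] at this
    refine ⟨this.2.1, this.2.2, this.1.1.1.1, this.1.1.1.2, ?_⟩
    rw [← image_union, hTL, union_compl] at this
    exact this.1.2
  have hne : ∀ (j : Fin k) (Z : Finset V), Z.card ≤ q + 2 → ∃ v ∈ X j, v ∉ Z := by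
    intro j Z hZ
    by_contra! hcon
    have := card_le_card (show X j ⊆ Z from hcon)
    rw [hXc] at this
    omega
  choose p hp _ using fun j => hne j ∅ (by simp)
  obtain ⟨g1, g2, g3, g4, g5⟩ := hgood p hp
  refine ⟨p i₀, mem_sdiff.2 ⟨g3, g2 _⟩, p i₁, mem_sdiff.2 ⟨g4, g2 _⟩, fun h => hi (g1 h), ?_⟩
  intro Z hZ
  choose a ha haZ using fun j => hne j (Z ∪ {p j})
    ((card_union_le_of_le hZ (card_singleton _).le).trans (by omega))
  choose a' ha' haZ' using fun j => hne j (Z ∪ {p j, a j}) (card_union_le_of_le hZ card_le_two)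
  simp only [mem_union, mem_insert, mem_singleton, not_or] at haZ haZ'
  set φ : Fin k × Fin 3 → V := fun v => ![p v.1, a v.1, a' v.1] v.2 with hφ
  have hφX : ∀ j t, φ (j, t) ∈ X j := by
    intro j t
    fin_cases t
    exacts [hp j, ha j, ha' j]
  have hφi : Function.Injective φ := by
    rintro ⟨j, t⟩ ⟨j', t'⟩ h
    have hj : j = j' := by
      by_contra hne
      have h7 := (hgood (fun i => if i = j then φ (j, t) else φ (i, t'))
        (fun i => by
          split_ifs with h
          · rw [h]; exact hφX _ _
          · exact hφX _ _)).1
      exact hne (h7 (by simp only [if_pos, if_neg (Ne.symm hne)]; exact h))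
    subst hj
    have := haZ j
    have := haZ' j
    fin_cases t <;> fin_cases t' <;> simp [hφ] at h ⊢ <;> grind
  obtain ⟨A, T', B, hsw, hsub⟩ := partite_swap (l := l) (by omega) hlk hi
    (K := (univ : Finset (Fin k → Fin 3)).image fun σ => univ.image fun j => (j, σ j))
    (fun σ => mem_image_of_mem _ (mem_univ σ))
  have hsw' := hsw.map (H := H) hφi (by
    intro e he
    obtain ⟨σ, -, rfl⟩ := mem_image.1 he
    rw [image_image]
    exact (hgood _ fun j => hφX j (σ j)).2.2.2.2)
  rw [image_singleton, image_singleton] at hsw'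
  refine ⟨_, _, _, hsw', ?_, ?_⟩
  · rw [← image_union, ← image_union, disjoint_left]
    intro v hv
    obtain ⟨⟨j, t⟩, hjt, rfl⟩ := mem_image.1 hv
    have := hsub hjt
    simp only [mem_product, mem_univ, true_and, mem_insert, mem_singleton] at this
    rcases this with rfl | rfl
    · exact (haZ j).1
    · exact (haZ' j).1
  · rw [← image_union, ← image_union]
    refine card_image_le.trans ((card_le_card hsub).trans ?_)
    rw [card_product, card_univ, Fintype.card_fin, mul_comm]
    exact Nat.mul_le_mul_right _ card_le_two

end BoxSwaps

section AllSwaps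

open Finset

variable {V : Type} [Fintype V] [DecidableEq V] {H : Finset (Finset V)} {k l : ℕ}

theorem exists_fresh (F : Finset V) (s : ℕ) (h : F.card + s ≤ Fintype.card V) :
    ∃ A : Finset V, A.card = s ∧ Disjoint A F := by
  obtain ⟨A, hA, hAc⟩ := exists_subset_card_eq (s := Fᶜ) (n := s) (by rw [card_compl]; omega)
  exact ⟨A, hAc, disjoint_left.2 fun v hv => mem_compl.1 (hA hv)⟩

/-- Outside a small exceptional set any two vertices can be swapped robustly. -/
theorem good_swap (k l q : ℕ) (hl : 2 ≤ l) (hlk : 2 * l < k) {d ε : ℝ} (hd : 0 < d)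
    (hε : 0 < ε) :
    ∃ n₀ : ℕ, ∀ (V : Type) [Fintype V] [DecidableEq V], n₀ ≤ Fintype.card V →
      ∀ H : Finset (Finset V), DegDense k l d H → Conn H k l (q + 52 * k) →
        ∃ U₀ : Finset V, (U₀.card : ℝ) ≤ ε * Fintype.card V ∧
          ∀ u w, u ∉ U₀ → w ∉ U₀ → u ≠ w → RobSwap H k l (22 * k) q {u} {w} := by
  set κ : ℝ := (d / 4) ^ 2 / 2 with hκ
  have hκ0 : 0 < κ := by positivity
  obtain ⟨n₁, hn₁⟩ := vertex_count k l (by omega) (by omega) hd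
  obtain ⟨n₂, hn₂⟩ := lookalike_swap k l (q + 52 * k) hlk hκ0
  obtain ⟨n₃, hn₃⟩ := box_swap k l (q + 52 * k) hl hlk hd (c := κ * ε) (by positivity)
  refine ⟨n₁ + n₂ + n₃ + 1, fun V _ _ hV H hH hC => ?_⟩
  have : Nonempty V := Fintype.card_pos_iff.1 (by omega)
  classical
  set i₀ : Fin k := ⟨0, by omega⟩ with hi₀
  refine ⟨univ.filter fun u => ((lookalikes H i₀ κ u).card : ℝ) ≤ κ * ε * Fintype.card V, ?_, ?_⟩
  · have := card_few_lookalikes (κ := d / 4) (c := κ * ε) (by positivity) (by positivity)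
      (hn₁ V (by omega) H hH i₀ rfl)
      (univ.filter fun u => ((lookalikes H i₀ κ u).card : ℝ) ≤ κ * ε * Fintype.card V)
      (fun u hu => (mem_filter.1 hu).2)
    rw [← hκ, mul_assoc κ ε] at this
    refine le_of_mul_le_mul_left ?_ hκ0
    simpa only [mul_assoc] using this
  · intro u w hu hw huw
    simp only [mem_filter, mem_univ, true_and, not_le] at hu hw
    have h := RobSwap.chain (b := 2 * k) (q' := q) (U := {u}) (W := {w}) hC le_rfl (by omega)
      (by simp; omega) (by simp; omega) ?_
    · exact h.mono (by omega) le_rfl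
    · intro Z hZ
      obtain ⟨x, hx, y, hy, hxy, hs⟩ := hn₃ V (by omega) H hH _ _ hu.le hw.le (Z ∪ {u} ∪ {w})
        ((card_union_le_of_le (card_union_le_of_le hZ (card_singleton u).le)
          (card_singleton w).le).trans (by omega))
      rw [mem_sdiff] at hx hy
      refine ⟨{x}, {y}, disjoint_singleton_left.2 hx.2, disjoint_singleton_left.2 hy.2,
        by simpa using hxy, by simp; omega, by simp; omega, hn₂ V (by omega) H i₀ u x hx.1, hs,
        (hn₂ V (by omega) H i₀ w y hy.1).symm⟩

theorem Conn.exists_path_through {Q : ℕ} (hl : 1 ≤ l) (hlk : 2 * l < k) (hC : Conn H k l Q)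
    {A D F : Finset V} (hA : A.card = l) (hD : D.card = l) (hAD : Disjoint A D) {u : V}
    (huA : u ∉ A) (huD : u ∉ D) (hQ : F.card + 8 * k ≤ Q)
    (hV : F.card + 8 * k ≤ Fintype.card V) :
    ∃ T, T.card = 4 * k - 5 * l - 1 ∧ Disjoint T F ∧ u ∉ T ∧ LP H k l A (T ∪ {u}) D := by
  have c1 := card_union_le_of_le (card_union_le_of_le (card_union_le_of_le (le_refl F.card)
    (card_singleton u).le) hA.le) hD.le
  obtain ⟨C, hCc, hCd⟩ := exists_fresh (F ∪ {u} ∪ A ∪ D) (l - 1) (by omega)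
  have c2 := card_union_le_of_le c1 hCc.le
  simp only [disjoint_union_right, disjoint_singleton_right] at hCd
  obtain ⟨⟨⟨hCF, hCu⟩, hCA⟩, hCD⟩ := hCd
  have hCuc : (C ∪ {u}).card = l := by
    rw [card_union_of_disjoint (disjoint_singleton_right.2 hCu), hCc, card_singleton]
    omega
  obtain ⟨X, hXc, hXd, hX⟩ := hC A (C ∪ {u}) _ hA hCuc
    (disjoint_union_right.2 ⟨hCA.symm, disjoint_singleton_right.2 huA⟩) (c2.trans (by omega))
  have c3 := card_union_le_of_le c2 hXc.le
  obtain ⟨Y, hYc, hYd, hY⟩ := hC (C ∪ {u}) D _ hCuc hD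
    (disjoint_union_left.2 ⟨hCD, disjoint_singleton_left.2 huD⟩) (c3.trans (by omega))
  simp only [disjoint_union_right, disjoint_singleton_right] at hXd hYd
  obtain ⟨⟨⟨⟨hXF, hXu⟩, hXA⟩, hXD⟩, hXC⟩ := hXd
  obtain ⟨⟨⟨⟨⟨hYF, hYu⟩, hYA⟩, hYD⟩, hYC⟩, hYX⟩ := hYd
  refine ⟨X ∪ C ∪ Y, ?_, ?_, ?_, ?_⟩
  · rw [card_union_of_disjoint (disjoint_union_left.2 ⟨hYX.symm, hYC.symm⟩),
      card_union_of_disjoint hXC, hXc, hYc, hCc]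
    omega
  · simp only [disjoint_union_left]
    exact ⟨⟨hXF, hCF⟩, hYF⟩
  · simp only [mem_union, not_or]
    exact ⟨⟨hXu, hCu⟩, hYu⟩
  · have := hX.trans hY (by
      simp only [disjoint_union_left, disjoint_union_right, disjoint_singleton_right, mem_union,
        not_or]
      exact ⟨⟨⟨⟨hCA.symm, hXC⟩, huA, hXu⟩, hYA.symm, hYX.symm⟩, hAD, hXD⟩)
    convert this using 1
    ac_rfl

/-- If all pairs outside a small set can be swapped, then all pairs can. -/
theorem RobSwap.of_good {b q q' Q s : ℕ} (hl : 1 ≤ l) (hlk : 2 * l < k) (hkb : 2 * k ≤ b)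
    (hs : s = 4 * k - 5 * l - 1) (hC : Conn H k l Q) (U₀ : Finset V)
    (hQ : U₀.card + q' + 3 ^ s * b + 30 * k ≤ Q) (hq : q' + 20 * k + 6 * s * 3 ^ s * b ≤ q)
    (hqQ : q ≤ Q) (hV : U₀.card + q' + 30 * k ≤ Fintype.card V)
    (hgood : ∀ u w, u ∉ U₀ → w ∉ U₀ → u ≠ w → RobSwap H k l b q {u} {w}) (u w : V) :
    RobSwap H k l (3 ^ s * b + 20 * k) q' {u} {w} := by
  intro Z hZ
  obtain ⟨E, hE⟩ : ∃ E, E = U₀ ∪ Z ∪ {u} ∪ {w} := ⟨_, rfl⟩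
  have hEc : E.card ≤ U₀.card + q' + 1 + 1 := by
    rw [hE]
    exact card_union_le_of_le (card_union_le_of_le (card_union_le_of_le le_rfl hZ)
      (card_singleton _).le) (card_singleton _).le
  obtain ⟨A, hA, hAE⟩ := exists_fresh E l (by omega)
  have c1 := card_union_le_of_le hEc hA.le
  obtain ⟨D, hD, hDE⟩ := exists_fresh (E ∪ A) l (by omega)
  have c2 := card_union_le_of_le c1 hD.le
  rw [disjoint_union_right] at hDE
  obtain ⟨hDE, hDA⟩ := hDE
  have hEu : ∀ F, Disjoint F E → Disjoint F U₀ ∧ Disjoint F Z ∧ u ∉ F ∧ w ∉ F := by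
    intro F hF
    simpa only [hE, disjoint_union_right, disjoint_singleton_right, and_assoc] using hF
  have hQ' : 0 ≤ 3 ^ s * b := Nat.zero_le _
  have eA := hEu _ hAE
  have eD := hEu _ hDE
  obtain ⟨Tu, hTuc, hTud, huTu, P₁⟩ := hC.exists_path_through (F := E ∪ A ∪ D) hl hlk hA hD hDA.symm
    eA.2.2.1 eD.2.2.1 (by omega) (by omega)
  have c3 := card_union_le_of_le c2 hTuc.le
  obtain ⟨Tw, hTwc, hTwd, hwTw, P₂⟩ := hC.exists_path_through (F := E ∪ A ∪ D ∪ Tu) hl hlk hA hD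
    hDA.symm eA.2.2.2 eD.2.2.2 (by omega) (by omega)
  simp only [disjoint_union_right] at hTud hTwd
  have dTuw : Disjoint Tu Tw := hTwd.2.symm
  have fu := hEu _ hTud.1.1
  have fw := hEu _ hTwd.1.1.1
  rw [← hs] at hTuc hTwc
  have dAT : Disjoint A Tu ∧ Disjoint A Tw ∧ Disjoint D Tu ∧ Disjoint D Tw :=
    ⟨hTud.1.2.symm, hTwd.1.1.2.symm, hTud.2.symm, hTwd.1.2.symm⟩
  clear hTud hTwd hAE hDE hEu hE hEc c1 c2 c3
  have sw₁ : SetSwap H k l A ∅ D (Tu ∪ {u}) (Tw ∪ {w}) := by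
    refine ⟨?_, ?_, disjoint_empty_left _, disjoint_empty_left _⟩
    · rwa [empty_union]
    · rwa [empty_union]
  have sw₂ := RobSwap.of_singletons (U := Tw) (W := Tu) (hC.mono hqQ) hkb (by omega) s (by omega)
    (q' + 20 * k) hq hTwc hTuc (fun x hx y hy => hgood x y (disjoint_left.1 fw.1 hx)
      (disjoint_left.1 fu.1 hy) fun h => disjoint_left.1 dTuw hy (h ▸ hx))
  obtain ⟨A₂, T₂, B₂, sw₂, hd₂, hc₂⟩ := sw₂ (Z ∪ {u} ∪ {w} ∪ A ∪ D ∪ Tu ∪ Tw)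
    ((card_union_le_of_le (card_union_le_of_le (card_union_le_of_le (card_union_le_of_le
      (card_union_le_of_le (card_union_le_of_le hZ (card_singleton _).le) (card_singleton _).le)
      hA.le) hD.le) hTuc.le) hTwc.le).trans (by omega))
  have hA₂ : A₂.card = l := sw₂.left.cardA
  obtain ⟨M, hM⟩ : ∃ M, M = A₂ ∪ T₂ ∪ B₂ := ⟨_, rfl⟩
  rw [← hM] at hd₂ hc₂
  have hAM : A₂ ⊆ M := by rw [hM, union_assoc]; exact subset_union_left
  have hTM : T₂ ⊆ M := by rw [hM, union_assoc, union_left_comm]; exact subset_union_left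
  have hBM : B₂ ⊆ M := by rw [hM]; exact subset_union_right
  simp only [disjoint_union_right, disjoint_singleton_right] at hd₂
  obtain ⟨⟨⟨⟨⟨⟨hMZ, hMu⟩, hMw⟩, hMA⟩, hMD⟩, hMTu⟩, hMTw⟩ := hd₂
  obtain ⟨G, hGc, hGd, hG⟩ := hC D A₂ (Z ∪ {u} ∪ {w} ∪ A ∪ Tu ∪ Tw ∪ M) hD hA₂
    (hMD.symm.mono_right hAM)
    ((card_union_le_of_le (card_union_le_of_le (card_union_le_of_le (card_union_le_of_le
      (card_union_le_of_le (card_union_le_of_le hZ (card_singleton _).le) (card_singleton _).le)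
      hA.le) hTuc.le) hTwc.le) hc₂).trans (by omega))
  simp only [disjoint_union_right, disjoint_singleton_right] at hGd
  obtain ⟨⟨⟨⟨⟨⟨hGZ, hGu⟩, hGw⟩, hGA⟩, hGTu⟩, hGTw⟩, hGM⟩ := hGd
  have sw₃ := sw₁.join sw₂ hG
    (by
      simp only [disjoint_union_right, disjoint_singleton_right]
      exact ⟨⟨⟨⟨⟨⟨⟨hGA, disjoint_empty_right _⟩, hGTu, hGu⟩, hGTw, hGw⟩, hGM.mono_right hTM⟩,
        hGM.mono_right hBM⟩, hGTw⟩, hGTu⟩)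
    (by
      rw [union_empty, disjoint_union_left, ← hM]
      exact ⟨hMA.symm, hMD.symm⟩)
    (by
      rw [union_empty]
      simp only [disjoint_union_right, disjoint_union_left]
      exact ⟨⟨dAT.2.1, dAT.2.2.2⟩, dAT.1, dAT.2.2.1⟩)
    (by
      rw [← hM]
      simp only [disjoint_union_right, disjoint_singleton_right]
      exact ⟨⟨hMTu, hMu⟩, hMTw, hMw⟩)
    (by
      simp only [disjoint_union_left, disjoint_singleton_left]
      exact ⟨dTuw, fw.2.2.1⟩)
    (by
      simp only [disjoint_union_left, disjoint_singleton_left]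
      exact ⟨dTuw.symm, fu.2.2.2⟩)
  have sw₄ := sw₃.of_common (X := Tu ∪ Tw) (U := {u}) (W := {w}) (by ac_rfl) (by ac_rfl)
    (by
      simp only [disjoint_singleton_right, mem_union, not_or]
      exact ⟨fu.2.2.1, fw.2.2.1⟩)
    (by
      simp only [disjoint_singleton_right, mem_union, not_or]
      exact ⟨fu.2.2.2, fw.2.2.2⟩)
  have hall : A ∪ (∅ ∪ D ∪ G ∪ A₂ ∪ T₂ ∪ (Tu ∪ Tw)) ∪ B₂ = A ∪ D ∪ G ∪ Tu ∪ Tw ∪ M := by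
    rw [empty_union, hM]; ac_rfl
  refine ⟨_, _, _, sw₄, ?_, ?_⟩
  · rw [hall]
    simp only [disjoint_union_left]
    exact ⟨⟨⟨⟨⟨eA.2.1, eD.2.1⟩, hGZ⟩, fu.2.1⟩, fw.2.1⟩, hMZ⟩
  · rw [hall]
    exact (card_union_le_of_le (card_union_le_of_le (card_union_le_of_le (card_union_le_of_le
      (card_union_le_of_le hA.le hD.le) hGc.le) hTuc.le) hTwc.le) hc₂).trans (by omega)

theorem exists_absorber_of_swap {b q Q s : ℕ} (hl : 1 ≤ l) (hlk : 2 * l < k) (hkb : 2 * k ≤ b)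
    (hs : s = 3 * k - 4 * l) (hC : Conn H k l Q) (hQ : 3 ^ s * b + 20 * k ≤ Q)
    (hq : 20 * k + 6 * s * 3 ^ s * b ≤ q) (hqQ : q ≤ Q) (hV : 20 * k ≤ Fintype.card V)
    (hsw : ∀ u w : V, RobSwap H k l b q {u} {w}) {S : Finset V} (hS : S.card = k - l) :
    ∃ A X B, LP H k l A X B ∧ LP H k l A (X ∪ S) B ∧ Disjoint X S := by
  have hQ' : 0 ≤ 3 ^ s * b := Nat.zero_le _
  obtain ⟨A, hA, hAS⟩ := exists_fresh S l (by omega)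
  have c1 := card_union_le_of_le hS.le hA.le
  obtain ⟨D, hD, hDS⟩ := exists_fresh (S ∪ A) l (by omega)
  rw [disjoint_union_right] at hDS
  obtain ⟨I, C, hI, hIS, hCS⟩ : ∃ I C, LEdge H k l A I C ∧ Disjoint I S ∧ Disjoint C S := by
    obtain ⟨X, hXc, hXS, hX⟩ := hC A D S hA hD hDS.2.symm (by omega)
    rcases hX.first with h | ⟨I, C, Y, h, -, -, rfl⟩
    · have := h.cardI
      omega
    · simp only [disjoint_union_left] at hXS
      exact ⟨I, C, h, hXS.1.1, hXS.1.2⟩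
  clear hDS hD D
  have c2 := card_union_le_of_le (card_union_le_of_le c1 hI.cardI.le) hI.cardB.le
  obtain ⟨B, hB, hBd⟩ := exists_fresh (S ∪ A ∪ I ∪ C) l (by omega)
  simp only [disjoint_union_right] at hBd
  obtain ⟨⟨⟨hBS, hBA⟩, hBI⟩, hBC⟩ := hBd
  have c3 := card_union_le_of_le c2 hB.le
  obtain ⟨X, hXc, hXd, hX⟩ := hC A B _ hA hB hBA.symm (c3.trans (by omega))
  have c4 := card_union_le_of_le c3 hXc.le
  obtain ⟨Y, hYc, hYd, hY⟩ := hC C B _ hI.cardB hB hBC.symm (c4.trans (by omega))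
  have c5 := card_union_le_of_le c4 hYc.le
  simp only [disjoint_union_right] at hXd hYd
  obtain ⟨⟨⟨⟨hXS, hXA⟩, hXI⟩, hXC⟩, hXB⟩ := hXd
  obtain ⟨⟨⟨⟨⟨hYS, hYA⟩, hYI⟩, hYC⟩, hYB⟩, hYX⟩ := hYd
  have hX' : LP H k l A (I ∪ C ∪ Y) B := LP.cons hI hY (by
    simp only [disjoint_union_left, disjoint_union_right]
    exact ⟨⟨⟨hI.dAB, hI.dIB⟩, hYA.symm, hYI.symm⟩, hBA.symm, hBI.symm⟩)
  obtain ⟨W, hW⟩ : ∃ W, W = I ∪ C ∪ Y := ⟨_, rfl⟩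
  have hWc : W.card = s := by
    rw [hW, card_union_of_disjoint (disjoint_union_left.2 ⟨hYI.symm, hYC.symm⟩),
      card_union_of_disjoint hI.dIB, hYc, hI.cardI, hI.cardB]
    omega
  have hXSc : (X ∪ S).card = s := by
    rw [card_union_of_disjoint hXS, hXc, hS]
    omega
  rw [← hW] at hX'
  have hWS : Disjoint W S := by
    simp only [hW, disjoint_union_left]
    exact ⟨⟨hIS, hCS⟩, hYS⟩
  have hWX : Disjoint W X := by
    simp only [hW, disjoint_union_left]
    exact ⟨⟨hXI.symm, hXC.symm⟩, hYX⟩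
  have sw := RobSwap.of_singletons (U := W) (W := X ∪ S) (hC.mono hqQ) hkb (by omega) s (by omega)
    (20 * k) hq hWc hXSc fun x _ y _ => hsw x y
  obtain ⟨A₂, T₂, B₂, sw₂, hd₂, hc₂⟩ := sw (A ∪ B ∪ W ∪ (X ∪ S))
    ((card_union_le_of_le (card_union_le_of_le (card_union_le_of_le hA.le hB.le) hWc.le)
      hXSc.le).trans (by omega))
  obtain ⟨M, hM⟩ : ∃ M, M = A₂ ∪ T₂ ∪ B₂ := ⟨_, rfl⟩
  rw [← hM] at hd₂ hc₂
  have hAM : A₂ ⊆ M := by rw [hM, union_assoc]; exact subset_union_left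
  have hTM : T₂ ⊆ M := by rw [hM, union_assoc, union_left_comm]; exact subset_union_left
  have hBM : B₂ ⊆ M := by rw [hM]; exact subset_union_right
  simp only [disjoint_union_right] at hd₂
  obtain ⟨⟨⟨hMA, hMB⟩, hMW⟩, hMX, hMS⟩ := hd₂
  obtain ⟨G, hGc, hGd, hG⟩ := hC B A₂ (A ∪ W ∪ (X ∪ S) ∪ M) hB sw₂.left.cardA
    (hMB.symm.mono_right hAM)
    ((card_union_le_of_le (card_union_le_of_le (card_union_le_of_le hA.le hWc.le) hXSc.le)
      hc₂).trans (by omega))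
  simp only [disjoint_union_right] at hGd
  obtain ⟨⟨⟨hGA, hGW⟩, hGX, hGS⟩, hGM⟩ := hGd
  have sw₁ : SetSwap H k l A ∅ B X W := by
    refine ⟨?_, ?_, disjoint_empty_left _, disjoint_empty_left _⟩
    · rwa [empty_union]
    · rwa [empty_union]
  have hBW : Disjoint B W := hX'.dXB.symm
  have sw₃ := sw₁.join sw₂ hG
    (by
      simp only [disjoint_union_right]
      exact ⟨⟨⟨⟨⟨⟨⟨hGA, disjoint_empty_right _⟩, hGX⟩, hGW⟩, hGM.mono_right hTM⟩,
        hGM.mono_right hBM⟩, hGW⟩, hGX, hGS⟩)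
    (by
      rw [union_empty, disjoint_union_left, ← hM]
      exact ⟨hMA.symm, hMB.symm⟩)
    (by
      rw [union_empty]
      simp only [disjoint_union_right, disjoint_union_left]
      exact ⟨⟨hX'.dAX, hBW⟩, ⟨hX.dAX, hX.dXB.symm⟩, hAS, hBS⟩)
    (by
      rw [← hM]
      exact disjoint_union_right.2 ⟨hMX, hMW⟩)
    hWX.symm (disjoint_union_right.2 ⟨hWX, hWS⟩)
  refine ⟨_, _, _, sw₃.left, ?_, ?_⟩
  · convert sw₃.right using 1
    ac_rfl
  · simp only [disjoint_union_left]
    exact ⟨⟨⟨⟨⟨disjoint_empty_left _, hBS⟩, hGS⟩, hMS.mono_left hAM⟩, hMS.mono_left hTM⟩, hXS, hWS⟩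

/-- Every `(k - l)`-set has an absorbing path. -/
theorem exists_absorber {k l : ℕ} (hl : 2 ≤ l) (hlk : 2 * l < k) {η : ℝ} (hη : 0 < η) :
    ∃ n₀ : ℕ, ∀ n ≥ n₀, ∀ H : Finset (Finset (Fin n)),
      DegDense k l (((1 : ℝ) / 2) ^ (((k - l : ℕ) : ℝ) / l) + η) H →
      ∀ S : Finset (Fin n), S.card = k - l →
        ∃ A X B, LP H k l A X B ∧ LP H k l A (X ∪ S) B ∧ Disjoint X S := by
  obtain ⟨c, hc, n₁, hn₁⟩ := exists_connector (k := k) (l := l) (by omega) hlk hη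
  obtain ⟨s₁, hs₁⟩ : ∃ s, s = 4 * k - 5 * l - 1 := ⟨_, rfl⟩
  obtain ⟨s₂, hs₂⟩ : ∃ s, s = 3 * k - 4 * l := ⟨_, rfl⟩
  obtain ⟨b, hb⟩ : ∃ b, b = 3 ^ s₁ * (22 * k) + 20 * k := ⟨_, rfl⟩
  obtain ⟨q₁, hq₁⟩ : ∃ q, q = 20 * k + 6 * s₂ * 3 ^ s₂ * b := ⟨_, rfl⟩
  obtain ⟨q₀, hq₀⟩ : ∃ q, q = q₁ + 20 * k + 6 * s₁ * 3 ^ s₁ * (22 * k) := ⟨_, rfl⟩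
  have hd : (0 : ℝ) < ((1 : ℝ) / 2) ^ (((k - l : ℕ) : ℝ) / l) + η := by positivity
  obtain ⟨n₂, hn₂⟩ := good_swap k l q₀ hl hlk hd (ε := min (c / 2) (1 / 2)) (by positivity)
  obtain ⟨E, hE⟩ : ∃ E, E = q₀ + q₁ + 100 * k + 3 ^ s₁ * (22 * k) + 3 ^ s₂ * b := ⟨_, rfl⟩
  obtain ⟨n₃, hn₃⟩ := exists_nat_gt ((E : ℝ) / (min (c / 2) (1 / 2)))
  refine ⟨n₁ + n₂ + n₃ + 1, fun n hn H hH S hS => ?_⟩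
  have hn0 : (n₃ : ℝ) ≤ n := by exact_mod_cast (by omega : n₃ ≤ n)
  have hEn : (E : ℝ) ≤ min (c / 2) (1 / 2) * n := by
    rw [div_lt_iff₀ (by positivity)] at hn₃
    have : (0 : ℝ) < min (c / 2) (1 / 2) := by positivity
    nlinarith
  have hmin1 : min (c / 2) (1 / 2) * n ≤ c / 2 * n := by gcongr; exact min_le_left _ _
  have hmin2 : min (c / 2) (1 / 2) * n ≤ 1 / 2 * n := by gcongr; exact min_le_right _ _
  have hC : ∀ Q : ℕ, (Q : ℝ) ≤ c * n → Conn H k l Q := fun Q hQ A B Z hA hB hAB hZ =>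
    hn₁ n (by omega) H hH A B Z hA hB hAB (le_trans (by exact_mod_cast hZ) hQ)
  have hcard : Fintype.card (Fin n) = n := Fintype.card_fin n
  obtain ⟨U₀, hU₀, hsw⟩ := hn₂ (Fin n) (by omega) H hH (hC _ (by
    have : ((q₀ + 52 * k : ℕ) : ℝ) ≤ E := by exact_mod_cast (by omega)
    linarith))
  rw [hcard] at hU₀
  have hCQ : Conn H k l (U₀.card + E) := hC _ (by push_cast; linarith)
  have hUE : U₀.card + E ≤ n := by
    have : ((U₀.card + E : ℕ) : ℝ) ≤ n := by push_cast; linarith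
    exact_mod_cast this
  have hall := RobSwap.of_good (by omega) hlk (by omega) hs₁ hCQ U₀ (q' := q₁) (by omega)
    hq₀.ge (by omega) (by omega) hsw
  exact exists_absorber_of_swap (by omega) hlk (by omega) hs₂ hCQ (by omega) (by omega)
    (by omega) (by omega) (fun u w => hb ▸ hall u w) hS

end AllSwaps

section Families

open Finset

theorem card_coord_mem {Ω : Type*} [Fintype Ω] [DecidableEq Ω] {M : ℕ} (i : Fin M)
    (Φ : Finset Ω) :
    Fintype.card Ω * (univ.filter fun x : Fin M → Ω => x i ∈ Φ).card =
      Φ.card * Fintype.card Ω ^ M := by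
  have h1 : (univ.filter fun x : Fin M → Ω => x i ∈ Φ) =
      Fintype.piFinset fun j => if j = i then Φ else univ := by
    ext x
    simp only [mem_filter, mem_univ, true_and, Fintype.mem_piFinset]
    constructor
    · intro h j
      split_ifs with hj
      · rwa [hj]
      · exact mem_univ _
    · intro h
      simpa using h i
  have h2 : ∀ j ∈ univ.erase i, (if j = i then Φ else univ).card = Fintype.card Ω := by
    intro j hj
    rw [if_neg (ne_of_mem_erase hj), card_univ]
  have h3 : M = (M - 1) + 1 := by
    have := i.2
    omega
  have h4 : Fintype.card Ω ^ M = Fintype.card Ω ^ (M - 1) * Fintype.card Ω := by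
    rw [← pow_succ, ← h3]
  rw [h1, Fintype.card_piFinset, ← mul_prod_erase _ _ (mem_univ i), prod_congr rfl h2, prod_const,
    card_erase_of_mem (mem_univ i), if_pos rfl, card_univ, Fintype.card_fin, h4]
  ring

/-- A random family of few members has many good members for every requirement, and its
members can be made pairwise disjoint. -/
theorem exists_family {V Ω ι : Type*} [Fintype Ω] [DecidableEq Ω] [Nonempty Ω] [DecidableEq V]
    (supp : Ω → Finset V) (𝒮 : Finset ι) (good : ι → Finset Ω) {M : ℕ} {D β n : ℝ} (hn : 0 < n)
    (hβ : 0 < β) (hβ1 : β ≤ 1)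
    (hmeet : ∀ ω', n * (univ.filter fun ω => ¬ Disjoint (supp ω) (supp ω')).card ≤
      D * Fintype.card Ω)
    (hgood : ∀ s ∈ 𝒮, β * Fintype.card Ω ≤ (good s).card)
    (hS : 𝒮.card * Real.exp (-(M * (β / 4) ^ 2 / 4)) < 1 / 2) (hM : 8 * M * D ≤ β * n) :
    ∃ (y : Fin M → Ω) (I : Finset (Fin M)),
      (∀ i ∈ I, ∀ j ∈ I, i ≠ j → Disjoint (supp (y i)) (supp (y j))) ∧
      ∀ s ∈ 𝒮, β / 2 * M ≤ (I.filter fun i => y i ∈ good s).card := by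
  classical
  rcases Nat.eq_zero_or_pos M with rfl | hM0
  · exact ⟨fun i => i.elim0, ∅, by simp, by simp⟩
  have hM0' : (0 : ℝ) < M := by exact_mod_cast hM0
  set N : ℝ := (Fintype.card Ω : ℝ) with hN
  have hN0 : 0 < N := by rw [hN]; exact_mod_cast Fintype.card_pos
  set f : ι → (Fin M → Ω) → ℝ := fun s x => ((univ.filter fun i => x i ∈ good s).card : ℝ) with hf
  set B : ι → Finset (Fin M → Ω) := fun s => univ.filter fun x => f s x ≤ β * M - β / 4 * M * 1
    with hB
  have hBs : ∀ s ∈ 𝒮, ((B s).card : ℝ) ≤ N ^ M * Real.exp (-(M * (β / 4) ^ 2 / 4)) := by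
    intro s hs
    refine mcdiarmid one_pos (by positivity) (by linarith) (f s) ?_ ?_ _ (fun x hx => hx)
    · intro x y i hxy
      have : (univ.filter fun i => x i ∈ good s) ⊆ (univ.filter fun i => y i ∈ good s) ∪ {i} := by
        intro j hj
        simp only [mem_union, mem_filter, mem_univ, true_and, mem_singleton] at hj ⊢
        by_cases h : j = i
        · exact Or.inr h
        · exact Or.inl (hxy j h ▸ hj)
      have h2 := (card_le_card this).trans (card_union_le _ _)
      rw [card_singleton] at h2
      have h3 : f s x ≤ f s y + 1 := by
        simp only [hf]
        exact_mod_cast h2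
      linarith
    · have h1 : ∑ x, f s x = ∑ i : Fin M, ((univ.filter fun x : Fin M → Ω => x i ∈ good s).card : ℝ) := by
        simp only [hf, card_filter]
        push_cast
        rw [sum_comm]
      rw [h1]
      have h2 : ∀ i ∈ (univ : Finset (Fin M)), β * N ^ M ≤ ((univ.filter fun x : Fin M → Ω => x i ∈ good s).card : ℝ) := by
        intro i _
        have h3 : N * ((univ.filter fun x : Fin M → Ω => x i ∈ good s).card : ℝ) =
            (good s).card * N ^ M := by
          rw [hN]; exact_mod_cast card_coord_mem i (good s)
        have h4 := hgood s hs
        refine le_of_mul_le_mul_left ?_ hN0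
        rw [h3]
        calc N * (β * N ^ M) = (β * N) * N ^ M := by ring
          _ ≤ _ := by gcongr
      have h3 := card_nsmul_le_sum _ _ _ h2
      rw [card_univ, Fintype.card_fin, nsmul_eq_mul] at h3
      linarith
  set meet : (Fin M → Ω) → Finset (Fin M × Fin M) := fun x => univ.filter fun p =>
    p.1 ≠ p.2 ∧ ¬ Disjoint (supp (x p.1)) (supp (x p.2)) with hmt
  have hpair : ∀ p : Fin M × Fin M, n * ((univ.filter fun x : Fin M → Ω => p ∈ meet x).card : ℝ) ≤
      D * N ^ M := by
    rintro ⟨i, j⟩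
    have hD : 0 ≤ D := by
      have := hmeet (Classical.arbitrary Ω)
      by_contra hneg
      have h1 : D * N < 0 := mul_neg_of_neg_of_pos (not_le.1 hneg) hN0
      have h2 : 0 ≤ n * ((univ.filter fun ω => ¬ Disjoint (supp ω)
        (supp (Classical.arbitrary Ω))).card : ℝ) := by positivity
      linarith
    by_cases hij : i = j
    · have : (univ.filter fun x : Fin M → Ω => (i, j) ∈ meet x) = ∅ := by
        apply filter_eq_empty_iff.2
        intro x _ h
        exact (mem_filter.1 h).2.1 hij
      rw [this]
      simp only [card_empty, Nat.cast_zero, mul_zero]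
      positivity
    · rw [← le_div_iff₀' hn]
      refine card_filter_le_of_piecewise {j} _ fun z => ?_
      have h1 : (univ.filter fun x : Fin M → Ω => (i, j) ∈ meet (({j} : Finset (Fin M)).piecewise z x)) =
          univ.filter fun x : Fin M → Ω => x i ∈ univ.filter fun ω => ¬ Disjoint (supp ω) (supp (z j)) := by
        ext x
        simp [hmt, hij]
      rw [h1, le_div_iff₀' hn]
      have h3 : N * ((univ.filter fun x : Fin M → Ω => x i ∈ univ.filter fun ω => ¬ Disjoint (supp ω) (supp (z j))).card : ℝ) =
            (univ.filter fun ω => ¬ Disjoint (supp ω) (supp (z j))).card * N ^ M := by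
          rw [hN]; exact_mod_cast card_coord_mem i _
      refine le_of_mul_le_mul_left ?_ hN0
      rw [mul_left_comm, h3]
      have h4 := hmeet (z j)
      calc n * ((univ.filter fun ω => ¬ Disjoint (supp ω) (supp (z j))).card * N ^ M)
          = (n * (univ.filter fun ω => ¬ Disjoint (supp ω) (supp (z j))).card) * N ^ M := by ring
        _ ≤ (D * N) * N ^ M := by gcongr
        _ = _ := by ring
  have hsum : n * ∑ x, ((meet x).card : ℝ) ≤ M ^ 2 * (D * N ^ M) := by
    have h1 : ∑ x, ((meet x).card : ℝ) = ∑ p : Fin M × Fin M,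
        ((univ.filter fun x : Fin M → Ω => p ∈ meet x).card : ℝ) := by
      have : ∀ x, ((meet x).card : ℝ) = ∑ p : Fin M × Fin M, if p ∈ meet x then (1 : ℝ) else 0 := by
        intro x
        rw [← sum_filter, filter_mem_eq_inter, univ_inter]
        simp
      rw [sum_congr rfl fun x _ => this x, sum_comm]
      refine sum_congr rfl fun p _ => ?_
      rw [← sum_filter]
      simp
    rw [h1, mul_sum]
    refine (sum_le_card_nsmul _ _ _ fun p _ => hpair p).trans ?_
    rw [nsmul_eq_mul, card_univ, Fintype.card_prod, Fintype.card_fin]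
    push_cast
    rw [sq]
  set C : Finset (Fin M → Ω) := univ.filter fun x => β / 4 * M < (meet x).card with hCdef
  have hCc : (C.card : ℝ) ≤ N ^ M / 2 := by
    have h1 : C.card * (β / 4 * M) ≤ ∑ x, ((meet x).card : ℝ) := by
      rw [← nsmul_eq_mul]
      refine (card_nsmul_le_sum C (fun x => ((meet x).card : ℝ)) _
        fun x hx => (mem_filter.1 hx).2.le).trans ?_
      exact sum_le_univ_sum_of_nonneg fun x => by positivity
    have hP : 0 < N ^ M := by positivity
    have h2 : n * (C.card * (β / 4 * M)) ≤ M ^ 2 * (D * N ^ M) := by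
      refine le_trans ?_ hsum
      gcongr
    have h3 : M ^ 2 * (D * N ^ M) ≤ (β * n) * M / 8 * N ^ M := by
      have := mul_le_mul_of_nonneg_right hM (by positivity : 0 ≤ M / 8 * N ^ M)
      calc _ = 8 * M * D * (M / 8 * N ^ M) := by ring
        _ ≤ _ := this
        _ = _ := by ring
    have h4 : 0 < n * (β / 4 * M) := by positivity
    refine le_of_mul_le_mul_left ?_ h4
    calc n * (β / 4 * M) * C.card = n * (C.card * (β / 4 * M)) := by ring
      _ ≤ _ := h2.trans h3
      _ = _ := by ring
  obtain ⟨x, hx⟩ : ∃ x, x ∉ 𝒮.biUnion B ∪ C := by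
    by_contra! hcon
    have h1 : (univ : Finset (Fin M → Ω)) ⊆ 𝒮.biUnion B ∪ C := fun x _ => hcon x
    have h2 := (card_le_card h1).trans (card_union_le _ _)
    rw [card_univ, Fintype.card_fun, Fintype.card_fin] at h2
    have h3 : ((𝒮.biUnion B).card : ℝ) ≤ 𝒮.card * (N ^ M * Real.exp (-(M * (β / 4) ^ 2 / 4))) := by
      refine (Nat.cast_le.2 card_biUnion_le).trans ?_
      push_cast
      rw [← nsmul_eq_mul]
      exact sum_le_card_nsmul _ _ _ hBs
    have h4 : N ^ M ≤ (𝒮.biUnion B).card + C.card := by rw [hN]; exact_mod_cast h2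
    have hP : 0 < N ^ M := by positivity
    nlinarith
  rw [mem_union, not_or, mem_biUnion] at hx
  refine ⟨x, univ.filter fun i => ∀ j, j ≠ i → Disjoint (supp (x i)) (supp (x j)), ?_, ?_⟩
  · intro i hi j _ hij
    exact (mem_filter.1 hi).2 j hij.symm
  · intro s hs
    have h1 : β * M - β / 4 * M * 1 < f s x := by
      by_contra h
      exact hx.1 ⟨s, hs, mem_filter.2 ⟨mem_univ _, not_lt.1 h⟩⟩
    have h2 : ((meet x).card : ℝ) ≤ β / 4 * M := by
      by_contra h
      exact hx.2 (mem_filter.2 ⟨mem_univ _, not_le.1 h⟩)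
    have h3 : (univ.filter fun i => x i ∈ good s) ⊆
        ((univ.filter fun i => ∀ j, j ≠ i → Disjoint (supp (x i)) (supp (x j))).filter
          fun i => x i ∈ good s) ∪ (meet x).image Prod.fst := by
      intro i hi
      rw [mem_union]
      by_cases h : ∀ j, j ≠ i → Disjoint (supp (x i)) (supp (x j))
      · left
        exact mem_filter.2 ⟨mem_filter.2 ⟨mem_univ _, h⟩, (mem_filter.1 hi).2⟩
      · right
        push Not at h
        obtain ⟨j, hj, hij⟩ := h
        exact mem_image.2 ⟨(i, j), mem_filter.2 ⟨mem_univ _, hj.symm, hij⟩, rfl⟩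
    have h4 := (card_le_card h3).trans ((card_union_le _ _).trans (Nat.add_le_add_left card_image_le _))
    have h5 : f s x ≤ (((univ.filter fun i => ∀ j, j ≠ i → Disjoint (supp (x i)) (supp (x j))).filter
          fun i => x i ∈ good s).card : ℝ) + (meet x).card := by
      simp only [hf]
      exact_mod_cast h4
    linarith

end Families

section TupleFamilies

open Finset

/-- A random family of linearly many disjoint tuples contains linearly many tuples satisfying
each of polynomially many dense requirements. -/
theorem exists_tuple_family (m q : ℕ) (Q : Type) [Fintype Q] [DecidableEq Q] [Nonempty Q]
    {γ : ℝ} (hγ : 0 < γ) :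
    ∃ a : ℝ, 0 < a ∧ ∃ n₀ : ℕ, ∀ n ≥ n₀, ∀ (ι : Type) (𝒮 : Finset ι), 𝒮.card ≤ n ^ q →
      ∀ P : ι → (Fin m → Fin n) → Q → Prop,
      (∀ s ∈ 𝒮, ∀ G : Finset (Fin m → Fin n), (∀ x, (∃ π, P s x π) → x ∈ G) →
        (1 / 4 : ℝ) * n ^ m ≤ G.card) →
      ∃ (M : ℕ) (y : Fin M → Fin m → Fin n) (π : Fin M → Q) (I : Finset (Fin M)),
        (m * M : ℝ) ≤ γ * n ∧
        (∀ i ∈ I, ∀ j ∈ I, i ≠ j → Disjoint (univ.image (y i)) (univ.image (y j))) ∧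
        ∀ s ∈ 𝒮, ∃ J ⊆ I, a * n ≤ J.card ∧ ∀ j ∈ J, P s (y j) (π j) := by
  classical
  set β : ℝ := 1 / (4 * Fintype.card Q) with hβ
  have hQ1 : (1 : ℝ) ≤ Fintype.card Q := by exact_mod_cast Fintype.card_pos (α := Q)
  have hβ0 : 0 < β := by positivity
  have hβ1 : β ≤ 1 := by
    rw [hβ, div_le_one (by positivity)]
    linarith
  set γ' : ℝ := min (γ / (m + 1)) (β / (8 * ((m : ℝ) ^ 2 + 1))) with hγ'
  have hγ0 : 0 < γ' := by positivity
  obtain ⟨n₁, hn₁⟩ := exists_pow_mul_exp_le q (c := γ' / 2 * ((β / 4) ^ 2 / 4)) (δ := 1 / 4)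
    (by positivity) (by norm_num)
  obtain ⟨n₂, hn₂⟩ := exists_nat_gt (2 / γ')
  refine ⟨β / 4 * γ', by positivity, n₁ + n₂ + 1, fun n hn ι 𝒮 h𝒮 P hP => ?_⟩
  have hn0 : (0 : ℝ) < n := by exact_mod_cast (by omega : 0 < n)
  have hn2 : 2 ≤ γ' * n := by
    have : (n₂ : ℝ) ≤ n := by exact_mod_cast (by omega : n₂ ≤ n)
    rw [div_lt_iff₀ hγ0] at hn₂
    nlinarith
  obtain ⟨M, hM⟩ : ∃ M, M = ⌊γ' * n⌋₊ := ⟨_, rfl⟩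
  have hM1 : (M : ℝ) ≤ γ' * n := hM ▸ Nat.floor_le (by positivity)
  have hM2 : γ' / 2 * n ≤ M := by
    have := Nat.lt_floor_add_one (γ' * n)
    rw [← hM] at this
    linarith
  have : Nonempty (Fin n) := ⟨⟨0, by omega⟩⟩
  have hΩ : (Fintype.card ((Fin m → Fin n) × Q) : ℝ) = (n : ℝ) ^ m * Fintype.card Q := by
    simp
  set supp : (Fin m → Fin n) × Q → Finset (Fin n) := fun ω => univ.image ω.1 with hsupp
  set good : ι → Finset ((Fin m → Fin n) × Q) := fun s => univ.filter fun ω => P s ω.1 ω.2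
    with hgood
  have key := exists_family (M := M) (D := (m : ℝ) ^ 2 + 1) (β := β) (n := n)
    supp 𝒮 good hn0 hβ0 hβ1 ?_ ?_ ?_ ?_
  · obtain ⟨y, I, hI, hy⟩ := key
    refine ⟨M, fun i => (y i).1, fun i => (y i).2, I, ?_, hI, fun s hs =>
      ⟨I.filter fun i => y i ∈ good s, filter_subset _ _, ?_, ?_⟩⟩
    · have h1 : γ' ≤ γ / (m + 1) := min_le_left _ _
      rw [le_div_iff₀ (by positivity)] at h1
      nlinarith
    · refine le_trans ?_ (hy s hs)
      nlinarith
    · intro j hj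
      exact (mem_filter.1 (mem_filter.1 hj).2).2
  · intro ω'
    have h1 : (univ.filter fun ω => ¬ Disjoint (supp ω) (supp ω')) ⊆
        (univ.filter fun x : Fin m → Fin n => ∃ i, x i ∈ supp ω') ×ˢ (univ : Finset Q) := by
      intro ω hω
      obtain ⟨v, hv, hv'⟩ := not_disjoint_iff.1 (mem_filter.1 hω).2
      obtain ⟨i, -, rfl⟩ := mem_image.1 hv
      exact mem_product.2 ⟨mem_filter.2 ⟨mem_univ _, i, hv'⟩, mem_univ _⟩
    have h2 := card_le_card h1
    rw [card_product, card_univ] at h2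
    have h3 := card_hit_le (m := m) (supp ω')
    have h4 : (supp ω').card ≤ m := card_image_le.trans (by simp)
    rw [Fintype.card_fin] at h3
    have h5 : n * (univ.filter fun ω => ¬ Disjoint (supp ω) (supp ω')).card ≤
        m * m * n ^ m * Fintype.card Q := by
      calc _ ≤ n * ((univ.filter fun x : Fin m → Fin n => ∃ i, x i ∈ supp ω').card *
            Fintype.card Q) := Nat.mul_le_mul_left _ h2
        _ = n * (univ.filter fun x : Fin m → Fin n => ∃ i, x i ∈ supp ω').card *
            Fintype.card Q := by ring
        _ ≤ m * (supp ω').card * n ^ m * Fintype.card Q := Nat.mul_le_mul_right _ h3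
        _ ≤ _ := by gcongr
    rw [hΩ]
    have h6 : (n : ℝ) * (univ.filter fun ω => ¬ Disjoint (supp ω) (supp ω')).card ≤
        m * m * n ^ m * Fintype.card Q := by exact_mod_cast h5
    have h7 : (0 : ℝ) ≤ (n : ℝ) ^ m * Fintype.card Q := by positivity
    nlinarith
  · intro s hs
    have h1 := hP s hs ((good s).image Prod.fst) fun x ⟨π, hx⟩ =>
      mem_image.2 ⟨(x, π), mem_filter.2 ⟨mem_univ _, hx⟩, rfl⟩
    have h2 : (((good s).image Prod.fst).card : ℝ) ≤ (good s).card := by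
      exact_mod_cast card_image_le
    rw [hΩ]
    calc β * ((n : ℝ) ^ m * Fintype.card Q) = 1 / 4 * n ^ m := by
          rw [hβ]; field_simp
      _ ≤ _ := h1.trans h2
  · have h1 := hn₁ n (by omega)
    have h2 : (𝒮.card : ℝ) ≤ (n : ℝ) ^ q := by exact_mod_cast h𝒮
    calc (𝒮.card : ℝ) * Real.exp (-(M * (β / 4) ^ 2 / 4)) ≤
        (n : ℝ) ^ q * Real.exp (-(γ' / 2 * ((β / 4) ^ 2 / 4) * n)) := by
          gcongr
          have : (0 : ℝ) < (β / 4) ^ 2 / 4 := by positivity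
          nlinarith
      _ ≤ 1 / 4 := h1
      _ < 1 / 2 := by norm_num
  · have h1 : γ' ≤ β / (8 * ((m : ℝ) ^ 2 + 1)) := min_le_right _ _
    rw [le_div_iff₀ (by positivity)] at h1
    have h2 : (0 : ℝ) ≤ 8 * ((m : ℝ) ^ 2 + 1) := by positivity
    nlinarith [mul_le_mul_of_nonneg_right hM1 h2]

end TupleFamilies

section Reservoir

open Finset

theorem image_of_eqOn {α β : Type*} [DecidableEq β] {f g : α → β} {s : Finset α}
    (h : ∀ i ∈ s, f i = g i) : s.image f = s.image g :=
  image_congr fun i hi => h i (mem_coe.1 hi)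

/-- Most samples stay dense when a prescribed vertex set is added to them. -/
theorem sampling_through (k l : ℕ) (hlk : l < k) (s₀ : ℕ) {η δ : ℝ} (hη : 0 < η) (hδ : 0 < δ) :
    ∃ m₀ : ℕ, ∀ m, m₀ ≤ m → ∃ n₀ : ℕ, ∀ n, n₀ ≤ n → ∀ (p : ℝ) (H : Finset (Finset (Fin n))),
      0 ≤ p → DegDense k l p H → ∀ S : Finset (Fin n), S.card = s₀ →
      ∃ (F : Finset (Fin m)) (B : Finset (Fin m → Fin n)), (B.card : ℝ) ≤ δ * (n : ℝ) ^ m ∧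
        ∀ x ∉ B, ∃ y : Fin m → Fin n, Function.Injective y ∧ F.image y = S ∧
          (∀ i, i ∉ F → y i = x i) ∧ DegDense k l (p - η) (pullback k H y) := by
  classical
  obtain ⟨m₀, hm₀⟩ := sampling k l hlk s₀ hη hδ
  refine ⟨m₀ + s₀, fun m hm => ?_⟩
  obtain ⟨n₀, hn₀⟩ := hm₀ m (by omega)
  refine ⟨n₀ + k + 1, fun n hn p H hp hH S hS => ?_⟩
  have hcard : Fintype.card (Fin n) = n := Fintype.card_fin n
  set F : Finset (Fin m) := univ.filter fun i => i.1 < s₀ with hF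
  set s : Fin m → Fin n := fun i =>
    if h : i.1 < s₀ then S.orderEmbOfFin hS ⟨i.1, h⟩ else ⟨0, by omega⟩ with hs
  have hFs : ∀ i ∈ F, ∃ h : i.1 < s₀, s i = S.orderEmbOfFin hS ⟨i.1, h⟩ := by
    intro i hi
    have h := (mem_filter.1 hi).2
    exact ⟨h, by simp only [hs, dif_pos h]⟩
  have hinj : Set.InjOn s F := by
    intro i hi j hj hij
    obtain ⟨h, h'⟩ := hFs i (mem_coe.1 hi)
    obtain ⟨g, g'⟩ := hFs j (mem_coe.1 hj)
    rw [h', g'] at hij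
    have := (S.orderEmbOfFin hS).injective hij
    exact Fin.ext (by simpa using this)
  have hFc : F.card ≤ s₀ := by
    rw [← hS]
    refine card_le_card_of_injOn s (fun i hi => ?_) hinj
    obtain ⟨h, h'⟩ := hFs i hi
    rw [h']
    exact S.orderEmbOfFin_mem hS _
  obtain ⟨B, hB, hx⟩ := hn₀ (Fin n) (by omega) p H hp
    (hH.le_one (by omega) (by omega)) hH F s hFc hinj
  rw [hcard] at hB
  refine ⟨F, B, hB, fun x hxB => ⟨F.piecewise s x, (hx x hxB).1, ?_, ?_, (hx x hxB).2⟩⟩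
  · rw [image_of_eqOn (g := s) fun i hi => F.piecewise_eq_of_mem _ _ hi]
    refine subset_antisymm (fun v hv => ?_) fun v hv => ?_
    · obtain ⟨i, hi, rfl⟩ := mem_image.1 hv
      obtain ⟨h, h'⟩ := hFs i hi
      rw [h']
      exact S.orderEmbOfFin_mem hS _
    · have : v ∈ Set.range (S.orderEmbOfFin hS) := by
        rw [S.range_orderEmbOfFin hS]
        exact mem_coe.2 hv
      obtain ⟨i, rfl⟩ := this
      have hi : i.1 < m := by have := i.2; omega
      refine mem_image.2 ⟨⟨i.1, hi⟩, mem_filter.2 ⟨mem_univ _, i.2⟩, ?_⟩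
      simp only [hs, dif_pos i.2]
  · exact fun i hi => F.piecewise_eq_of_notMem _ _ hi

theorem le_card_of_compl {m n : ℕ} {B G : Finset (Fin m → Fin n)} {δ : ℝ}
    (hB : (B.card : ℝ) ≤ δ * (n : ℝ) ^ m) (h : ∀ x ∉ B, x ∈ G) :
    (1 - δ) * (n : ℝ) ^ m ≤ G.card := by
  have h1 : (univ : Finset (Fin m → Fin n)) ⊆ B ∪ G := fun x _ => by
    by_cases hx : x ∈ B
    · exact mem_union_left _ hx
    · exact mem_union_right _ (h x hx)
  have h2 := (card_le_card h1).trans (card_union_le _ _)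
  rw [card_univ, Fintype.card_fun, Fintype.card_fin, Fintype.card_fin] at h2
  have h3 : (n : ℝ) ^ m ≤ B.card + G.card := by exact_mod_cast h2
  linarith

/-- There is a small family of disjoint paths such that every set of `k - l` vertices can be
absorbed by linearly many of them. -/
theorem exists_absorber_family {k l : ℕ} (hl : 2 ≤ l) (hlk : 2 * l < k) {η γ : ℝ} (hη : 0 < η)
    (hγ : 0 < γ) :
    ∃ a : ℝ, 0 < a ∧ ∃ n₀ m : ℕ, ∀ n ≥ n₀, ∀ H : Finset (Finset (Fin n)),
      DegDense k l (((1 : ℝ) / 2) ^ (((k - l : ℕ) : ℝ) / l) + η) H →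
      ∃ (M : ℕ) (A X B : Fin M → Finset (Fin n)) (I : Finset (Fin M)),
        (m * M : ℝ) ≤ γ * n ∧ (∀ i ∈ I, LP H k l (A i) (X i) (B i)) ∧
        (∀ i ∈ I, (A i ∪ X i ∪ B i).card ≤ m) ∧
        (∀ i ∈ I, ∀ j ∈ I, i ≠ j → Disjoint (A i ∪ X i ∪ B i) (A j ∪ X j ∪ B j)) ∧
        ∀ S : Finset (Fin n), S.card = k - l →
          ∃ J ⊆ I, a * n ≤ J.card ∧ ∀ j ∈ J, LP H k l (A j) (X j ∪ S) (B j) := by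
  classical
  obtain ⟨m₁, hm₁⟩ := exists_absorber hl hlk (half_pos hη)
  obtain ⟨m₂, hm₂⟩ := sampling_through k l (by omega) (k - l) (half_pos hη)
    (δ := 1 / 2) (by norm_num)
  obtain ⟨m, hm⟩ : ∃ m, m = m₁ + m₂ := ⟨_, rfl⟩
  obtain ⟨n₁, hn₁⟩ := hm₂ m (by omega)
  obtain ⟨a, ha, n₂, hn₂⟩ := exists_tuple_family m (k - l)
    (Finset (Fin m) × Finset (Fin m) × Finset (Fin m)) hγ
  refine ⟨a, ha, n₁ + n₂, m, fun n hn H hH => ?_⟩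
  obtain ⟨M, y, π, I, hM, hI, hy⟩ := hn₂ n (by omega) (Finset (Fin n)) (powersetCard (k - l) univ)
    (by rw [card_powersetCard, card_univ, Fintype.card_fin]; exact Nat.choose_le_pow _ _)
    (fun S x π => LP H k l (π.1.image x) (π.2.1.image x) (π.2.2.image x) ∧
      LP H k l (π.1.image x) (π.2.1.image x ∪ S) (π.2.2.image x)) (by
    intro S hS G hG
    have hSc := (mem_powersetCard.1 hS).2
    obtain ⟨F, B, hB, hx⟩ := hn₁ n (by omega) _ H (by positivity) hH S hSc
    have := le_card_of_compl (G := G) hB (fun x hxB => by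
      obtain ⟨z, hz, hzF, hzx, hd⟩ := hx x hxB
      obtain ⟨A', X', B', h1, h2, h3⟩ := hm₁ m (by omega) (pullback k H z)
        (by convert hd using 1; ring) F (by rw [← hSc, ← hzF, card_image_of_injective _ hz])
      have hK : ∀ e ∈ pullback k H z, e.image z ∈ H := fun e he => (mem_pullback.1 he).2
      have hAF : Disjoint A' F := h2.dAX.mono_right subset_union_right
      have hBF : Disjoint B' F := (h2.dXB.mono_left subset_union_right).symm
      have hIm : ∀ {D : Finset (Fin m)}, Disjoint D F → D.image z = D.image x := fun hD =>
        image_of_eqOn fun i hi => hzx i (disjoint_left.1 hD hi)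
      have g1 := h1.map hz hK
      have g2 := h2.map hz hK
      rw [image_union, hzF] at g2
      rw [hIm hAF, hIm hBF, hIm h3] at g1 g2
      exact hG x ⟨(A', X', B'), g1, g2⟩)
    have h0 : (0 : ℝ) ≤ (n : ℝ) ^ m := by positivity
    linarith)
  refine ⟨M, fun i => (π i).1.image (y i), fun i => (π i).2.1.image (y i),
    fun i => (π i).2.2.image (y i), I.filter fun i => LP H k l ((π i).1.image (y i))
      ((π i).2.1.image (y i)) ((π i).2.2.image (y i)), hM, fun i hi => (mem_filter.1 hi).2,
    ?_, ?_, ?_⟩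
  · intro i _
    rw [← image_union, ← image_union]
    exact card_image_le.trans ((card_le_univ _).trans_eq (Fintype.card_fin m))
  · intro i hi j hj hij
    have := hI i (mem_filter.1 hi).1 j (mem_filter.1 hj).1 hij
    simp only [← image_union]
    exact this.mono (image_subset_image (subset_univ _)) (image_subset_image (subset_univ _))
  · intro S hS
    obtain ⟨J, hJ, hJc, h⟩ := hy S (mem_powersetCard.2 ⟨subset_univ _, hS⟩)
    exact ⟨J, fun j hj => mem_filter.2 ⟨hJ hj, (h j hj).1⟩, hJc, fun j hj => (h j hj).2⟩

/-- There is a small vertex set through which any two disjoint `l`-sets can be connected, even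
after a few of its vertices have been used. -/
theorem exists_reservoir {k l : ℕ} (hl : 1 ≤ l) (hlk : 2 * l < k) {η : ℝ} (hη : 0 < η) :
    ∃ ρ : ℝ, 0 < ρ ∧ ∀ γ : ℝ, 0 < γ → ∃ c : ℝ, 0 < c ∧ ∃ n₀ : ℕ, ∀ n ≥ n₀,
      ∀ H : Finset (Finset (Fin n)),
      DegDense k l (((1 : ℝ) / 2) ^ (((k - l : ℕ) : ℝ) / l) + η) H →
      ∀ P : Finset (Fin n), (P.card : ℝ) ≤ ρ * n →
      ∃ Y : Finset (Fin n), Disjoint Y P ∧ (Y.card : ℝ) ≤ γ * n ∧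
        ∀ A B Z : Finset (Fin n), A.card = l → B.card = l → Disjoint A B →
          (Z.card : ℝ) < c * n →
          ∃ X ⊆ Y, X.card = 2 * k - 3 * l ∧ Disjoint X Z ∧ LP H k l A X B := by
  classical
  obtain ⟨c₁, hc₁, m₁, hm₁⟩ := exists_connector hl hlk (half_pos hη)
  obtain ⟨m₂, hm₂⟩ := sampling_through k l (by omega) (l + l) (half_pos hη)
    (δ := 1 / 2) (by norm_num)
  obtain ⟨m, hm⟩ : ∃ m, m = m₁ + m₂ := ⟨_, rfl⟩
  obtain ⟨n₁, hn₁⟩ := hm₂ m (by omega)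
  refine ⟨1 / (4 * (m + 1)), by positivity, fun γ hγ => ?_⟩
  obtain ⟨a, ha, n₂, hn₂⟩ := exists_tuple_family m (l + l) Unit hγ
  refine ⟨a, ha, n₁ + n₂ + 1, fun n hn H hH P hP => ?_⟩
  have hn0 : (0 : ℝ) < n := by exact_mod_cast (by omega : 0 < n)
  have : Nonempty (Fin n) := ⟨⟨0, by omega⟩⟩
  obtain ⟨M, y, -, I, hM, hI, hy⟩ := hn₂ n (by omega) (Finset (Fin n) × Finset (Fin n))
    ((powersetCard l univ ×ˢ powersetCard l univ).filter fun s => Disjoint s.1 s.2)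
    (by
      refine (card_filter_le _ _).trans ?_
      rw [card_product, card_powersetCard, card_univ, Fintype.card_fin, pow_add]
      exact Nat.mul_le_mul (Nat.choose_le_pow _ _) (Nat.choose_le_pow _ _))
    (fun s x _ => Disjoint (univ.image x) P ∧
      ∃ X ⊆ univ.image x, X.card = 2 * k - 3 * l ∧ LP H k l s.1 X s.2) (by
    rintro ⟨A, B⟩ hs G hG
    obtain ⟨hs1, hAB⟩ := mem_filter.1 hs
    have hA := (mem_powersetCard.1 (mem_product.1 hs1).1).2
    have hB := (mem_powersetCard.1 (mem_product.1 hs1).2).2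
    simp only at hA hB hAB
    obtain ⟨F, E, hE, hx⟩ := hn₁ n (by omega) _ H (by positivity) hH (A ∪ B)
      (by rw [card_union_of_disjoint hAB, hA, hB])
    have hhit : ((univ.filter fun x : Fin m → Fin n => ∃ i, x i ∈ P).card : ℝ) ≤
        1 / 4 * (n : ℝ) ^ m := by
      have h1 := card_hit_le (m := m) P
      rw [Fintype.card_fin] at h1
      have h2 : (n : ℝ) * (univ.filter fun x : Fin m → Fin n => ∃ i, x i ∈ P).card ≤
          m * P.card * (n : ℝ) ^ m := by exact_mod_cast h1
      have h3 : (m : ℝ) * P.card ≤ 1 / 4 * n := by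
        rw [div_mul_eq_mul_div, one_mul, le_div_iff₀ (by positivity)] at hP
        have : (0 : ℝ) ≤ P.card := by positivity
        nlinarith
      have h4 : (0 : ℝ) ≤ (n : ℝ) ^ m := by positivity
      refine le_of_mul_le_mul_left ?_ hn0
      nlinarith
    have hEc : (((E ∪ univ.filter fun x : Fin m → Fin n => ∃ i, x i ∈ P).card : ℕ) : ℝ) ≤
        (1 / 2 + 1 / 4) * (n : ℝ) ^ m := by
      have : (((E ∪ univ.filter fun x : Fin m → Fin n => ∃ i, x i ∈ P).card : ℕ) : ℝ) ≤
        E.card + (univ.filter fun x : Fin m → Fin n => ∃ i, x i ∈ P).card := by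
        exact_mod_cast card_union_le _ _
      linarith
    have := le_card_of_compl (G := G) hEc (fun x hxE => by
      rw [notMem_union] at hxE
      obtain ⟨z, hz, hzF, hzx, hd⟩ := hx x hxE.1
      have hIm : ∀ {D : Finset (Fin n)}, D ⊆ A ∪ B → (F.filter fun i => z i ∈ D).image z = D := by
        intro D hD
        ext v
        simp only [mem_image, mem_filter]
        constructor
        · rintro ⟨i, ⟨-, hi⟩, rfl⟩
          exact hi
        · intro hv
          have := hD hv
          rw [← hzF] at this
          obtain ⟨i, hi, rfl⟩ := mem_image.1 this
          exact ⟨i, ⟨hi, hv⟩, rfl⟩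
      have hA' := hIm (subset_union_left : A ⊆ A ∪ B)
      have hB' := hIm (subset_union_right : B ⊆ A ∪ B)
      obtain ⟨X', h1, -, h2⟩ := hm₁ m (by omega) (pullback k H z)
        (by convert hd using 1; ring) (F.filter fun i => z i ∈ A) (F.filter fun i => z i ∈ B) ∅
        (by rw [← card_image_of_injective _ hz, hA', hA])
        (by rw [← card_image_of_injective _ hz, hB', hB])
        (disjoint_filter.2 fun i _ hi hi' => disjoint_left.1 hAB hi hi')
        (by rw [card_empty]; push_cast; positivity)
      have hK : ∀ e ∈ pullback k H z, e.image z ∈ H := fun e he => (mem_pullback.1 he).2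
      have hXF : ∀ i ∈ X', i ∉ F := by
        intro i hi hiF
        have : z i ∈ A ∪ B := by
          rw [← hzF]
          exact mem_image_of_mem _ hiF
        rcases mem_union.1 this with h | h
        · exact disjoint_left.1 h2.dAX (mem_filter.2 ⟨hiF, h⟩) hi
        · exact disjoint_left.1 h2.dXB hi (mem_filter.2 ⟨hiF, h⟩)
      have g := h2.map hz hK
      rw [hA', hB'] at g
      refine hG x ⟨(), disjoint_left.2 fun v hv hvP => ?_, X'.image z, ?_,
        by rw [card_image_of_injective _ hz, h1], g⟩
      · obtain ⟨i, -, rfl⟩ := mem_image.1 hv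
        exact hxE.2 (mem_filter.2 ⟨mem_univ _, i, hvP⟩)
      · rw [image_of_eqOn fun i hi => hzx i (hXF i hi)]
        exact image_subset_image (subset_univ _))
    have h0 : (0 : ℝ) ≤ (n : ℝ) ^ m := by positivity
    linarith)
  refine ⟨(I.filter fun i => Disjoint (univ.image (y i)) P).biUnion fun i => univ.image (y i),
    ?_, ?_, ?_⟩
  · rw [disjoint_biUnion_left]
    exact fun i hi => (mem_filter.1 hi).2
  · have h1 : ((I.filter fun i => Disjoint (univ.image (y i)) P).biUnion
        fun i => univ.image (y i)).card ≤ M * m := by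
      refine (card_biUnion_le_card_mul _ _ m fun i _ => ?_).trans
        (Nat.mul_le_mul_right _ ((card_filter_le _ _).trans (by simpa using card_le_univ I)))
      exact card_image_le.trans (by simp)
    have h2 : (((I.filter fun i => Disjoint (univ.image (y i)) P).biUnion
        fun i => univ.image (y i)).card : ℝ) ≤ M * m := by exact_mod_cast h1
    linarith
  · intro A B Z hA hB hAB hZ
    obtain ⟨J, hJ, hJc, h⟩ := hy (A, B) (mem_filter.2 ⟨mem_product.2
      ⟨mem_powersetCard.2 ⟨subset_univ _, hA⟩, mem_powersetCard.2 ⟨subset_univ _, hB⟩⟩, hAB⟩)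
    obtain ⟨j, hj, hjZ⟩ : ∃ j ∈ J, Disjoint (univ.image (y j)) Z := by
      by_contra! hcon
      have h1 : ∀ j ∈ J, ∃ v ∈ univ.image (y j), v ∈ Z := fun j hj => by
        simpa using not_disjoint_iff.1 (hcon j hj)
      choose! f hf hfZ using h1
      have h2 : J.card ≤ Z.card := by
        refine card_le_card_of_injOn f hfZ fun i hi j hj hij => ?_
        by_contra hne
        exact disjoint_left.1 (hI i (hJ hi) j (hJ hj) hne) (hf i hi) (hij ▸ hf j hj)
      have h3 : (J.card : ℝ) ≤ Z.card := by exact_mod_cast h2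
      linarith
    obtain ⟨hjP, X, hX, hXc, hXL⟩ := h j hj
    refine ⟨X, fun v hv => mem_biUnion.2 ⟨j, mem_filter.2 ⟨hJ hj, hjP⟩, hX hv⟩, hXc,
      hjZ.mono_left hX, hXL⟩

end Reservoir

section PathOn

open Finset

variable {α : Type*} [DecidableEq α] {H : Finset (Finset α)} {k l : ℕ}

/-- There is an `l`-path with vertex set `W` from `A` to `B`. -/
def PathOn (H : Finset (Finset α)) (k l : ℕ) (A B W : Finset α) : Prop :=
  ∃ X, LP H k l A X B ∧ A ∪ X ∪ B = W

variable {A B C D W W' Y : Finset α}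

theorem LP.pathOn {X : Finset α} (h : LP H k l A X B) : PathOn H k l A B (A ∪ X ∪ B) :=
  ⟨X, h, rfl⟩

theorem PathOn.cardA (h : PathOn H k l A B W) : A.card = l := h.choose_spec.1.cardA

theorem PathOn.cardB (h : PathOn H k l A B W) : B.card = l := h.choose_spec.1.cardB

theorem PathOn.subA (h : PathOn H k l A B W) : A ⊆ W := by
  obtain ⟨X, -, rfl⟩ := h
  exact subset_union_left.trans subset_union_left

theorem PathOn.subB (h : PathOn H k l A B W) : B ⊆ W := by
  obtain ⟨X, -, rfl⟩ := h
  exact subset_union_right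

theorem PathOn.dAB (h : PathOn H k l A B W) : Disjoint A B := h.choose_spec.1.dAB

/-- Two paths sharing exactly an end can be concatenated. -/
theorem PathOn.trans (h : PathOn H k l A B W) (h' : PathOn H k l B D W')
    (hd : Disjoint W (W' \ B)) : PathOn H k l A D (W ∪ W') := by
  obtain ⟨X, hX, rfl⟩ := h
  obtain ⟨Y, hY, rfl⟩ := h'
  refine ⟨X ∪ B ∪ Y, hX.trans hY ?_, ?_⟩
  · rw [disjoint_left] at hd ⊢
    intro v hv hv'
    by_cases hvB : v ∈ B
    · rcases mem_union.1 hv with h | h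
      · exact disjoint_left.1 hX.dAB h hvB
      · exact disjoint_left.1 hX.dXB h hvB
    · exact hd (mem_union_left _ hv) (mem_sdiff.2 ⟨hv', hvB⟩)
  · ext v
    simp only [mem_union]
    tauto

/-- Two disjoint paths can be joined by a path between their ends. -/
theorem PathOn.join (h : PathOn H k l A B W) (h' : PathOn H k l C D W') (hY : LP H k l B Y C)
    (hWW : Disjoint W W') (hWY : Disjoint W Y) (hWY' : Disjoint W' Y) :
    PathOn H k l A D (W ∪ Y ∪ W') := by
  have h1 := h.trans hY.pathOn (by
    rw [disjoint_left] at *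
    intro v hv hv'
    simp only [mem_sdiff, mem_union] at hv'
    obtain ⟨(h1 | h1) | h1, h2⟩ := hv'
    · exact h2 h1
    · exact hWY hv h1
    · exact hWW hv (h'.subA h1))
  have h2 := h1.trans h' (by
    rw [disjoint_left] at *
    intro v hv hv'
    simp only [mem_sdiff, mem_union] at hv hv'
    rcases hv with h1 | ((h1 | h1) | h1)
    · exact hWW h1 hv'.1
    · exact hWW (h.subB h1) hv'.1
    · exact hWY' hv'.1 h1
    · exact hv'.2 h1)
  convert h2 using 1
  ext v
  have hB : v ∈ B → v ∈ W := fun hv => h.subB hv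
  have hC : v ∈ C → v ∈ W' := fun hv => h'.subA hv
  simp only [mem_union]
  tauto

theorem PathOn.map {β : Type*} [DecidableEq β] {K : Finset (Finset β)} {A B W : Finset β}
    {f : β → α} (hf : Function.Injective f) (hK : ∀ e ∈ K, e.image f ∈ H)
    (h : PathOn K k l A B W) : PathOn H k l (A.image f) (B.image f) (W.image f) := by
  obtain ⟨X, hX, rfl⟩ := h
  exact ⟨X.image f, hX.map hf hK, by simp only [image_union]⟩

/-- Blowing up two edges `S ∪ I ∪ T` and `S ∪ J ∪ T` yields a long path. -/
theorem blowup_path {β : Type*} [DecidableEq β] {S T I J : Finset β} (hS : S.card = l)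
    (hT : T.card = l) (hI : I.card = k - 2 * l) (hJ : J.card = k - 2 * l) (hST : Disjoint S T)
    (hSI : Disjoint S I) (hTI : Disjoint T I) (hSJ : Disjoint S J) (hTJ : Disjoint T J)
    (hIJ : Disjoint I J) (φ : ℕ → β → α) (s : ℕ)
    (hφ : ∀ c ≤ s, ∀ c' ≤ s, ∀ j j', φ c j = φ c' j' → c = c' ∧ j = j')
    (hH : ∀ x : β → ℕ, (∀ j, x j ≤ s) → ((S ∪ I ∪ T).image fun j => φ (x j) j) ∈ H ∧
      ((S ∪ J ∪ T).image fun j => φ (x j) j) ∈ H) :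
    PathOn H k l (S.image (φ 0)) (T.image (φ s))
      (((range s).biUnion fun c => (S ∪ I ∪ T ∪ J).image (φ c)) ∪ (S ∪ I ∪ T).image (φ s)) := by
  have hinj : ∀ c ≤ s, Function.Injective (φ c) := fun c hc j j' h => (hφ c hc c hc j j' h).2
  have hdis : ∀ c ≤ s, ∀ c' ≤ s, c ≠ c' → ∀ F F' : Finset β,
      Disjoint (F.image (φ c)) (F'.image (φ c')) := by
    intro c hc c' hc' hne F F'
    rw [disjoint_left]
    intro v hv hv'
    obtain ⟨j, -, rfl⟩ := mem_image.1 hv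
    obtain ⟨j', -, h⟩ := mem_image.1 hv'
    exact hne (hφ c' hc' c hc _ _ h).1.symm
  have hedge : ∀ c ≤ s, LEdge H k l (S.image (φ c)) (I.image (φ c)) (T.image (φ c)) := by
    intro c hc
    have hi := hinj c hc
    refine ⟨by rwa [card_image_of_injective _ hi], by rwa [card_image_of_injective _ hi],
      by rwa [card_image_of_injective _ hi], (disjoint_image hi).2 hSI, (disjoint_image hi).2 hST,
      (disjoint_image hi).2 hTI.symm, ?_⟩
    rw [← image_union, ← image_union]
    exact (hH (fun _ => c) fun _ => hc).1
  induction s with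
  | zero =>
    have := (LP.edge (hedge 0 le_rfl)).pathOn
    rw [range_zero, biUnion_empty, empty_union]
    simpa only [image_union] using this
  | succ s ih =>
    have ih := ih (fun c hc c' hc' => hφ c (by omega) c' (by omega))
      (fun x hx => hH x fun j => (hx j).trans (by omega)) (fun c hc => hinj c (by omega))
      (fun c hc c' hc' => hdis c (by omega) c' (by omega)) (fun c hc => hedge c (by omega))
    have hi := hinj s (by omega)
    have hi' := hinj (s + 1) le_rfl
    have hcross : LEdge H k l (T.image (φ s)) (J.image (φ s)) (S.image (φ (s + 1))) := by
      refine ⟨by rwa [card_image_of_injective _ hi], by rwa [card_image_of_injective _ hi],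
        by rwa [card_image_of_injective _ hi'], (disjoint_image hi).2 hTJ,
        hdis s (by omega) (s + 1) le_rfl (by omega) _ _,
        hdis s (by omega) (s + 1) le_rfl (by omega) _ _, ?_⟩
      have h1 := (hH (fun j => if j ∈ S then s + 1 else s) fun j => by split_ifs <;> omega).2
      have h2 : ∀ F : Finset β, Disjoint S F →
          (F.image fun j => φ (if j ∈ S then s + 1 else s) j) = F.image (φ s) := fun F hF =>
        image_of_eqOn fun j hj => by rw [if_neg (disjoint_right.1 hF hj)]
      have h3 : (S.image fun j => φ (if j ∈ S then s + 1 else s) j) = S.image (φ (s + 1)) :=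
        image_of_eqOn fun j hj => by rw [if_pos hj]
      rw [image_union, image_union, h2 T hST, h2 J hSJ, h3] at h1
      convert h1 using 1
      ac_rfl
    have h1 : ∀ c ≤ s, ∀ F F' : Finset β,
        Disjoint (F.image (φ c)) (F'.image (φ (s + 1))) := fun c hc =>
      hdis c (by omega) (s + 1) le_rfl (by omega)
    have h2 : Disjoint ((range s).biUnion fun c => (S ∪ I ∪ T ∪ J).image (φ c))
        (J.image (φ s)) := by
      rw [disjoint_biUnion_left]
      intro c hc
      have := mem_range.1 hc
      exact hdis c (by omega) s (by omega) (by omega) _ _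
    have h3 : Disjoint ((S ∪ I ∪ T).image (φ s)) (J.image (φ s)) :=
      (disjoint_image hi).2 (by simp only [disjoint_union_left]; exact ⟨⟨hSJ, hIJ⟩, hTJ⟩)
    have h4 : ∀ F' : Finset β, Disjoint (((range s).biUnion fun c => (S ∪ I ∪ T ∪ J).image (φ c)) ∪
        (S ∪ I ∪ T).image (φ s)) (F'.image (φ (s + 1))) := by
      intro F'
      rw [disjoint_union_left, disjoint_biUnion_left]
      exact ⟨fun c hc => h1 c (mem_range.1 hc).le _ _, h1 s le_rfl _ _⟩
    have h5 := ih.trans (LP.edge hcross).pathOn (by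
      refine Disjoint.mono_right (c := J.image (φ s) ∪ S.image (φ (s + 1))) ?_ ?_
      · intro v
        simp only [mem_sdiff, mem_union]
        tauto
      · rw [disjoint_union_right]
        exact ⟨disjoint_union_left.2 ⟨h2, h3⟩, h4 S⟩)
    have h6 := h5.trans (LP.edge (hedge (s + 1) le_rfl)).pathOn (by
      refine Disjoint.mono_right (c := (I ∪ T).image (φ (s + 1))) ?_ ?_
      · intro v
        simp only [mem_sdiff, mem_union, image_union]
        tauto
      · rw [disjoint_union_left]
        refine ⟨h4 _, ?_⟩
        rw [disjoint_union_left, disjoint_union_left]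
        exact ⟨⟨h1 s le_rfl _ _, h1 s le_rfl _ _⟩, (disjoint_image hi').2
          (disjoint_union_right.2 ⟨hSI, hST⟩)⟩)
    convert h6 using 1
    rw [range_add_one, biUnion_insert]
    simp only [image_union]
    generalize ((range s).biUnion fun c => S.image (φ c) ∪ I.image (φ c) ∪ T.image (φ c) ∪
      J.image (φ c)) = U
    ext v
    simp only [mem_union]
    grind

end PathOn

section RowStates

open Finset

/-- Pairs of `k`-sets meeting in `2 * l` vertices which cover nearly all of `Fin m` disjointly. -/
structure IsYPattern {m : ℕ} (k l : ℕ) (ε : ℝ)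
    (π : Finset (Finset (Fin m) × Finset (Fin m))) : Prop where
  card_fst : ∀ p ∈ π, p.1.card = k
  card_snd : ∀ p ∈ π, p.2.card = k
  card_inter : ∀ p ∈ π, (p.1 ∩ p.2).card = 2 * l
  disj : ∀ p ∈ π, ∀ p' ∈ π, p ≠ p' → Disjoint (p.1 ∪ p.2) (p'.1 ∪ p'.2)
  cover : (m : ℝ) - (π.biUnion fun p => p.1 ∪ p.2).card ≤ ε * m

theorem HasYTilingCover.exists_pattern {m k l : ℕ} {ε : ℝ} {K : Finset (Finset (Fin m))}
    (hK : ∀ e ∈ K, e.card = k) (h : HasYTilingCover m l K (ε * m)) :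
    ∃ π, IsYPattern k l ε π ∧ ∀ p ∈ π, p.1 ∈ K ∧ p.2 ∈ K := by
  obtain ⟨N, e₁, e₂, h1, h2, h3⟩ := h
  have hmem : ∀ p ∈ univ.image fun j => (e₁ j, e₂ j), ∃ j, e₁ j = p.1 ∧ e₂ j = p.2 := by
    intro p hp
    obtain ⟨j, -, rfl⟩ := mem_image.1 hp
    exact ⟨j, rfl, rfl⟩
  refine ⟨univ.image fun j => (e₁ j, e₂ j), ⟨?_, ?_, ?_, ?_, ?_⟩, ?_⟩
  · intro p hp
    obtain ⟨j, h, -⟩ := hmem p hp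
    exact h ▸ hK _ (h1 j).1
  · intro p hp
    obtain ⟨j, -, h⟩ := hmem p hp
    exact h ▸ hK _ (h1 j).2.1
  · intro p hp
    obtain ⟨j, h, h'⟩ := hmem p hp
    rw [← h, ← h']
    exact (h1 j).2.2
  · intro p hp p' hp' hne
    obtain ⟨j, h, h'⟩ := hmem p hp
    obtain ⟨i, g, g'⟩ := hmem p' hp'
    rw [← h, ← h', ← g, ← g']
    refine h2 j i fun hij => hne ?_
    subst hij
    exact Prod.ext (h.symm.trans g) (h'.symm.trans g')
  · rwa [image_biUnion]
  · intro p hp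
    obtain ⟨j, h, h'⟩ := hmem p hp
    rw [← h, ← h']
    exact ⟨(h1 j).1, (h1 j).2.1⟩

/-- The vertices are arranged in rows, and for every positive label, all transversals of the rows
with this label contain the edges of a common pattern. -/
structure RowState {R m : ℕ} (H : Finset (Finset (Fin R × Fin m))) (k l : ℕ) (ε : ℝ)
    (e : Equiv.Perm (Fin R × Fin m)) (lab : Fin R → ℕ) (L : ℕ) : Prop where
  le : ∀ ρ, lab ρ ≤ L
  pat : ∀ i, 1 ≤ i → i ≤ L → ∃ π, IsYPattern k l ε π ∧ ∀ p ∈ π, ∀ x : Fin m → Fin R,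
    (∀ j, lab (x j) = i) →
      (p.1.image fun j => e (x j, j)) ∈ H ∧ (p.2.image fun j => e (x j, j)) ∈ H

/-- Many unlabelled rows allow finding a box of samples with the same patterns. -/
theorem exists_sample_box {m k l b : ℕ} [NeZero m] {ε ζ : ℝ} (hζ : 0 < ζ) :
    ∃ R₀ : ℕ, ∀ R ≥ R₀, ∀ (H : Finset (Finset (Fin R × Fin m)))
      (B : Finset (Fin m → Fin R × Fin m)),
      (m : ℝ) * B.card ≤ ζ / 4 * ((R : ℝ) * m) ^ m →
      (∀ x ∉ B, ∃ π, IsYPattern k l ε π ∧ ∀ p ∈ π, p.1.image x ∈ H ∧ p.2.image x ∈ H) →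
      ∀ (e : Equiv.Perm (Fin R × Fin m)) (U : Finset (Fin R)), ζ * R ≤ U.card →
      ∃ (X : Fin m → Finset (Fin R)) (r : Fin m → Fin m)
        (π : Fin m → Finset (Finset (Fin m) × Finset (Fin m))),
        (∀ j, (X j).card = b) ∧ (∀ a, IsYPattern k l ε (π a)) ∧
        ∀ x : Fin m → Fin R, (∀ j, x j ∈ X j) → Function.Injective x ∧ x 0 ∈ U ∧
          ∀ a, ∀ p ∈ π a, (p.1.image fun j => e (x j, r j + a)) ∈ H ∧
            (p.2.image fun j => e (x j, r j + a)) ∈ H := by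
  classical
  set κ : ℝ := (Fintype.card ((Fin m → Fin m) ×
    (Fin m → Finset (Finset (Fin m) × Finset (Fin m)))) : ℝ) with hκ
  have hκ0 : 0 < κ := by rw [hκ]; exact_mod_cast Fintype.card_pos
  have hm0 : (0 : ℝ) < m := by exact_mod_cast Nat.pos_of_ne_zero (NeZero.ne m)
  obtain ⟨R₁, hR₁⟩ := exists_box b m (ζ / 2 * (m : ℝ) ^ m / κ) (by positivity)
  obtain ⟨R₂, hR₂⟩ := exists_nat_gt ((m : ℝ) ^ 2 / (ζ / 4))
  refine ⟨R₁ + R₂ + 1, fun R hR H B hB hpat e U hU => ?_⟩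
  have hR0 : (0 : ℝ) < R := by exact_mod_cast (by omega : 0 < R)
  have : Nonempty (Fin R) := ⟨⟨0, by omega⟩⟩
  have hpat' : ∀ x, ∃ π : Finset (Finset (Fin m) × Finset (Fin m)), x ∉ B →
      IsYPattern k l ε π ∧ ∀ p ∈ π, p.1.image x ∈ H ∧ p.2.image x ∈ H := by
    intro x
    by_cases hx : x ∈ B
    · exact ⟨∅, fun h => (h hx).elim⟩
    · obtain ⟨π, h⟩ := hpat x hx
      exact ⟨π, fun _ => h⟩
  choose pat hpat using hpat'
  set shift : Fin m → Equiv.Perm (Fin m → Fin R × Fin m) := fun a =>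
    Equiv.piCongrRight fun _ => ((Equiv.refl _).prodCongr (Equiv.addRight a)).trans e with hshift
  have hshift' : ∀ a ξ j, shift a ξ j = e ((ξ j).1, (ξ j).2 + a) := fun a ξ j => rfl
  set G₀ := univ.filter fun ξ : Fin m → Fin R × Fin m => ξ 0 ∈ U ×ˢ (univ : Finset (Fin m))
    with hG₀
  set G₁ := (univ : Finset (Fin m)).biUnion fun a =>
    univ.filter fun ξ : Fin m → Fin R × Fin m => shift a ξ ∈ B with hG₁
  set G₂ := univ.filter fun ξ : Fin m → Fin R × Fin m => ¬ Function.Injective fun j => (ξ j).1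
    with hG₂
  have hcV : Fintype.card (Fin R × Fin m) = R * m := by simp
  have hc₀ : ζ * ((R : ℝ) * m) ^ m ≤ G₀.card := by
    have h := card_coord_mem (Ω := Fin R × Fin m) (M := m) 0 (U ×ˢ univ)
    rw [hcV, card_product, card_univ, Fintype.card_fin] at h
    have h' : ((R : ℝ) * m) * G₀.card = U.card * m * ((R : ℝ) * m) ^ m := by exact_mod_cast h
    have h2 : (0 : ℝ) ≤ m * ((R : ℝ) * m) ^ m := by positivity
    refine le_of_mul_le_mul_left (a := (R : ℝ) * m) ?_ (by positivity)
    rw [h']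
    nlinarith
  have hc₁ : (G₁.card : ℝ) ≤ ζ / 4 * ((R : ℝ) * m) ^ m := by
    refine le_trans ?_ hB
    have : G₁.card ≤ m * B.card := by
      refine (card_biUnion_le_card_mul _ _ B.card fun a _ => ?_).trans_eq (by simp)
      exact card_le_card_of_injOn (shift a) (fun ξ hξ => by simpa using hξ)
        (shift a).injective.injOn
    exact_mod_cast this
  have hc₂ : (G₂.card : ℝ) ≤ ζ / 4 * ((R : ℝ) * m) ^ m := by
    have h1 := card_not_injective_le (V := Fin R) (m := m) ∅ (fun _ => Classical.arbitrary _)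
      (by simp)
    simp only [piecewise_empty] at h1
    have h2 : G₂.card ≤ (univ.filter fun x : Fin m → Fin R => ¬ Function.Injective x).card *
        m ^ m := by
      have h3 : ((univ : Finset (Fin m → Fin m))).card = m ^ m := by simp
      rw [← h3, ← card_product]
      refine card_le_card_of_injOn (fun ξ => (fun j => (ξ j).1, fun j => (ξ j).2)) ?_ ?_
      · intro ξ hξ
        have := (mem_filter.1 (mem_coe.1 hξ)).2
        exact mem_coe.2 (mem_product.2 ⟨mem_filter.2 ⟨mem_univ _, this⟩, mem_univ _⟩)
      · intro ξ _ ξ' _ h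
        simp only [Prod.mk.injEq] at h
        exact funext fun j => Prod.ext (congrFun h.1 j) (congrFun h.2 j)
    rw [Fintype.card_fin] at h1
    have h3 : (R : ℝ) * (univ.filter fun x : Fin m → Fin R => ¬ Function.Injective x).card ≤
        (m : ℝ) ^ 2 * (R : ℝ) ^ m := by exact_mod_cast h1
    have h4 : (G₂.card : ℝ) ≤
        (univ.filter fun x : Fin m → Fin R => ¬ Function.Injective x).card * (m : ℝ) ^ m := by
      exact_mod_cast h2
    rw [div_lt_iff₀ (by positivity)] at hR₂
    have h5 : (R₂ : ℝ) ≤ R := by exact_mod_cast (by omega : R₂ ≤ R)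
    have h6 : ((univ.filter fun x : Fin m → Fin R => ¬ Function.Injective x).card : ℝ) ≤
        ζ / 4 * (R : ℝ) ^ m := by
      refine le_of_mul_le_mul_left (a := (R : ℝ)) (h3.trans ?_) hR0
      have : (m : ℝ) ^ 2 ≤ R * (ζ / 4) := by nlinarith
      calc (m : ℝ) ^ 2 * (R : ℝ) ^ m ≤ R * (ζ / 4) * (R : ℝ) ^ m := by gcongr
        _ = _ := by ring
    calc _ ≤ _ := h4
      _ ≤ ζ / 4 * (R : ℝ) ^ m * (m : ℝ) ^ m := by gcongr
      _ = _ := by rw [mul_pow]; ring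
  set G := G₀ \ (G₁ ∪ G₂) with hG
  have hGc : ζ / 2 * ((R : ℝ) * m) ^ m ≤ G.card := by
    have h1 := le_card_sdiff (G₁ ∪ G₂) G₀
    have h2 := card_union_le G₁ G₂
    have h3 : (G₀.card : ℝ) ≤ G.card + (G₁.card + G₂.card) := by
      exact_mod_cast (by rw [hG]; omega : G₀.card ≤ G.card + (G₁.card + G₂.card))
    linarith
  obtain ⟨⟨r, π⟩, -, hfib⟩ := exists_le_card_fiber_of_nsmul_le_card_of_maps_to
    (s := G) (t := univ) (b := ζ / 2 * ((R : ℝ) * m) ^ m / κ)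
    (f := fun ξ => ((fun j => (ξ j).2, fun a => pat (shift a ξ)) : (Fin m → Fin m) ×
      (Fin m → Finset (Finset (Fin m) × Finset (Fin m))))) (fun _ _ => mem_univ _) univ_nonempty
    (by
      rw [card_univ, nsmul_eq_mul, ← hκ, mul_div_cancel₀ _ hκ0.ne']
      exact hGc)
  set Fb := G.filter fun ξ => ((fun j => (ξ j).2, fun a => pat (shift a ξ)) :
    (Fin m → Fin m) × (Fin m → Finset (Finset (Fin m) × Finset (Fin m)))) = (r, π) with hFb
  have hFbm : ∀ ξ ∈ Fb, ξ ∈ G ∧ (∀ j, (ξ j).2 = r j) ∧ ∀ a, pat (shift a ξ) = π a := by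
    intro ξ hξ
    obtain ⟨h1, h2⟩ := mem_filter.1 hξ
    simp only [Prod.mk.injEq] at h2
    exact ⟨h1, congrFun h2.1, congrFun h2.2⟩
  obtain ⟨X, hX, hXQ⟩ := hR₁ (Fin R) (by rw [Fintype.card_fin]; omega)
    (Fb.image fun ξ j => (ξ j).1) (by
      rw [card_image_of_injOn, Fintype.card_fin]
      · refine le_trans (le_of_eq ?_) hfib
        rw [mul_pow]
        ring
      · intro ξ hξ ξ' hξ' h
        refine funext fun j => Prod.ext (congrFun h j) ?_
        rw [(hFbm ξ hξ).2.1, (hFbm ξ' hξ').2.1])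
  have hkey : ∀ x : Fin m → Fin R, (∀ j, x j ∈ X j) → (fun j => (x j, r j)) ∈ Fb := by
    intro x hx
    obtain ⟨ξ, hξ, rfl⟩ := mem_image.1 (hXQ x hx)
    have : (fun j => ((ξ j).1, r j)) = ξ := funext fun j => by rw [← (hFbm ξ hξ).2.1 j]
    rwa [this]
  have hGm : ∀ ξ ∈ G, (ξ 0).1 ∈ U ∧ (∀ a, shift a ξ ∉ B) ∧
      Function.Injective fun j => (ξ j).1 := by
    intro ξ hξ
    obtain ⟨h1, h2⟩ := mem_sdiff.1 hξ
    rw [notMem_union] at h2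
    refine ⟨(mem_product.1 (mem_filter.1 h1).2).1, fun a ha => h2.1 ?_, ?_⟩
    · exact mem_biUnion.2 ⟨a, mem_univ _, mem_filter.2 ⟨mem_univ _, ha⟩⟩
    · by_contra h
      exact h2.2 (mem_filter.2 ⟨mem_univ _, h⟩)
  have hFb0 : Fb.Nonempty := by
    rw [← card_pos]
    have : (0 : ℝ) < Fb.card := lt_of_lt_of_le (by positivity) hfib
    exact_mod_cast this
  obtain ⟨ξ₀, hξ₀⟩ := hFb0
  refine ⟨X, r, π, hX, fun a => ?_, fun x hx => ?_⟩
  · rw [← (hFbm ξ₀ hξ₀).2.2 a]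
    exact (hpat _ ((hGm _ (hFbm ξ₀ hξ₀).1).2.1 a)).1
  · obtain ⟨h1, -, h2⟩ := hFbm _ (hkey x hx)
    obtain ⟨g1, g2, g3⟩ := hGm _ h1
    refine ⟨g3, g1, fun a p hp => ?_⟩
    rw [← h2 a] at hp
    exact (hpat _ (g2 a)).2 p hp

end RowStates

section RowStateSteps

open Finset

theorem RowState.step {R m k l b L : ℕ} [NeZero m] {ε : ℝ} (hb : 1 ≤ b)
    {H : Finset (Finset (Fin R × Fin m))} {e : Equiv.Perm (Fin R × Fin m)} {lab : Fin R → ℕ}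
    (hs : RowState H k l ε e lab L) {X : Fin m → Finset (Fin R)} {r : Fin m → Fin m}
    {π : Fin m → Finset (Finset (Fin m) × Finset (Fin m))}
    (hX : ∀ j, (X j).card = b) (hπ : ∀ a, IsYPattern k l ε (π a))
    (h : ∀ x : Fin m → Fin R, (∀ j, x j ∈ X j) → Function.Injective x ∧
      x 0 ∈ univ.filter (fun ρ => lab ρ = 0) ∧
      ∀ a, ∀ p ∈ π a, (p.1.image fun j => e (x j, r j + a)) ∈ H ∧
        (p.2.image fun j => e (x j, r j + a)) ∈ H) :
    ∃ (e' : Equiv.Perm (Fin R × Fin m)) (lab' : Fin R → ℕ), RowState H k l ε e' lab' (L + m) ∧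
      (univ.filter fun ρ => lab' ρ = 0).card + b ≤ (univ.filter fun ρ => lab ρ = 0).card := by
  classical
  have hne : ∀ j, (X j).Nonempty := fun j => by rw [← card_pos, hX]; omega
  choose y hy using hne
  have hdisj : ∀ i j v, v ∈ X i → v ∈ X j → i = j := by
    intro i j v hi hj
    refine (h (fun a => if v ∈ X a then v else y a) fun a => ?_).1 ?_
    · split_ifs with hv
      exacts [hv, hy a]
    · simp [hi, hj]
  set g : Fin m × Fin b → Fin R := fun p => (X p.1).orderEmbOfFin (hX p.1) p.2 with hg
  have hgX : ∀ p, g p ∈ X p.1 := fun p => orderEmbOfFin_mem _ _ _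
  have hgi : Function.Injective g := by
    intro p q hpq
    obtain ⟨a, c⟩ := p
    obtain ⟨a', c'⟩ := q
    obtain rfl : a = a' := hdisj _ _ _ (hgX (a, c)) (by rw [hpq]; exact hgX (a', c'))
    exact congrArg _ (((X a).orderEmbOfFin (hX a)).injective hpq)
  set ι : (Fin m × Fin b) × Fin m ↪ Fin R × Fin m :=
    ⟨fun q => (g q.1, q.2), fun q q' hq => by
      simp only [Prod.mk.injEq] at hq
      exact Prod.ext (hgi hq.1) hq.2⟩ with hι
  have hτi : Function.Injective fun q : (Fin m × Fin b) × Fin m =>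
      (((q.2, q.1.2), r q.2 + q.1.1) : (Fin m × Fin b) × Fin m) := by
    rintro ⟨⟨a, c⟩, j⟩ ⟨⟨a', c'⟩, j'⟩ hq
    simp only [Prod.mk.injEq] at hq
    obtain ⟨⟨rfl, rfl⟩, h3⟩ := hq
    rw [add_left_cancel h3]
  set τ : Equiv.Perm ((Fin m × Fin b) × Fin m) :=
    Equiv.ofBijective _ (Finite.injective_iff_bijective.1 hτi) with hτ
  set e' := (τ.viaEmbedding ι).trans e with he'
  have he1 : ∀ a c j, e' (g (a, c), j) = e (g (j, c), r j + a) := by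
    intro a c j
    have := Equiv.Perm.viaEmbedding_apply τ ι ((a, c), j)
    exact congrArg e this
  have he2 : ∀ ρ j, ρ ∉ Set.range g → e' (ρ, j) = e (ρ, j) := by
    intro ρ j hρ
    refine congrArg e (Equiv.Perm.viaEmbedding_apply_of_notMem τ ι (ρ, j) ?_)
    rintro ⟨q, hq⟩
    exact hρ ⟨q.1, congrArg Prod.fst hq⟩
  set lab' := Function.extend g (fun p => L + 1 + p.1.val) lab with hlab'
  have hl1 : ∀ p, lab' (g p) = L + 1 + p.1.val := fun p => hgi.extend_apply _ _ _
  have hl2 : ∀ ρ, ρ ∉ Set.range g → lab' ρ = lab ρ := fun ρ hρ =>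
    Function.extend_apply' _ _ _ hρ
  refine ⟨e', lab', ⟨fun ρ => ?_, fun i hi1 hi2 => ?_⟩, ?_⟩
  · by_cases hρ : ρ ∈ Set.range g
    · obtain ⟨p, rfl⟩ := hρ
      have := p.1.2
      rw [hl1]
      omega
    · rw [hl2 ρ hρ]
      exact (hs.le ρ).trans (Nat.le_add_right _ _)
  · by_cases hiL : i ≤ L
    · obtain ⟨π', h1, h2⟩ := hs.pat i hi1 hiL
      refine ⟨π', h1, fun p hp x hx => ?_⟩
      have hx' : ∀ j, x j ∉ Set.range g := by
        rintro j ⟨q, hq⟩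
        have := hx j
        rw [← hq, hl1] at this
        omega
      have hx'' : (fun j => e' (x j, j)) = fun j => e (x j, j) := funext fun j => he2 _ _ (hx' j)
      rw [hx'']
      exact h2 p hp x fun j => by rw [← hl2 _ (hx' j), hx j]
    · set a : Fin m := ⟨i - (L + 1), by omega⟩ with ha
      refine ⟨π a, hπ a, fun p hp x hx => ?_⟩
      have hx' : ∀ j, ∃ c, g (a, c) = x j := by
        intro j
        by_cases hr : x j ∈ Set.range g
        · obtain ⟨⟨a', c⟩, hq⟩ := hr
          have := hx j
          rw [← hq, hl1] at this
          refine ⟨c, ?_⟩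
          rw [← hq]
          congr 2
          refine Fin.ext ?_
          simp only [ha]
          simp only at this
          omega
        · have := hx j
          have h3 := hs.le (x j)
          rw [hl2 _ hr] at this
          omega
      choose c hc using hx'
      have hx'' : (fun j => e' (x j, j)) = fun j => e (g (j, c j), r j + a) :=
        funext fun j => by rw [← hc j, he1]
      rw [hx'']
      exact (h _ fun j => hgX (j, c j)).2.2 a p hp
  · have hsub : X 0 ⊆ univ.filter fun ρ => lab ρ = 0 := by
      intro ρ hρ
      have := (h (fun j => if j = 0 then ρ else y j) fun j => by
        split_ifs with hj
        exacts [hj ▸ hρ, hy j]).2.1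
      simpa using this
    rw [← hX 0, ← card_union_of_disjoint]
    · refine card_le_card (union_subset (fun ρ hρ => ?_) hsub)
      have h0 := (mem_filter.1 hρ).2
      refine mem_filter.2 ⟨mem_univ _, ?_⟩
      rw [← hl2]
      · exact h0
      · rintro ⟨q, rfl⟩
        rw [hl1] at h0
        omega
    · refine disjoint_left.2 fun ρ hρ hρX => ?_
      have h0 := (mem_filter.1 hρ).2
      have : ρ ∈ Set.range g := by
        have h1 := range_orderEmbOfFin (X 0) (hX 0)
        obtain ⟨c, rfl⟩ : ρ ∈ Set.range ((X 0).orderEmbOfFin (hX 0)) := by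
          rw [h1]; exact hρX
        exact ⟨(0, c), rfl⟩
      obtain ⟨q, rfl⟩ := this
      rw [hl1] at h0
      omega

/-- Giving rows new labels until few rows carry none. -/
theorem exists_rowState {m k l b : ℕ} [NeZero m] {ε ζ : ℝ} (hζ : 0 < ζ) (hb : 1 ≤ b) :
    ∃ R₀ : ℕ, ∀ R ≥ R₀, ∀ (H : Finset (Finset (Fin R × Fin m)))
      (B : Finset (Fin m → Fin R × Fin m)),
      (m : ℝ) * B.card ≤ ζ / 4 * ((R : ℝ) * m) ^ m →
      (∀ x ∉ B, ∃ π, IsYPattern k l ε π ∧ ∀ p ∈ π, p.1.image x ∈ H ∧ p.2.image x ∈ H) →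
      ∃ (e : Equiv.Perm (Fin R × Fin m)) (lab : Fin R → ℕ) (L : ℕ), RowState H k l ε e lab L ∧
        b * L ≤ m * R ∧ ((univ.filter fun ρ => lab ρ = 0).card : ℝ) < ζ * R := by
  obtain ⟨R₀, hR₀⟩ := exists_sample_box (m := m) (k := k) (l := l) (b := b) (ε := ε) hζ
  refine ⟨R₀, fun R hR H B hB hpat => ?_⟩
  have key : ∀ u, ∀ (e : Equiv.Perm (Fin R × Fin m)) (lab : Fin R → ℕ) (L : ℕ),
      RowState H k l ε e lab L → (univ.filter fun ρ => lab ρ = 0).card = u →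
      b * L + m * u ≤ m * R →
      ∃ (e : Equiv.Perm (Fin R × Fin m)) (lab : Fin R → ℕ) (L : ℕ), RowState H k l ε e lab L ∧
        b * L ≤ m * R ∧ ((univ.filter fun ρ => lab ρ = 0).card : ℝ) < ζ * R := by
    intro u
    induction u using Nat.strong_induction_on with
    | _ u ih =>
      intro e lab L hs hu hL
      by_cases hz : ((univ.filter fun ρ => lab ρ = 0).card : ℝ) < ζ * R
      · exact ⟨e, lab, L, hs, by omega, hz⟩
      · obtain ⟨X, r, π, h1, h2, h3⟩ := hR₀ R hR H B hB hpat e _ (not_lt.1 hz)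
        obtain ⟨e', lab', hs', hc⟩ := hs.step hb h1 h2 h3
        refine ih _ (by omega) e' lab' (L + m) hs' rfl ?_
        have : m * ((univ.filter fun ρ => lab' ρ = 0).card + b) ≤ m * u :=
          Nat.mul_le_mul_left m (by omega)
        nlinarith
  refine key _ (Equiv.refl _) (fun _ => 0) 0 ⟨fun _ => le_rfl, fun i h1 h2 => by omega⟩ rfl ?_
  simp

end RowStateSteps

section RowStateCover

open Finset

theorem exists_pathOn_of_pattern {R m k l : ℕ} {H : Finset (Finset (Fin R × Fin m))}
    (e : Equiv.Perm (Fin R × Fin m)) {T : Finset (Fin R)} (hT : T.Nonempty)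
    {p q : Finset (Fin m)} (hp : p.card = k) (hq : q.card = k) (hpq : (p ∩ q).card = 2 * l)
    (h : ∀ x : Fin m → Fin R, (∀ j, x j ∈ T) →
      (p.image fun j => e (x j, j)) ∈ H ∧ (q.image fun j => e (x j, j)) ∈ H) :
    ∃ A B W, PathOn H k l A B W ∧ W ⊆ (T ×ˢ (p ∪ q)).image e ∧
      ((T ×ˢ (p ∪ q)).image e \ W).card ≤ k := by
  classical
  obtain ⟨S, hSs, hSc⟩ := exists_subset_card_eq (s := p ∩ q) (n := l) (by omega)
  set S' := (p ∩ q) \ S with hS'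
  have hS'c : S'.card = l := by rw [hS', card_sdiff_of_subset hSs]; omega
  have hIc : (p \ q).card = k - 2 * l := by
    have := card_sdiff_add_card_inter p q
    omega
  have hJc : (q \ p).card = k - 2 * l := by
    have := card_sdiff_add_card_inter q p
    rw [inter_comm] at this
    omega
  have hcard : 0 < T.card := card_pos.2 hT
  set ρ : ℕ → Fin R := fun c => if h : c < T.card then T.orderEmbOfFin rfl ⟨c, h⟩ else
    T.orderEmbOfFin rfl ⟨0, hcard⟩ with hρ
  have hρT : ∀ c, ρ c ∈ T := by
    intro c
    simp only [hρ]
    split_ifs <;> exact orderEmbOfFin_mem _ _ _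
  have hρi : ∀ c ≤ T.card - 1, ∀ c' ≤ T.card - 1, ρ c = ρ c' → c = c' := by
    intro c hc c' hc' hcc
    simp only [hρ, dif_pos (show c < T.card by omega), dif_pos (show c' < T.card by omega)] at hcc
    simpa using (T.orderEmbOfFin rfl).injective hcc
  have hρs : ∀ r ∈ T, ∃ c ≤ T.card - 1, ρ c = r := by
    intro r hr
    have h1 := range_orderEmbOfFin T rfl
    obtain ⟨c, rfl⟩ : r ∈ Set.range (T.orderEmbOfFin rfl) := by rw [h1]; exact hr
    refine ⟨c, by omega, ?_⟩
    simp only [hρ, dif_pos c.2]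
  have hSp : S ⊆ p := hSs.trans inter_subset_left
  have hSq : S ⊆ q := hSs.trans inter_subset_right
  have hS'p : S' ⊆ p := sdiff_subset.trans inter_subset_left
  have hS'q : S' ⊆ q := sdiff_subset.trans inter_subset_right
  have hunp : S ∪ p \ q ∪ S' = p := by
    ext v
    have := @hSs v
    simp only [hS', mem_union, mem_sdiff, mem_inter] at *
    tauto
  have hunq : S ∪ q \ p ∪ S' = q := by
    ext v
    have := @hSs v
    simp only [hS', mem_union, mem_sdiff, mem_inter] at *
    tauto
  have key := blowup_path (k := k) (l := l) (H := H) (S := S) (T := S') (I := p \ q)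
    (J := q \ p) hSc hS'c hIc hJc disjoint_sdiff
    (disjoint_sdiff.mono_left hSq) (disjoint_sdiff.mono_left hS'q)
    (disjoint_sdiff.mono_left hSp) (disjoint_sdiff.mono_left hS'p)
    disjoint_sdiff_sdiff
    (fun c j => e (ρ c, j)) (T.card - 1) ?_ ?_
  · refine ⟨_, _, _, key, ?_, ?_⟩
    · rw [hunp, union_sdiff_self_eq_union]
      refine union_subset (biUnion_subset.2 fun c _ => ?_) ?_
      · refine image_subset_iff.2 fun j hj => mem_image_of_mem e ?_
        exact mem_product.2 ⟨hρT c, hj⟩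
      · refine image_subset_iff.2 fun j hj => mem_image_of_mem e ?_
        exact mem_product.2 ⟨hρT _, mem_union_left _ hj⟩
    · rw [hunp, union_sdiff_self_eq_union]
      refine (card_le_card (t := (q \ p).image fun j => e (ρ (T.card - 1), j)) ?_).trans ?_
      · intro v hv
        rw [mem_sdiff, notMem_union] at hv
        obtain ⟨h1, h2, h3⟩ := hv
        obtain ⟨⟨r, j⟩, hrj, rfl⟩ := mem_image.1 h1
        rw [mem_product] at hrj
        obtain ⟨c, hc, hcr⟩ := hρs r hrj.1
        subst hcr
        have hcs : c = T.card - 1 := by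
          by_contra hne
          refine h2 (mem_biUnion.2 ⟨c, mem_range.2 (by omega), ?_⟩)
          exact mem_image.2 ⟨j, hrj.2, rfl⟩
        subst hcs
        refine mem_image.2 ⟨j, mem_sdiff.2 ⟨?_, fun hjp => h3 (mem_image.2 ⟨j, hjp, rfl⟩)⟩, rfl⟩
        rcases mem_union.1 hrj.2 with hj | hj
        · exact (h3 (mem_image.2 ⟨j, hj, rfl⟩)).elim
        · exact hj
      · exact card_image_le.trans (by omega)
  · intro c hc c' hc' j j' hjj
    have := e.injective hjj
    simp only [Prod.mk.injEq] at this
    exact ⟨hρi c hc c' hc' this.1, this.2⟩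
  · intro x _
    rw [hunp, hunq]
    exact h (fun j => ρ (x j)) fun j => hρT _

theorem RowState.exists_paths {R m k l L : ℕ} {ε ζ : ℝ}
    {H : Finset (Finset (Fin R × Fin m))} {e : Equiv.Perm (Fin R × Fin m)} {lab : Fin R → ℕ}
    (hε : 0 ≤ ε) (hs : RowState H k l ε e lab L)
    (hz : ((univ.filter fun ρ => lab ρ = 0).card : ℝ) ≤ ζ * R) :
    ∃ Ps : Finset (Finset (Fin R × Fin m)), (∀ W ∈ Ps, ∃ A B, PathOn H k l A B W) ∧
      (∀ W ∈ Ps, ∀ W' ∈ Ps, W ≠ W' → Disjoint W W') ∧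
      Ps.card ≤ L * Fintype.card (Finset (Fin m) × Finset (Fin m)) ∧
      ((univ \ Ps.biUnion id).card : ℝ) ≤ (ζ + ε) * (R * m) +
        k * (L * Fintype.card (Finset (Fin m) × Finset (Fin m)) : ℕ) := by
  classical
  have hpat : ∀ i, ∃ π : Finset (Finset (Fin m) × Finset (Fin m)), 1 ≤ i → i ≤ L →
      IsYPattern k l ε π ∧ ∀ p ∈ π, ∀ x : Fin m → Fin R, (∀ j, lab (x j) = i) →
        (p.1.image fun j => e (x j, j)) ∈ H ∧ (p.2.image fun j => e (x j, j)) ∈ H := by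
    intro i
    by_cases hi : 1 ≤ i ∧ i ≤ L
    · obtain ⟨π, h⟩ := hs.pat i hi.1 hi.2
      exact ⟨π, fun _ _ => h⟩
    · exact ⟨∅, fun h1 h2 => (hi ⟨h1, h2⟩).elim⟩
  choose π hπ using hpat
  set T : ℕ → Finset (Fin R) := fun i => univ.filter fun ρ => lab ρ = i with hT
  set Q : Finset (ℕ × (Finset (Fin m) × Finset (Fin m))) :=
    ((Icc 1 L) ×ˢ univ).filter fun q => q.2 ∈ π q.1 ∧ (T q.1).Nonempty with hQ
  have hQm : ∀ q ∈ Q, (1 ≤ q.1 ∧ q.1 ≤ L) ∧ q.2 ∈ π q.1 ∧ (T q.1).Nonempty := by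
    intro q hq
    obtain ⟨h1, h2⟩ := mem_filter.1 hq
    exact ⟨mem_Icc.1 (mem_product.1 h1).1, h2⟩
  set D : ℕ × (Finset (Fin m) × Finset (Fin m)) → Finset (Fin R × Fin m) := fun q =>
    (T q.1 ×ˢ (q.2.1 ∪ q.2.2)).image e with hD
  have hW : ∀ q, ∃ W, q ∈ Q → (∃ A B, PathOn H k l A B W) ∧ W ⊆ D q ∧ (D q \ W).card ≤ k := by
    intro q
    by_cases hq : q ∈ Q
    · obtain ⟨⟨h1, h2⟩, h3, h4⟩ := hQm q hq
      obtain ⟨g1, g2⟩ := hπ q.1 h1 h2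
      obtain ⟨A, B, W, h5, h6⟩ := exists_pathOn_of_pattern e h4 (g1.card_fst _ h3)
        (g1.card_snd _ h3) (g1.card_inter _ h3) fun x hx =>
          g2 _ h3 x fun j => (mem_filter.1 (hx j)).2
      exact ⟨W, fun _ => ⟨⟨A, B, h5⟩, h6⟩⟩
    · exact ⟨∅, fun h => (hq h).elim⟩
  choose W hW using hW
  have hQc : Q.card ≤ L * Fintype.card (Finset (Fin m) × Finset (Fin m)) := by
    refine (card_filter_le _ _).trans ?_
    rw [card_product, card_univ, Nat.card_Icc]
    simp
  have hDd : ∀ q ∈ Q, ∀ q' ∈ Q, q ≠ q' → Disjoint (D q) (D q') := by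
    intro q hq q' hq' hne
    refine (disjoint_image e.injective).2 ?_
    rw [disjoint_left]
    rintro ⟨ρ, j⟩ h1 h2
    rw [mem_product] at h1 h2
    have h3 : q.1 = q'.1 := (mem_filter.1 h1.1).2.symm.trans (mem_filter.1 h2.1).2
    obtain ⟨⟨a1, a2⟩, a3, -⟩ := hQm q hq
    obtain ⟨-, b3, -⟩ := hQm q' hq'
    rw [← h3] at b3
    refine disjoint_left.1 ((hπ q.1 a1 a2).1.disj _ a3 _ b3 fun h4 => hne ?_) h1.2 h2.2
    exact Prod.ext h3 h4
  refine ⟨Q.image W, ?_, ?_, card_image_le.trans hQc, ?_⟩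
  · intro V hV
    obtain ⟨q, hq, rfl⟩ := mem_image.1 hV
    exact (hW q hq).1
  · intro V hV V' hV' hne
    obtain ⟨q, hq, rfl⟩ := mem_image.1 hV
    obtain ⟨q', hq', rfl⟩ := mem_image.1 hV'
    exact (hDd q hq q' hq' fun h => hne (h ▸ rfl)).mono (hW q hq).2.1 (hW q' hq').2.1
  · set E : Fin R → Finset (Fin m) := fun ρ => if lab ρ = 0 then ∅ else
      univ \ (π (lab ρ)).biUnion fun p => p.1 ∪ p.2 with hE
    have hEc : ∀ ρ, ((E ρ).card : ℝ) ≤ ε * m := by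
      intro ρ
      simp only [hE]
      split_ifs with h0
      · simp only [card_empty, Nat.cast_zero]; positivity
      · have := (hπ (lab ρ) (by omega) (hs.le ρ)).1.cover
        rw [card_sdiff_of_subset (subset_univ _), card_univ, Fintype.card_fin, Nat.cast_sub]
        · exact this
        · exact (card_le_univ _).trans_eq (Fintype.card_fin m)
    have hsub : univ \ (Q.image W).biUnion id ⊆
        ((T 0 ×ˢ univ).image e ∪ univ.biUnion fun ρ => (E ρ).image fun j => e (ρ, j)) ∪
          Q.biUnion fun q => D q \ W q := by
      intro v hv
      obtain ⟨⟨ρ, j⟩, rfl⟩ := e.surjective v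
      have hv' : ∀ q ∈ Q, e (ρ, j) ∉ W q := fun q hq hm =>
        (mem_sdiff.1 hv).2 (mem_biUnion.2 ⟨W q, mem_image_of_mem _ hq, hm⟩)
      by_cases h0 : lab ρ = 0
      · refine mem_union_left _ (mem_union_left _ (mem_image_of_mem e ?_))
        simp [hT, h0]
      · by_cases hj : j ∈ (π (lab ρ)).biUnion fun p => p.1 ∪ p.2
        · obtain ⟨p, hp, hjp⟩ := mem_biUnion.1 hj
          have hρ : ρ ∈ T (lab ρ) := by simp [hT]
          have hq : (lab ρ, p) ∈ Q := mem_filter.2 ⟨mem_product.2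
            ⟨mem_Icc.2 ⟨by omega, hs.le ρ⟩, mem_univ _⟩, hp, ⟨ρ, hρ⟩⟩
          refine mem_union_right _ (mem_biUnion.2 ⟨_, hq, mem_sdiff.2 ⟨?_, hv' _ hq⟩⟩)
          exact mem_image_of_mem e (mem_product.2 ⟨hρ, hjp⟩)
        · refine mem_union_left _ (mem_union_right _ (mem_biUnion.2 ⟨ρ, mem_univ _, ?_⟩))
          refine mem_image.2 ⟨j, ?_, rfl⟩
          simp only [hE, if_neg h0]
          exact mem_sdiff.2 ⟨mem_univ _, hj⟩
    have h1 : (((T 0 ×ˢ (univ : Finset (Fin m))).image e).card : ℝ) ≤ ζ * R * m := by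
      have : ((T 0 ×ˢ (univ : Finset (Fin m))).image e).card ≤ (T 0).card * m := by
        refine card_image_le.trans_eq ?_
        rw [card_product, card_univ, Fintype.card_fin]
      calc (((T 0 ×ˢ (univ : Finset (Fin m))).image e).card : ℝ) ≤ (T 0).card * m := by
            exact_mod_cast this
        _ ≤ _ := by gcongr
    have h2 : ((univ.biUnion fun ρ => (E ρ).image fun j => e (ρ, j)).card : ℝ) ≤ R * (ε * m) := by
      calc ((univ.biUnion fun ρ => (E ρ).image fun j => e (ρ, j)).card : ℝ)
          ≤ ∑ ρ : Fin R, ((E ρ).card : ℝ) := by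
            exact_mod_cast card_biUnion_le.trans (sum_le_sum fun ρ _ => card_image_le)
        _ ≤ ∑ ρ : Fin R, ε * m := sum_le_sum fun ρ _ => hEc ρ
        _ = _ := by simp
    have h3 : ((Q.biUnion fun q => D q \ W q).card : ℝ) ≤
        k * (L * Fintype.card (Finset (Fin m) × Finset (Fin m)) : ℕ) := by
      have : (Q.biUnion fun q => D q \ W q).card ≤ Q.card * k :=
        card_biUnion_le_card_mul _ _ _ fun q hq => (hW q hq).2.2
      have h' : (Q.biUnion fun q => D q \ W q).card ≤
          k * (L * Fintype.card (Finset (Fin m) × Finset (Fin m))) :=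
        this.trans (by rw [mul_comm]; exact Nat.mul_le_mul_left k hQc)
      exact_mod_cast h'
    have h4 : ((univ \ (Q.image W).biUnion id).card : ℝ) ≤
        ((T 0 ×ˢ (univ : Finset (Fin m))).image e).card +
        (univ.biUnion fun ρ => (E ρ).image fun j => e (ρ, j)).card +
        (Q.biUnion fun q => D q \ W q).card := by
      have := (card_le_card hsub).trans ((card_union_le _ _).trans
        (Nat.add_le_add_right (card_union_le _ _) _))
      exact_mod_cast this
    linarith

end RowStateCover

section PathCover

open Finset

theorem exists_path_cover {k l : ℕ} (hlk : 2 * l < k) {t η μ : ℝ} (ht0 : 0 ≤ t) (hη : 0 < η)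
    (ht : ∀ ε : ℝ, 0 < ε → ∃ n₀ : ℕ, ∀ n ≥ n₀, ∀ H : Finset (Finset (Fin n)),
      DegDense k l t H → HasYTilingCover n l H (ε * n)) (hμ : 0 < μ) :
    ∃ m : ℕ, 1 ≤ m ∧ ∃ R₀ : ℕ, ∀ R ≥ R₀, ∀ H : Finset (Finset (Fin R × Fin m)),
      DegDense k l (t + η) H →
      ∃ Ps : Finset (Finset (Fin R × Fin m)), (∀ W ∈ Ps, ∃ A B, PathOn H k l A B W) ∧
        (∀ W ∈ Ps, ∀ W' ∈ Ps, W ≠ W' → Disjoint W W') ∧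
        (Ps.card : ℝ) ≤ μ * (R * m) ∧
        ((univ \ Ps.biUnion id).card : ℝ) ≤ μ * (R * m) := by
  classical
  obtain ⟨m₁, hm₁⟩ := sampling_mul k l (by omega) 0 hη (δ := μ / 4 / 4) (by positivity)
  obtain ⟨m₂, hm₂⟩ := ht (μ / 4) (by positivity)
  set m := m₁ + m₂ + 1 with hm
  have : NeZero m := ⟨by omega⟩
  obtain ⟨n₁, hn₁⟩ := hm₁ m (by omega)
  set κ := Fintype.card (Finset (Fin m) × Finset (Fin m)) with hκ
  obtain ⟨b, hb⟩ := exists_nat_gt ((2 * k + 2) * κ / μ)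
  obtain ⟨R₁, hR₁⟩ := exists_rowState (m := m) (k := k) (l := l) (b := b + 1) (ε := μ / 4)
    (ζ := μ / 4) (by positivity) (by omega)
  refine ⟨m, by omega, R₁ + n₁ + k + 1, fun R hR H hH => ?_⟩
  have hcV : Fintype.card (Fin R × Fin m) = R * m := by simp
  have hRm : R ≤ R * m := Nat.le_mul_of_pos_right R (by omega)
  have : Nonempty (Fin R × Fin m) := ⟨⟨⟨0, by omega⟩, ⟨0, by omega⟩⟩⟩
  obtain ⟨B, hB, hBx⟩ := hn₁ (Fin R × Fin m) (by rw [hcV]; omega) (t + η) H (by linarith)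
    (hH.le_one (by omega) (by rw [hcV]; omega)) hH ∅ (fun _ => Classical.arbitrary _)
    (by simp) (by simp)
  rw [hcV] at hB
  push_cast at hB
  obtain ⟨e, lab, L, hs, hL, hz⟩ := hR₁ R (by omega) H B hB fun x hx => by
    have h1 := (hBx x hx).2
    rw [piecewise_empty, add_sub_cancel_right] at h1
    obtain ⟨π, h2, h3⟩ := (hm₂ m (by omega) _ h1).exists_pattern fun e he => (mem_pullback.1 he).1
    exact ⟨π, h2, fun p hp => ⟨(mem_pullback.1 (h3 p hp).1).2, (mem_pullback.1 (h3 p hp).2).2⟩⟩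
  obtain ⟨Ps, h1, h2, h3, h4⟩ := hs.exists_paths (by positivity) hz.le
  have hRm0 : (0 : ℝ) ≤ R * m := by positivity
  have hLκ : (2 * k + 2) * ((L : ℝ) * κ) ≤ μ * (R * m) := by
    rw [div_lt_iff₀ hμ] at hb
    have h5 : ((b : ℝ) + 1) * L ≤ m * R := by exact_mod_cast hL
    have h6 : (0 : ℝ) ≤ L := by positivity
    nlinarith
  have hLκ0 : (0 : ℝ) ≤ L * κ := by positivity
  have hk0 : (0 : ℝ) ≤ k := by positivity
  refine ⟨Ps, h1, h2, ?_, h4.trans ?_⟩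
  · have : (Ps.card : ℝ) ≤ L * κ := by exact_mod_cast h3
    nlinarith [mul_nonneg hk0 hLκ0]
  · rw [← hκ]
    push_cast
    nlinarith

end PathCover

section Induced

open Finset

theorem DegDense.induce {V W : Type*} [Fintype V] [DecidableEq V] [Fintype W] [DecidableEq W]
    {k l : ℕ} (hlk : l < k) {d μ : ℝ} {H : Finset (Finset V)} (hH : DegDense k l d H)
    {f : W → V} (hf : Function.Injective f) (hV : 2 * (k - l) ≤ Fintype.card V)
    (hμ : (Fintype.card V : ℝ) - Fintype.card W ≤ μ * Fintype.card V) :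
    DegDense k l (d - μ * (2 * (k - l : ℕ)))
      ((univ : Finset (Finset W)).filter fun e => e.image f ∈ H) := by
  classical
  set r := k - l with hr
  refine ⟨fun e he => ?_, fun S hS => ?_⟩
  · rw [← hH.1 _ (mem_filter.1 he).2, card_image_of_injective _ hf]
  set D := univ \ univ.image f with hD
  have hWV : Fintype.card W ≤ Fintype.card V := Fintype.card_le_of_injective f hf
  have hDc : (D.card : ℝ) ≤ μ * Fintype.card V := by
    refine le_trans (le_of_eq ?_) hμ
    rw [hD, card_sdiff_of_subset (subset_univ _), card_image_of_injective _ hf, card_univ,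
      card_univ, Nat.cast_sub hWV]
  set S' := S.image f with hS'
  have hS'c : S'.card = l := by rw [hS', card_image_of_injective _ hf, hS]
  have hbad : ((H.filter (S' ⊆ ·)).filter fun e => ¬ Disjoint e D).card ≤
      D.card * (Fintype.card V).choose (r - 1) := by
    have hsub : (H.filter (S' ⊆ ·)).filter (fun e => ¬ Disjoint e D) ⊆
        D.biUnion fun v => (powersetCard (r - 1) univ).image fun T => insert v (S' ∪ T) := by
      intro e he
      obtain ⟨he, h2⟩ := mem_filter.1 he
      obtain ⟨heH, hSe⟩ := mem_filter.1 he
      obtain ⟨v, hve, hvD⟩ := not_disjoint_iff.1 h2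
      have hvS : v ∉ S' := fun hv => by
        obtain ⟨w, -, rfl⟩ := mem_image.1 hv
        exact (mem_sdiff.1 hvD).2 (mem_image_of_mem f (mem_univ w))
      have hsub : insert v S' ⊆ e := insert_subset hve hSe
      refine mem_biUnion.2 ⟨v, hvD, mem_image.2 ⟨e \ insert v S', ?_, ?_⟩⟩
      · rw [mem_powersetCard]
        refine ⟨subset_univ _, ?_⟩
        rw [card_sdiff_of_subset hsub, card_insert_of_notMem hvS, hS'c, hH.1 e heH]
        omega
      · rw [← insert_union, union_sdiff_of_subset hsub]
    refine (card_le_card hsub).trans (card_biUnion_le_card_mul _ _ _ fun v _ => ?_)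
    refine card_image_le.trans_eq ?_
    rw [card_powersetCard, card_univ]
  have hgood : ((H.filter (S' ⊆ ·)).filter fun e => Disjoint e D).card ≤
      (((univ : Finset (Finset W)).filter fun e => e.image f ∈ H).filter (S ⊆ ·)).card := by
    refine (card_le_card (t := ((((univ : Finset (Finset W)).filter fun e => e.image f ∈ H).filter
      (S ⊆ ·)).image fun e => e.image f)) ?_).trans card_image_le
    intro e he
    obtain ⟨he, h2⟩ := mem_filter.1 he
    obtain ⟨heH, hSe⟩ := mem_filter.1 he
    have he' : (univ.filter fun w => f w ∈ e).image f = e := by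
      ext v
      simp only [mem_image, mem_filter, mem_univ, true_and]
      refine ⟨fun ⟨w, h, h'⟩ => h' ▸ h, fun hv => ?_⟩
      have : v ∈ univ.image f := by
        by_contra hn
        exact disjoint_left.1 h2 hv (mem_sdiff.2 ⟨mem_univ _, hn⟩)
      obtain ⟨w, -, rfl⟩ := mem_image.1 this
      exact ⟨w, hv, rfl⟩
    refine mem_image.2 ⟨_, mem_filter.2 ⟨mem_filter.2 ⟨mem_univ _, ?_⟩, ?_⟩, he'⟩
    · rwa [he']
    · exact fun w hw => mem_filter.2 ⟨mem_univ _, hSe (mem_image_of_mem f hw)⟩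
  have hsum := card_filter_add_card_filter_not (s := H.filter (S' ⊆ ·)) fun e => Disjoint e D
  have h1 := hH.2 S' hS'c
  have h2 := choose_pred_mul (show 1 ≤ r by omega) hV
  have hμ0 : 0 ≤ μ * Fintype.card V := le_trans (by positivity) hDc
  set n : ℝ := (Fintype.card V : ℝ) with hn
  set C : ℝ := ((Fintype.card V).choose (r - 1) : ℝ) with hC
  set C' : ℝ := ((Fintype.card V).choose r : ℝ) with hC'
  have hn0 : 0 < n := by
    rw [hn]; exact_mod_cast (by omega : 0 < Fintype.card V)
  have hμ1 : 0 ≤ μ := nonneg_of_mul_nonneg_left hμ0 hn0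
  have hbad' : (((H.filter (S' ⊆ ·)).filter fun e => ¬ Disjoint e D).card : ℝ) ≤
      μ * (2 * r) * C' := by
    calc (((H.filter (S' ⊆ ·)).filter fun e => ¬ Disjoint e D).card : ℝ) ≤ D.card * C := by
          rw [hC]; exact_mod_cast hbad
      _ ≤ μ * n * C := by gcongr
      _ = μ * (n * C) := by ring
      _ ≤ μ * (2 * r * C') := by gcongr
      _ = _ := by ring
  have hgood' : (d - μ * (2 * r)) * C' ≤
      ((((univ : Finset (Finset W)).filter fun e => e.image f ∈ H).filter (S ⊆ ·)).card : ℝ) := by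
    have h3 : ((H.filter (S' ⊆ ·)).card : ℝ) ≤
        ((((univ : Finset (Finset W)).filter fun e => e.image f ∈ H).filter (S ⊆ ·)).card : ℝ) +
          ((H.filter (S' ⊆ ·)).filter fun e => ¬ Disjoint e D).card := by
      exact_mod_cast (by omega)
    linarith
  by_cases hneg : 0 ≤ d - μ * (2 * r)
  · refine le_trans ?_ hgood'
    refine mul_le_mul_of_nonneg_left ?_ hneg
    rw [hC']
    exact_mod_cast Nat.choose_le_choose r hWV
  · exact (mul_nonpos_of_nonpos_of_nonneg (not_le.1 hneg).le (by positivity)).trans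
      (by positivity)

end Induced

section PathCoverAvoiding

open Finset

theorem exists_path_cover_avoiding {k l : ℕ} (hlk : 2 * l < k) {t η : ℝ} (ht0 : 0 ≤ t)
    (hη : 0 < η)
    (ht : ∀ ε : ℝ, 0 < ε → ∃ n₀ : ℕ, ∀ n ≥ n₀, ∀ H : Finset (Finset (Fin n)),
      DegDense k l t H → HasYTilingCover n l H (ε * n)) :
    ∃ σ : ℝ, 0 < σ ∧ ∀ μ : ℝ, 0 < μ → ∃ n₀ : ℕ, ∀ n ≥ n₀, ∀ H : Finset (Finset (Fin n)),
      DegDense k l (t + η) H → ∀ Z : Finset (Fin n), (Z.card : ℝ) ≤ σ * n →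
      ∃ Ps : Finset (Finset (Fin n)), (∀ W ∈ Ps, ∃ A B, PathOn H k l A B W) ∧
        (∀ W ∈ Ps, ∀ W' ∈ Ps, W ≠ W' → Disjoint W W') ∧ (∀ W ∈ Ps, Disjoint W Z) ∧
        (Ps.card : ℝ) ≤ μ * n ∧ ((univ \ (Z ∪ Ps.biUnion id)).card : ℝ) ≤ μ * n := by
  classical
  set r := k - l with hr
  have hr0 : (0 : ℝ) < r := by exact_mod_cast (by omega : 0 < r)
  set σ : ℝ := min (η / (8 * r)) (1 / 2) with hσ
  have hσ0 : 0 < σ := lt_min (by positivity) (by norm_num)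
  have hσr : σ * (8 * r) ≤ η := by
    have : σ ≤ η / (8 * r) := min_le_left _ _
    rwa [le_div_iff₀ (by positivity)] at this
  have hσ2 : σ ≤ 1 / 2 := min_le_right _ _
  refine ⟨σ, hσ0, fun μ hμ => ?_⟩
  obtain ⟨m, hm1, R₀, hR₀⟩ := exists_path_cover hlk ht0 (half_pos hη) ht (half_pos hμ)
  obtain ⟨n₁, hn₁⟩ := exists_nat_gt (m / σ)
  obtain ⟨n₂, hn₂⟩ := exists_nat_gt (m / (μ / 2))
  refine ⟨n₁ + n₂ + 2 * (R₀ * m + m) + 2 * r, fun n hn H hH Z hZ => ?_⟩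
  rw [div_lt_iff₀ hσ0] at hn₁
  rw [div_lt_iff₀ (by positivity)] at hn₂
  have hn₁' : (n₁ : ℝ) ≤ n := by exact_mod_cast (by omega : n₁ ≤ n)
  have hn₂' : (n₂ : ℝ) ≤ n := by exact_mod_cast (by omega : n₂ ≤ n)
  set N := (univ \ Z).card with hN
  have hNZ : N + Z.card = n := by
    rw [hN, card_sdiff_add_card_eq_card (subset_univ _), card_univ, Fintype.card_fin]
  have hNr : (N : ℝ) + Z.card = n := by exact_mod_cast hNZ
  set R := N / m with hR
  have hdm : m * R + N % m = N := Nat.div_add_mod N m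
  have hmod : N % m < m := Nat.mod_lt _ (by omega)
  have hnn : 2 * (R₀ * m + m) ≤ n := by omega
  have hN2 : R₀ * m + m ≤ N := by
    have h1 : (2 * (R₀ * m + m) : ℝ) ≤ n := by exact_mod_cast hnn
    have h2 : ((R₀ * m + m : ℕ) : ℝ) ≤ N := by push_cast; nlinarith
    exact_mod_cast h2
  have hRR : R₀ ≤ R := by
    rw [hR, Nat.le_div_iff_mul_le (by omega)]
    omega
  have hRm : R * m ≤ N := by rw [mul_comm]; omega
  have hRm' : N ≤ R * m + m := by rw [mul_comm]; omega
  have hRmr : ((R : ℝ) * m) ≤ N := by exact_mod_cast hRm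
  have hRmr' : (N : ℝ) ≤ (R : ℝ) * m + m := by exact_mod_cast hRm'
  obtain ⟨g⟩ : Nonempty ((Fin R × Fin m) ↪ ↥(univ \ Z)) :=
    Function.Embedding.nonempty_of_card_le (by
      rw [Fintype.card_coe, Fintype.card_prod, Fintype.card_fin, Fintype.card_fin]
      exact hRm)
  set f : Fin R × Fin m → Fin n := fun x => (g x : Fin n) with hf
  have hfi : Function.Injective f := Subtype.val_injective.comp g.injective
  have hfZ : ∀ x, f x ∉ Z := fun x => (mem_sdiff.1 (g x).2).2
  have hcn : (Fintype.card (Fin n) : ℝ) = n := by simp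
  have hcw : (Fintype.card (Fin R × Fin m) : ℝ) = R * m := by simp
  have hind := hH.induce (by omega) hfi (μ := 2 * σ) (by simp; omega) (by
    rw [hcn, hcw]
    nlinarith)
  obtain ⟨Ps, h1, h2, h3, h4⟩ := hR₀ R hRR _ (hind.mono (by rw [← hr]; linarith))
  have hZf : ∀ W : Finset (Fin R × Fin m), Disjoint (W.image f) Z := by
    intro W
    rw [disjoint_left]
    intro v hv
    obtain ⟨x, -, rfl⟩ := mem_image.1 hv
    exact hfZ x
  refine ⟨Ps.image fun W => W.image f, ?_, ?_, ?_, ?_, ?_⟩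
  · intro W hW
    obtain ⟨U, hU, rfl⟩ := mem_image.1 hW
    obtain ⟨A, B, h⟩ := h1 U hU
    exact ⟨_, _, h.map hfi fun e he => (mem_filter.1 he).2⟩
  · intro W hW W' hW' hne
    obtain ⟨U, hU, rfl⟩ := mem_image.1 hW
    obtain ⟨U', hU', rfl⟩ := mem_image.1 hW'
    exact (disjoint_image hfi).2 (h2 U hU U' hU' fun h => hne (h ▸ rfl))
  · intro W hW
    obtain ⟨U, hU, rfl⟩ := mem_image.1 hW
    exact hZf U
  · have h5 : ((Ps.image fun W => W.image f).card : ℝ) ≤ Ps.card := by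
      exact_mod_cast card_image_le
    nlinarith [(by positivity : (0 : ℝ) ≤ Z.card)]
  · have hsub : univ \ (Z ∪ (Ps.image fun W => W.image f).biUnion id) ⊆
        ((univ \ Z) \ univ.image f) ∪ (univ \ Ps.biUnion id).image f := by
      intro v hv
      obtain ⟨-, hv⟩ := mem_sdiff.1 hv
      rw [notMem_union] at hv
      by_cases hvf : v ∈ univ.image f
      · obtain ⟨x, -, rfl⟩ := mem_image.1 hvf
        refine mem_union_right _ (mem_image_of_mem f (mem_sdiff.2 ⟨mem_univ _, fun hx => ?_⟩))
        obtain ⟨W, hW, hxW⟩ := mem_biUnion.1 hx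
        exact hv.2 (mem_biUnion.2 ⟨_, mem_image_of_mem _ hW, mem_image_of_mem f hxW⟩)
      · exact mem_union_left _ (mem_sdiff.2 ⟨mem_sdiff.2 ⟨mem_univ _, hv.1⟩, hvf⟩)
    have h6 : ((univ \ Z) \ univ.image f).card + R * m = N := by
      have hs : univ.image f ⊆ univ \ Z := fun v hv => by
        obtain ⟨x, -, rfl⟩ := mem_image.1 hv
        exact mem_sdiff.2 ⟨mem_univ _, hfZ x⟩
      have := card_sdiff_add_card_eq_card hs
      rw [card_image_of_injective _ hfi, card_univ] at this
      simpa using this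
    have h7 : (univ \ (Z ∪ (Ps.image fun W => W.image f).biUnion id)).card ≤
        m + (univ \ Ps.biUnion id).card := by
      refine (card_le_card hsub).trans ((card_union_le _ _).trans ?_)
      exact Nat.add_le_add (by omega) card_image_le
    have h8 : ((univ \ (Z ∪ (Ps.image fun W => W.image f).biUnion id)).card : ℝ) ≤
        m + (univ \ Ps.biUnion id).card := by exact_mod_cast h7
    nlinarith [(by positivity : (0 : ℝ) ≤ Z.card)]

end PathCoverAvoiding

section Chains

open Finset

variable {α : Type*} [DecidableEq α] {H : Finset (Finset α)} {k l : ℕ}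

/-- Any two disjoint `l`-sets can be joined by a two-edge path inside `Y`, avoiding any `q`
vertices. -/
def ConnIn (H : Finset (Finset α)) (k l q : ℕ) (Y : Finset α) : Prop :=
  ∀ A B Z : Finset α, A.card = l → B.card = l → Disjoint A B → Z.card ≤ q →
    ∃ X ⊆ Y, X.card = 2 * k - 3 * l ∧ Disjoint X Z ∧ LP H k l A X B

theorem ConnIn.chain {ι : Type*} [DecidableEq ι] {q : ℕ} {Y : Finset α} (hY : ConnIn H k l q Y)
    {A B F : ι → Finset α} {I : Finset ι} (hI : I.Nonempty)
    (hA : ∀ i ∈ I, (A i).card = l) (hB : ∀ i ∈ I, (B i).card = l)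
    (hAF : ∀ i ∈ I, A i ⊆ F i) (hBF : ∀ i ∈ I, B i ⊆ F i)
    (hF : ∀ i ∈ I, ∀ j ∈ I, i ≠ j → Disjoint (F i) (F j))
    (hq : I.card * (2 * k - 3 * l) ≤ q) :
    ∃ i ∈ I, ∃ j ∈ I, ∃ R ⊆ Y, R.card ≤ I.card * (2 * k - 3 * l) ∧
      ∀ W : ι → Finset α, (∀ i ∈ I, PathOn H k l (A i) (B i) (W i)) →
        (∀ i ∈ I, ∀ j ∈ I, i ≠ j → Disjoint (W i) (W j)) → (∀ i ∈ I, Disjoint (W i) R) →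
        PathOn H k l (A i) (B j) (I.biUnion W ∪ R) := by
  induction hI using Finset.Nonempty.cons_induction with
  | singleton i =>
    refine ⟨i, mem_singleton_self i, i, mem_singleton_self i, ∅, empty_subset _, by simp, ?_⟩
    intro W hW _ _
    simpa using hW i (mem_singleton_self i)
  | cons i s hi hs ih =>
    have hmem : ∀ j ∈ s, j ∈ cons i s hi := fun j hj => mem_cons_of_mem hj
    have hii : i ∈ cons i s hi := mem_cons_self i s
    rw [card_cons, add_mul, one_mul] at hq
    obtain ⟨j, hj, j', hj', R, hRY, hRc, hR⟩ := ih (fun j hj => hA j (hmem j hj))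
      (fun j hj => hB j (hmem j hj)) (fun j hj => hAF j (hmem j hj))
      (fun j hj => hBF j (hmem j hj)) (fun j hj j' hj' => hF j (hmem j hj) j' (hmem j' hj'))
      (by omega)
    have hne : ∀ j ∈ s, i ≠ j := fun j hj h => hi (h ▸ hj)
    obtain ⟨X, hXY, hXc, hXR, hX⟩ := hY (B i) (A j) R (hB i hii) (hA j (hmem j hj))
      ((hF i hii j (hmem j hj) (hne j hj)).mono (hBF i hii) (hAF j (hmem j hj))) (by omega)
    refine ⟨i, hii, j', hmem j' hj', R ∪ X, union_subset hRY hXY, ?_, ?_⟩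
    · rw [card_cons, add_mul, one_mul]
      exact (card_union_le _ _).trans (by omega)
    · intro W hW hWd hWR
      have hWR' : ∀ a ∈ cons i s hi, Disjoint (W a) R ∧ Disjoint (W a) X := fun a ha =>
        disjoint_union_right.1 (hWR a ha)
      have h1 := hR W (fun j hj => hW j (hmem j hj))
        (fun j hj j' hj' => hWd j (hmem j hj) j' (hmem j' hj')) fun j hj => (hWR' j (hmem j hj)).1
      have h2 := (hW i hii).join h1 hX ?_ (hWR' i hii).2 ?_
      · rw [cons_eq_insert, biUnion_insert]
        convert h2 using 1
        ac_rfl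
      · refine disjoint_union_right.2 ⟨?_, (hWR' i hii).1⟩
        exact (disjoint_biUnion_right _ _ _).2 fun j hj => hWd i hii j (hmem j hj) (hne j hj)
      · refine disjoint_union_left.2 ⟨?_, hXR.symm⟩
        exact (disjoint_biUnion_left _ _ _).2 fun j hj => (hWR' j (hmem j hj)).2

theorem exists_absorption {M : ℕ} {A X B : Fin M → Finset α} {I : Finset (Fin M)} {q : ℕ}
    (hI : ∀ i ∈ I, LP H k l (A i) (X i) (B i))
    (hJ : ∀ S : Finset α, S.card = k - l → ∃ J ⊆ I, q ≤ J.card ∧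
      ∀ j ∈ J, LP H k l (A j) (X j ∪ S) (B j)) (t : ℕ) (ht : t ≤ q) :
    ∀ D : Finset α, D.card = (k - l) * t → ∃ (E : Fin M → Finset α) (U : Finset (Fin M)),
      U.card ≤ t ∧ (∀ i ∉ U, E i = ∅) ∧ (∀ i j, i ≠ j → Disjoint (E i) (E j)) ∧
      I.biUnion E = D ∧ ∀ i ∈ I, LP H k l (A i) (X i ∪ E i) (B i) := by
  induction t with
  | zero =>
    intro D hD
    refine ⟨fun _ => ∅, ∅, by simp, by simp, by simp, ?_, fun i hi => by simpa using hI i hi⟩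
    rw [card_eq_zero.1 (hD.trans (mul_zero _))]
    ext
    simp
  | succ t ih =>
    intro D hD
    rw [mul_add, mul_one] at hD
    obtain ⟨S, hSD, hSc⟩ := exists_subset_card_eq (s := D) (n := k - l) (by omega)
    obtain ⟨E, U, h1, h2, h3, h4, h5⟩ := ih (by omega) (D \ S) (by
      rw [card_sdiff_of_subset hSD]; omega)
    obtain ⟨J, hJI, hJc, hJp⟩ := hJ S hSc
    obtain ⟨j, hjJ, hjU⟩ := exists_mem_notMem_of_card_lt_card (s := U) (t := J) (by omega)
    have hSE : ∀ i ∈ I, Disjoint S (E i) := fun i hi => by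
      have : E i ⊆ D \ S := h4 ▸ subset_biUnion_of_mem E hi
      exact disjoint_sdiff.mono_right this
    refine ⟨fun i => if i ∈ I then Function.update E j S i else ∅, insert j U,
      (card_insert_le _ _).trans (by omega), ?_, ?_, ?_, ?_⟩
    · intro i hi
      rw [mem_insert, not_or] at hi
      dsimp only
      rw [Function.update_of_ne hi.1, h2 i hi.2, ite_self]
    · intro i i' hii
      dsimp only
      split_ifs with hi hi'
      · by_cases hij : i = j
        · subst hij
          rw [Function.update_self, Function.update_of_ne hii.symm]
          exact hSE i' hi'
        · by_cases hij' : i' = j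
          · subst hij'
            rw [Function.update_self, Function.update_of_ne hij]
            exact (hSE i hi).symm
          · rw [Function.update_of_ne hij, Function.update_of_ne hij']
            exact h3 i i' hii
      all_goals simp
    · ext v
      simp only [mem_biUnion]
      constructor
      · rintro ⟨i, hi, hv⟩
        rw [if_pos hi] at hv
        by_cases hij : i = j
        · subst hij
          rw [Function.update_self] at hv
          exact hSD hv
        · rw [Function.update_of_ne hij] at hv
          have : v ∈ D \ S := h4 ▸ mem_biUnion.2 ⟨i, hi, hv⟩
          exact sdiff_subset this
      · intro hv
        by_cases hvS : v ∈ S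
        · exact ⟨j, hJI hjJ, by rw [if_pos (hJI hjJ), Function.update_self]; exact hvS⟩
        · have : v ∈ I.biUnion E := by rw [h4]; exact mem_sdiff.2 ⟨hv, hvS⟩
          obtain ⟨i, hi, hvi⟩ := mem_biUnion.1 this
          refine ⟨i, hi, ?_⟩
          have hij : i ≠ j := by
            rintro rfl
            rw [h2 i hjU] at hvi
            simp at hvi
          rw [if_pos hi, Function.update_of_ne hij]
          exact hvi
    · intro i hi
      dsimp only
      rw [if_pos hi]
      by_cases hij : i = j
      · subst hij
        rw [Function.update_self]
        exact hJp i hjJ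
      · rw [Function.update_of_ne hij]
        exact h5 i hi

end Chains

section AbsorbingPath

open Finset

theorem exists_absorbing_path {k l : ℕ} (hl : 2 ≤ l) (hlk : 2 * l < k) {η ρ : ℝ} (hη : 0 < η)
    (hρ : 0 < ρ) :
    ∃ a : ℝ, 0 < a ∧ ∃ n₀ : ℕ, ∀ n ≥ n₀, ∀ H : Finset (Finset (Fin n)),
      DegDense k l (((1 : ℝ) / 2) ^ (((k - l : ℕ) : ℝ) / l) + η) H →
      ∃ A B P : Finset (Fin n), (P.card : ℝ) ≤ ρ * n ∧
        ∀ D, Disjoint D P → (k - l) ∣ D.card → (D.card : ℝ) ≤ a * n →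
          PathOn H k l A B (P ∪ D) := by
  classical
  obtain ⟨c, hc, n₁, hn₁⟩ := exists_connector (by omega) hlk hη
  set γ : ℝ := min ρ (c / 2) / (2 * k + 1) with hγ
  have hk0 : (0 : ℝ) < 2 * k + 1 := by positivity
  have hγ0 : 0 < γ := div_pos (lt_min hρ (by positivity)) hk0
  have hγm : γ * (2 * k + 1) = min ρ (c / 2) := div_mul_cancel₀ _ hk0.ne'
  have hγρ : γ * (2 * k + 1) ≤ ρ := hγm ▸ min_le_left _ _
  have hγc : γ * (2 * k + 1) ≤ c / 2 := hγm ▸ min_le_right _ _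
  obtain ⟨a, ha, n₂, m, hn₂⟩ := exists_absorber_family hl hlk hη hγ0
  refine ⟨a, ha, n₁ + n₂ + k + 1, fun n hn H hH => ?_⟩
  have hn0 : (0 : ℝ) < n := by exact_mod_cast (by omega : 0 < n)
  obtain ⟨M, A, X, B, I, hM, h1, h2, h3, h4⟩ := hn₂ n (by omega) H hH
  set F : Fin M → Finset (Fin n) := fun i => A i ∪ X i ∪ B i with hF
  have hAF : ∀ i ∈ I, A i ⊆ F i := fun i _ => subset_union_left.trans subset_union_left
  have hBF : ∀ i ∈ I, B i ⊆ F i := fun i _ => subset_union_right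
  have hIne : I.Nonempty := by
    obtain ⟨S, -, hS⟩ := exists_subset_card_eq (s := (univ : Finset (Fin n))) (n := k - l)
      (by rw [card_univ, Fintype.card_fin]; omega)
    obtain ⟨J, hJI, hJ, -⟩ := h4 S hS
    have h5 : (0 : ℝ) < J.card := lt_of_lt_of_le (by positivity) hJ
    exact (card_pos.1 (by exact_mod_cast h5)).mono hJI
  set U := I.biUnion F with hU
  have hUc : (U.card : ℝ) ≤ γ * n := by
    refine le_trans ?_ hM
    have h5 : U.card ≤ M * m := (card_biUnion_le_card_mul _ _ _ h2).trans
      (Nat.mul_le_mul_right m ((card_le_univ I).trans_eq (Fintype.card_fin M)))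
    rw [mul_comm]
    exact_mod_cast h5
  have hIU : I.card ≤ U.card := by
    rw [hU, card_biUnion h3, card_eq_sum_ones]
    refine sum_le_sum fun i hi => ?_
    have := card_le_card (hAF i hi)
    rw [(h1 i hi).cardA] at this
    exact le_trans (by omega) this
  have hIUr : (I.card : ℝ) ≤ U.card := by exact_mod_cast hIU
  set d := 2 * k - 3 * l with hd
  have hdk : (d : ℝ) ≤ 2 * k := by exact_mod_cast (by omega : d ≤ 2 * k)
  have hd0 : (0 : ℝ) ≤ d := by positivity
  have hId : (I.card : ℝ) * d ≤ γ * n * (2 * k) := by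
    have := hIUr.trans hUc
    gcongr
  have hconn : ConnIn H k l (I.card * d) (univ \ U) := by
    intro A' B' Z hA' hB' hAB hZ
    obtain ⟨X', hX', hXZ, hLP⟩ := hn₁ n (by omega) H hH A' B' (Z ∪ U) hA' hB' hAB (by
      have h5 : ((Z ∪ U).card : ℝ) ≤ Z.card + U.card := by exact_mod_cast card_union_le _ _
      have h6 : (Z.card : ℝ) ≤ I.card * d := by exact_mod_cast hZ
      nlinarith)
    rw [disjoint_union_right] at hXZ
    exact ⟨X', subset_sdiff.2 ⟨subset_univ _, hXZ.2⟩, hX', hXZ.1, hLP⟩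
  obtain ⟨i, -, j, -, R, hRU, hRc, hR⟩ := hconn.chain hIne (fun i hi => (h1 i hi).cardA)
    (fun i hi => (h1 i hi).cardB) hAF hBF h3 le_rfl
  have hRU' : Disjoint R U := (subset_sdiff.1 hRU).2
  refine ⟨A i, B j, U ∪ R, ?_, fun D hD hdvd hDc => ?_⟩
  · have h5 : ((U ∪ R).card : ℝ) ≤ U.card + R.card := by exact_mod_cast card_union_le _ _
    have h6 : (R.card : ℝ) ≤ I.card * d := by exact_mod_cast hRc
    nlinarith
  · rw [disjoint_union_right] at hD
    obtain ⟨t, ht⟩ := hdvd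
    have ht' : t ≤ ⌈a * n⌉₊ := by
      have h5 : D.card ≤ ⌈a * n⌉₊ := by exact_mod_cast hDc.trans (Nat.le_ceil _)
      exact (Nat.le_mul_of_pos_left t (by omega)).trans (ht ▸ h5)
    obtain ⟨E, -, -, -, hEd, hED, hE⟩ := exists_absorption (q := ⌈a * n⌉₊) h1 (fun S hS => by
      obtain ⟨J, hJ, hJc, hJS⟩ := h4 S hS
      exact ⟨J, hJ, Nat.ceil_le.2 hJc, hJS⟩) t ht' D ht
    have hEsub : ∀ i ∈ I, E i ⊆ D := fun i hi => hED ▸ subset_biUnion_of_mem E hi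
    have hFU : ∀ i ∈ I, F i ⊆ U := fun i hi => subset_biUnion_of_mem F hi
    have key := hR (fun i => F i ∪ E i) (fun i hi => ⟨X i ∪ E i, hE i hi, by
      simp only [hF]; ac_rfl⟩) ?_ ?_
    · convert key using 1
      have : I.biUnion (fun i => F i ∪ E i) = U ∪ D := by
        rw [← hED, hU]
        ext v
        simp only [mem_biUnion, mem_union]
        grind
      rw [this]
      ac_rfl
    · intro i hi j hj hij
      simp only [disjoint_union_left, disjoint_union_right]
      exact ⟨⟨h3 i hi j hj hij, hD.1.mono (hEsub i hi) (hFU j hj)⟩,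
        (hD.1.mono (hEsub j hj) (hFU i hi)).symm, hEd i j hij⟩
    · intro i hi
      exact disjoint_union_left.2 ⟨hRU'.symm.mono_left (hFU i hi),
        hD.2.mono_left (hEsub i hi)⟩

end AbsorbingPath

section Assembly

open Finset

theorem LP.card_union_dvd {α : Type*} [DecidableEq α] {H : Finset (Finset α)} {k l : ℕ}
    {A B Y W : Finset α} (hlk : 2 * l < k) (h : PathOn H k l A B W) (h' : LP H k l B Y A)
    (hd : Disjoint W Y) : (k - l) ∣ (W ∪ Y).card := by
  obtain ⟨X, hX, rfl⟩ := h
  rw [card_union_of_disjoint hd, card_union_of_disjoint (disjoint_union_left.2 ⟨hX.dAB, hX.dXB⟩),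
    card_union_of_disjoint hX.dAX, hX.cardA, hX.cardB]
  rw [show l + X.card + l + Y.card = X.card + l + (Y.card + l) by omega]
  exact dvd_add (hX.dvd hlk) (h'.dvd hlk)

theorem exists_hasHamiltonCycle_of_degDense {k l : ℕ} (hl : 2 ≤ l) (hlk : 2 * l < k) {t η : ℝ}
    (ht0 : 0 ≤ t) (hη : 0 < η)
    (ht : ∀ ε : ℝ, 0 < ε → ∃ n₀ : ℕ, ∀ n ≥ n₀, ∀ H : Finset (Finset (Fin n)),
      DegDense k l t H → HasYTilingCover n l H (ε * n)) :
    ∃ n₀ : ℕ, ∀ n ≥ n₀, (k - l) ∣ n → ∀ H : Finset (Finset (Fin n)),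
      DegDense k l (((1 : ℝ) / 2) ^ (((k - l : ℕ) : ℝ) / l) + η) H → DegDense k l (t + η) H →
      HasHamiltonCycle n k l H := by
  classical
  obtain ⟨σ, hσ, hcover⟩ := exists_path_cover_avoiding hlk ht0 hη ht
  obtain ⟨ρ, hρ, hres⟩ := exists_reservoir (by omega) hlk hη
  obtain ⟨a, ha, n₁, habs⟩ := exists_absorbing_path hl hlk hη
    (ρ := min ρ (σ / 2)) (lt_min hρ (by positivity))
  obtain ⟨c, hc, n₂, hres⟩ := hres (min (a / 2) (σ / 2)) (lt_min (by positivity) (by positivity))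
  have hk0 : (0 : ℝ) < 2 * k + 1 := by positivity
  set μ : ℝ := min (a / 2) (c / 2 / (2 * k + 1)) with hμ
  have hμ0 : 0 < μ := lt_min (by positivity) (by positivity)
  have hμa : μ ≤ a / 2 := min_le_left _ _
  have hμc : μ * (2 * k + 1) ≤ c / 2 := by
    have : μ ≤ c / 2 / (2 * k + 1) := min_le_right _ _
    rwa [le_div_iff₀ hk0] at this
  obtain ⟨n₃, hcover⟩ := hcover μ hμ0
  obtain ⟨n₄, hn₄⟩ := exists_nat_gt (2 * k / (c / 2))
  rw [div_lt_iff₀ (by positivity)] at hn₄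
  refine ⟨n₁ + n₂ + n₃ + n₄ + 1, fun n hn hdvd H hH hH' => ?_⟩
  have hn0 : (0 : ℝ) < n := by exact_mod_cast (by omega : 0 < n)
  have hn₄' : (n₄ : ℝ) ≤ n := by exact_mod_cast (by omega : n₄ ≤ n)
  obtain ⟨A₀, B₀, P, hP, habs⟩ := habs n (by omega) H hH
  obtain ⟨Y, hYP, hY, hYc⟩ := hres n (by omega) H hH P
    (hP.trans (mul_le_mul_of_nonneg_right (min_le_left _ _) hn0.le))
  have hPσ : (P.card : ℝ) ≤ σ / 2 * n :=
    hP.trans (mul_le_mul_of_nonneg_right (min_le_right _ _) hn0.le)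
  have hYσ : (Y.card : ℝ) ≤ σ / 2 * n :=
    hY.trans (mul_le_mul_of_nonneg_right (min_le_right _ _) hn0.le)
  have hYa : (Y.card : ℝ) ≤ a / 2 * n :=
    hY.trans (mul_le_mul_of_nonneg_right (min_le_left _ _) hn0.le)
  obtain ⟨Ps, h1, h2, h3, h4, h5⟩ := hcover n (by omega) H hH' (P ∪ Y) (by
    have : ((P ∪ Y).card : ℝ) ≤ P.card + Y.card := by exact_mod_cast card_union_le _ _
    linarith)
  set Q := Ps.biUnion id with hQ
  have hQZ : Disjoint Q (P ∪ Y) := (disjoint_biUnion_left _ _ _).2 h3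
  rw [disjoint_union_right] at hQZ
  have hPsQ : ∀ W ∈ Ps, W ⊆ Q := fun W hW => subset_biUnion_of_mem id hW
  have hends : ∀ W, ∃ A B, W ∈ Ps → PathOn H k l A B W := by
    intro W
    by_cases hW : W ∈ Ps
    · obtain ⟨A, B, h⟩ := h1 W hW
      exact ⟨A, B, fun _ => h⟩
    · exact ⟨∅, ∅, fun h => (hW h).elim⟩
  choose A' B' hends using hends
  have hP0 : PathOn H k l A₀ B₀ P := by
    have := habs ∅ (disjoint_empty_left _) (by simp) (by
      rw [card_empty, Nat.cast_zero]; positivity)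
    rwa [union_empty] at this
  set A : Option (Finset (Fin n)) → Finset (Fin n) := fun o => o.elim A₀ A' with hA
  set B : Option (Finset (Fin n)) → Finset (Fin n) := fun o => o.elim B₀ B' with hB
  set F : Finset (Fin n) → Option (Finset (Fin n)) → Finset (Fin n) :=
    fun D o => o.elim (P ∪ D) id with hF
  set I := insertNone Ps with hI
  have hIc : I.card = Ps.card + 1 := card_insertNone Ps
  have hsome : ∀ W, some W ∈ I → W ∈ Ps := fun W hW => some_mem_insertNone.1 hW
  have hpath : ∀ D, PathOn H k l A₀ B₀ (P ∪ D) → ∀ o ∈ I, PathOn H k l (A o) (B o) (F D o) := by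
    rintro D hD (_ | W) hW
    · exact hD
    · exact hends W (hsome W hW)
  have hdisj : ∀ D, Disjoint D Q → ∀ o ∈ I, ∀ o' ∈ I, o ≠ o' → Disjoint (F D o) (F D o') := by
    rintro D hD (_ | W) hW (_ | W') hW' hne
    · exact (hne rfl).elim
    · exact (disjoint_union_left.2 ⟨hQZ.1.symm, hD⟩).mono_right (hPsQ W' (hsome W' hW'))
    · exact ((disjoint_union_left.2 ⟨hQZ.1.symm, hD⟩).mono_right (hPsQ W (hsome W hW))).symm
    · exact h2 W (hsome W hW) W' (hsome W' hW') fun h => hne (h ▸ rfl)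
  have hFR : ∀ D R, R ⊆ Y → Disjoint D R → ∀ o ∈ I, Disjoint (F D o) R := by
    rintro D R hR hD (_ | W) hW
    · exact disjoint_union_left.2 ⟨hYP.symm.mono_right hR, hD⟩
    · exact hQZ.2.mono (hPsQ W (hsome W hW)) hR
  have hFU : ∀ D, I.biUnion (F D) = P ∪ D ∪ Q := by
    intro D
    ext v
    simp only [mem_biUnion, mem_union, hQ, hF, hI]
    constructor
    · rintro ⟨_ | W, hW, hv⟩
      · exact Or.inl (mem_union.1 hv)
      · exact Or.inr ⟨W, hsome W hW, hv⟩
    · rintro (hv | ⟨W, hW, hv⟩)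
      · exact ⟨none, none_mem_insertNone, mem_union.2 hv⟩
      · exact ⟨some W, some_mem_insertNone.2 hW, hv⟩
  set d := 2 * k - 3 * l with hd
  have hdk : (d : ℝ) ≤ 2 * k := by exact_mod_cast (by omega : d ≤ 2 * k)
  have hconn : ConnIn H k l (I.card * d) Y := by
    intro A B Z hA hB hAB hZ
    refine hYc A B Z hA hB hAB ?_
    have h6 : (Z.card : ℝ) ≤ (Ps.card + 1) * d := by rw [hIc] at hZ; exact_mod_cast hZ
    calc (Z.card : ℝ) ≤ (Ps.card + 1) * d := h6
      _ ≤ (μ * n + 1) * (2 * k) := by gcongr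
      _ < c * n := by nlinarith
  have hp0 : ∀ o ∈ I, PathOn H k l (A o) (B o) (F ∅ o) := hpath ∅ (by rwa [union_empty])
  obtain ⟨i, hi, j, hj, R, hRY, hRc, hR⟩ := hconn.chain
    ⟨none, none_mem_insertNone⟩ (fun o ho => (hp0 o ho).cardA) (fun o ho => (hp0 o ho).cardB)
    (fun o ho => (hp0 o ho).subA) (fun o ho => (hp0 o ho).subB)
    (hdisj ∅ (disjoint_empty_left _)) le_rfl
  have hR' : ∀ D, PathOn H k l A₀ B₀ (P ∪ D) → Disjoint D Q → Disjoint D R →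
      PathOn H k l (A i) (B j) (P ∪ D ∪ Q ∪ R) := by
    intro D hD hDQ hDR
    rw [← hFU]
    exact hR (F D) (hpath D hD) (hdisj D hDQ) (hFR D R hRY hDR)
  have hmain := hR' ∅ (by rwa [union_empty]) (disjoint_empty_left _) (disjoint_empty_left _)
  rw [union_empty] at hmain
  obtain ⟨X, hXY, -, hXR, hX⟩ := hconn (B j) (A i) R hmain.cardB hmain.cardA hmain.dAB.symm hRc
  have hWX : Disjoint (P ∪ Q ∪ R) X := disjoint_union_left.2
    ⟨disjoint_union_left.2 ⟨hYP.symm.mono_right hXY, hQZ.2.mono_right hXY⟩, hXR.symm⟩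
  have hdv := LP.card_union_dvd hlk hmain hX hWX
  set D := univ \ (P ∪ Q ∪ R ∪ X) with hD
  have hDd : Disjoint D (P ∪ Q ∪ R ∪ X) := sdiff_disjoint
  simp only [disjoint_union_right] at hDd
  have hDdvd : (k - l) ∣ D.card := by
    have h6 := card_sdiff_add_card_eq_card (subset_univ (P ∪ Q ∪ R ∪ X))
    rw [card_univ, Fintype.card_fin] at h6
    rw [← h6] at hdvd
    exact (Nat.dvd_add_left hdv).1 hdvd
  have hDc : (D.card : ℝ) ≤ a * n := by
    have h6 : D ⊆ (univ \ (P ∪ Y ∪ Q)) ∪ Y := by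
      intro v hv
      simp only [hD, mem_sdiff, mem_union, mem_univ, true_and] at hv ⊢
      tauto
    have h7 : (D.card : ℝ) ≤ (univ \ (P ∪ Y ∪ Q)).card + Y.card := by
      exact_mod_cast (card_le_card h6).trans (card_union_le _ _)
    nlinarith
  obtain ⟨X₀, hX₀, hX₀W⟩ := hR' D (habs D hDd.1.1.1 hDdvd hDc) hDd.1.1.2 hDd.1.2
  refine hasHamiltonCycle_of_paths (by omega) hlk hX₀ hX ?_ ?_
  · have h6 : X₀ ⊆ P ∪ D ∪ Q ∪ R := by
      rw [← hX₀W]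
      exact subset_union_right.trans subset_union_left
    refine Disjoint.mono_left h6 ?_
    simp only [disjoint_union_left] at hWX ⊢
    exact ⟨⟨⟨hWX.1.1, hDd.2⟩, hWX.1.2⟩, hWX.2⟩
  · rw [hX₀W, eq_univ_iff_forall]
    intro v
    simp only [hD, mem_union, mem_sdiff, mem_univ, true_and]
    tauto

end Assembly

section Thresholds

open Finset Filter

theorem hDeg_eq_card_filter {n k : ℕ} {H : Finset (Finset (Fin n))} (hH : IsKGraph n k H)
    (S : Finset (Fin n)) : hDeg n k H S = (H.filter (S ⊆ ·)).card := by
  rw [hDeg, Nat.card_eq_fintype_card, Fintype.card_subtype]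
  refine card_nbij' (S ∪ ·) (· \ S) (fun T hT => ?_) (fun e he => ?_) (fun T hT => ?_)
    fun e he => ?_
  · simp only [mem_coe, mem_filter] at hT ⊢
    exact ⟨hT.2.2.2, subset_union_left⟩
  · simp only [mem_coe, mem_filter] at he ⊢
    refine ⟨mem_univ _, ?_, disjoint_sdiff, ?_⟩
    · rw [card_sdiff_of_subset he.2, hH _ he.1]
    · rw [union_sdiff_of_subset he.2]
      exact he.1
  · simp only [mem_coe, mem_filter] at hT
    exact union_sdiff_cancel_left hT.2.2.1
  · simp only [mem_coe, mem_filter] at he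
    exact union_sdiff_of_subset he.2

theorem DegDense.of_le_minDeg {n k l : ℕ} {H : Finset (Finset (Fin n))} (hH : IsKGraph n k H)
    {c : ℝ} (h : c * (n.choose (k - l) : ℝ) ≤ minDeg n k l H) : DegDense k l c H := by
  refine ⟨hH, fun S hS => ?_⟩
  rw [Fintype.card_fin, ← hDeg_eq_card_filter hH S]
  have h1 : minDeg n k l H ≤ hDeg n k H S := Nat.sInf_le ⟨S, hS, rfl⟩
  exact h.trans (by exact_mod_cast h1)

theorem exists_hDeg_eq_minDeg {n l : ℕ} (k : ℕ) (hln : l ≤ n) (H : Finset (Finset (Fin n))) :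
    ∃ S : Finset (Fin n), S.card = l ∧ hDeg n k H S = minDeg n k l H := by
  obtain ⟨S, -, hS⟩ := exists_subset_card_eq (s := (univ : Finset (Fin n))) (n := l) (by simpa)
  exact Nat.sInf_mem (s := {m | ∃ S : Finset (Fin n), S.card = l ∧ hDeg n k H S = m})
    ⟨_, S, hS, rfl⟩

theorem DegDense.le_minDeg {n k l : ℕ} {H : Finset (Finset (Fin n))} {c : ℝ} (hln : l ≤ n)
    (h : DegDense k l c H) : c * (n.choose (k - l) : ℝ) ≤ minDeg n k l H := by
  obtain ⟨S, hS, hm⟩ := exists_hDeg_eq_minDeg k hln H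
  have := h.2 S hS
  rwa [Fintype.card_fin, ← hDeg_eq_card_filter h.1 S, hm] at this

theorem minDeg_le_choose {n k l : ℕ} (hln : l ≤ n) (H : Finset (Finset (Fin n))) :
    minDeg n k l H ≤ n.choose (k - l) := by
  obtain ⟨S, hS, hm⟩ := exists_hDeg_eq_minDeg k hln H
  rw [← hm, hDeg, Nat.card_eq_fintype_card]
  refine (Fintype.card_subtype_mono _ (fun T => T.card = k - l) fun T hT => hS ▸ hT.1).trans ?_
  rw [Fintype.card_finset_len, Fintype.card_fin]

theorem tThreshold_le {k l n : ℕ} (hln : l ≤ n) (ε : ℝ) :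
    tThreshold k l l n ε ≤ n.choose (k - l) + 1 :=
  Nat.sInf_le fun H _ h => by have := minDeg_le_choose (k := k) hln H; omega

theorem hasYTilingCover_of_tThreshold_le {k l n : ℕ} (hln : l ≤ n) {ε : ℝ}
    {H : Finset (Finset (Fin n))} (hH : IsKGraph n k H)
    (h : tThreshold k l l n ε ≤ minDeg n k l H) : HasYTilingCover n l H (ε * n) :=
  Nat.sInf_mem (s := {t : ℕ | ∀ H : Finset (Finset (Fin n)), IsKGraph n k H →
    t ≤ minDeg n k l H → HasYTilingCover n l H (ε * n)})
    ⟨n.choose (k - l) + 1, fun H _ h => by have := minDeg_le_choose (k := k) hln H; omega⟩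
    H hH h

theorem tThreshold_anti {k l n : ℕ} (hln : l ≤ n) {ε ε' : ℝ} (h : ε ≤ ε') :
    tThreshold k l l n ε' ≤ tThreshold k l l n ε :=
  Nat.sInf_le fun H hH hm => by
    obtain ⟨m, e₁, e₂, h1, h2, h3⟩ := hasYTilingCover_of_tThreshold_le hln hH hm
    exact ⟨m, e₁, e₂, h1, h2, h3.trans (mul_le_mul_of_nonneg_right h (Nat.cast_nonneg n))⟩

theorem tThreshold_div_choose_le {k l n : ℕ} (hlk : l ≤ k) (hkn : k ≤ n) (ε : ℝ) :
    (tThreshold k l l n ε : ℝ) / (n.choose (k - l) : ℝ) ≤ 2 := by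
  have h1 : 0 < n.choose (k - l) := Nat.choose_pos (by omega)
  rw [div_le_iff₀ (by exact_mod_cast h1)]
  have := tThreshold_le (k := k) (hlk.trans hkn) ε
  exact_mod_cast (by omega : tThreshold k l l n ε ≤ 2 * n.choose (k - l))

theorem isBoundedUnder_tThreshold {k l : ℕ} (hlk : l ≤ k) (ε : ℝ) :
    IsBoundedUnder (· ≤ ·) atTop
      fun n : ℕ => (tThreshold k l l n ε : ℝ) / (n.choose (k - l) : ℝ) :=
  ⟨2, eventually_map.2 ((eventually_ge_atTop k).mono fun _ hn =>
    tThreshold_div_choose_le hlk hn ε)⟩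

theorem isBoundedUnder_ge_tThreshold (k l : ℕ) (ε : ℝ) :
    IsBoundedUnder (· ≥ ·) atTop
      fun n : ℕ => (tThreshold k l l n ε : ℝ) / (n.choose (k - l) : ℝ) :=
  ⟨0, eventually_map.2 (Eventually.of_forall fun _ => by positivity)⟩

/-- The inner upper limit in the definition of `tVal`. -/
noncomputable def tLim (k l : ℕ) (ε : ℝ) : ℝ :=
  limsup (fun n : ℕ => (tThreshold k l l n ε : ℝ) / (n.choose (k - l) : ℝ)) atTop

theorem tLim_nonneg {k l : ℕ} (hlk : l ≤ k) (ε : ℝ) : 0 ≤ tLim k l ε :=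
  le_limsup_of_frequently_le (Eventually.of_forall fun _ => by positivity).frequently
    (isBoundedUnder_tThreshold hlk ε)

theorem tLim_le_two {k l : ℕ} (hlk : l ≤ k) (ε : ℝ) : tLim k l ε ≤ 2 :=
  limsup_le_of_le (isBoundedUnder_ge_tThreshold k l ε).isCoboundedUnder_le
    ((eventually_ge_atTop k).mono fun _ hn => tThreshold_div_choose_le hlk hn ε)

theorem tLim_anti {k l : ℕ} (hlk : l ≤ k) : Antitone (tLim k l) := fun ε ε' h =>
  limsup_le_limsup ((eventually_ge_atTop l).mono fun n hn =>
    div_le_div_of_nonneg_right (by exact_mod_cast tThreshold_anti hn h) (by positivity))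
    (isBoundedUnder_ge_tThreshold k l ε').isCoboundedUnder_le (isBoundedUnder_tThreshold hlk ε)

theorem tLim_le_tVal {k l : ℕ} (hlk : l ≤ k) {ε : ℝ} (hε : 0 < ε) : tLim k l ε ≤ tVal k l l := by
  refine le_limsup_of_frequently_le (Eventually.frequently ?_)
    ⟨2, eventually_map.2 (Eventually.of_forall (tLim_le_two hlk))⟩
  exact mem_of_superset (Ioo_mem_nhdsGT hε) fun ε' h => tLim_anti hlk h.2.le

theorem tVal_nonneg {k l : ℕ} (hlk : l ≤ k) : 0 ≤ tVal k l l :=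
  (tLim_nonneg hlk 1).trans (tLim_le_tVal hlk one_pos)

theorem exists_hasYTilingCover_of_tVal_lt {k l : ℕ} (hlk : l ≤ k) {t : ℝ} (ht : tVal k l l < t)
    {ε : ℝ} (hε : 0 < ε) :
    ∃ n₀ : ℕ, ∀ n ≥ n₀, ∀ H : Finset (Finset (Fin n)), DegDense k l t H →
      HasYTilingCover n l H (ε * n) := by
  obtain ⟨N, hN⟩ := eventually_atTop.1 (eventually_lt_of_limsup_lt
    ((tLim_le_tVal hlk hε).trans_lt ht) (isBoundedUnder_tThreshold hlk ε))
  refine ⟨N + k, fun n hn H hH => ?_⟩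
  have h1 := hN n (by omega)
  rw [div_lt_iff₀ (by exact_mod_cast Nat.choose_pos (by omega))] at h1
  exact hasYTilingCover_of_tThreshold_le (by omega) hH.1
    (by exact_mod_cast h1.le.trans (hH.le_minDeg (by omega)))

theorem sub_le_choose_succ (n r : ℕ) : n - r ≤ n.choose (r + 1) := by
  induction n with
  | zero => simp
  | succ n ih =>
    rcases le_or_gt r n with h | h
    · have := Nat.choose_pos h
      rw [Nat.choose_succ_succ']
      omega
    · omega

theorem hVal_le_of_forall {k l : ℕ} (hlk : l < k) {M : ℝ} (hM : 0 ≤ M)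
    (h : ∀ η : ℝ, 0 < η → ∃ n₀ : ℕ, ∀ n : ℕ, n₀ ≤ n → (k - l) ∣ n →
      ∀ H : Finset (Finset (Fin n)), IsKGraph n k H →
        (M + η) * (n.choose (k - l) : ℝ) ≤ (minDeg n k l H : ℝ) → HasHamiltonCycle n k l H) :
    hVal k l l ≤ M := by
  have hne : (atTop ⊓ 𝓟 {m : ℕ | (k - l) ∣ m}).NeBot := by
    rw [← frequently_mem_iff_neBot, frequently_atTop]
    exact fun a => ⟨a * (k - l), Nat.le_mul_of_pos_right a (by omega), dvd_mul_left _ _⟩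
  refine le_of_forall_pos_le_add fun η hη => limsup_le_of_le
    (IsBoundedUnder.isCoboundedUnder_le
      ⟨0, eventually_map.2 (Eventually.of_forall fun _ => by positivity)⟩) ?_
  obtain ⟨n₀, hn₀⟩ := h (η / 2) (by positivity)
  obtain ⟨N, hN⟩ := exists_nat_gt (1 / (η / 2))
  rw [div_lt_iff₀ (by positivity)] at hN
  rw [eventually_inf_principal, eventually_atTop]
  refine ⟨n₀ + N + k, fun n hn hdvd => ?_⟩
  have hpos : 0 < n.choose (k - l) := Nat.choose_pos (by omega)
  have hN' : (N : ℝ) ≤ n.choose (k - l) := by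
    have h1 := sub_le_choose_succ n (k - l - 1)
    rw [Nat.sub_add_cancel (by omega : 1 ≤ k - l)] at h1
    exact_mod_cast (by omega : N ≤ n - (k - l - 1)).trans h1
  rw [div_le_iff₀ (by exact_mod_cast hpos)]
  have h1 : hThreshold k l l n ≤ ⌈(M + η / 2) * (n.choose (k - l) : ℝ)⌉₊ :=
    Nat.sInf_le fun H hH hm => hn₀ n (by omega) hdvd H hH
      ((Nat.le_ceil _).trans (by exact_mod_cast hm))
  have h2 := Nat.ceil_lt_add_one (a := (M + η / 2) * (n.choose (k - l) : ℝ)) (by positivity)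
  have h3 : (hThreshold k l l n : ℝ) ≤ (⌈(M + η / 2) * (n.choose (k - l) : ℝ)⌉₊ : ℝ) := by
    exact_mod_cast h1
  nlinarith

end Thresholds

/-- For `η > 0`, `k ≥ 5` and `2 ≤ ℓ < k/2`, every sufficiently large
`k`-graph `H` with `(k-ℓ) ∣ n` and
`δ_ℓ(H) ≥ (max{(1/2)^{(k-ℓ)/ℓ}, t(k,ℓ,ℓ)} + η) C(n, k-ℓ)` contains a Hamilton `ℓ`-cycle;
consequently `h_ℓ^ℓ(k) ≤ max{(1/2)^{(k-ℓ)/ℓ}, t(k,ℓ,ℓ)}`. -/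
theorem hamilton_ell_degree (η : ℝ) (hη : 0 < η) (k l : ℕ)
    (hk : 5 ≤ k) (hl : 2 ≤ l) (hlk : 2 * l < k) :
    (∃ n₀ : ℕ, ∀ n : ℕ, n₀ ≤ n → (k - l) ∣ n →
      ∀ H : Finset (Finset (Fin n)), IsKGraph n k H →
        (max (((1 : ℝ) / 2) ^ ((((k : ℝ)) - (l : ℝ)) / (l : ℝ))) (tVal k l l) + η) *
            (n.choose (k - l) : ℝ) ≤ (minDeg n k l H : ℝ) →
        HasHamiltonCycle n k l H) ∧
    hVal k l l ≤ max (((1 : ℝ) / 2) ^ ((((k : ℝ)) - (l : ℝ)) / (l : ℝ))) (tVal k l l) := by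
  have hlk' : l ≤ k := by omega
  have hmain : ∀ η : ℝ, 0 < η → ∃ n₀ : ℕ, ∀ n : ℕ, n₀ ≤ n → (k - l) ∣ n →
      ∀ H : Finset (Finset (Fin n)), IsKGraph n k H →
        (max (((1 : ℝ) / 2) ^ ((((k : ℝ)) - (l : ℝ)) / (l : ℝ))) (tVal k l l) + η) *
            (n.choose (k - l) : ℝ) ≤ (minDeg n k l H : ℝ) →
        HasHamiltonCycle n k l H := by
    intro η hη
    have ht0 := tVal_nonneg hlk'
    obtain ⟨n₀, hn₀⟩ := exists_hasHamiltonCycle_of_degDense hl hlk (t := tVal k l l + η / 2)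
      (η := η / 2) (by positivity) (by positivity)
      fun ε hε => exists_hasYTilingCover_of_tVal_lt hlk' (by linarith) hε
    refine ⟨n₀, fun n hn hdvd H hH hdeg => hn₀ n hn hdvd H ?_ ?_⟩
    · rw [Nat.cast_sub hlk']
      exact (DegDense.of_le_minDeg hH hdeg).mono
        (add_le_add (le_max_left _ _) (by linarith))
    · refine (DegDense.of_le_minDeg hH hdeg).mono ?_
      rw [add_assoc, add_halves]
      exact add_le_add_left (le_max_right _ _) η
  exact ⟨hmain η hη, hVal_le_of_forall (by omega) (by positivity) hmain⟩
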